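/- Let f, g ∈ ℤ[x] be monic with f quadratic, and let γ ∈ ℚ be the critical point of f. Suppose that g ∘ f^n is irreducible over ℚ for all n ≥ 0, that the set {g(f^n(γ)) : n ≥ 1} ⊆ ℚ is infinite, and that the sequence (g(f^n(γ)))_{n≥1} is a rigid divisibility sequence away from 2, i.e. g(f^n(γ)) ≠ 0 for all n ≥ 1 and for every prime p ≠ 2 and all n, m ≥ 1, if v_p(g(f^n(γ))) > 0 then v_p(g(f^{mn}(γ))) = v_p(g(f^n(γ))), where v_p is the p-adic valuation on ℚ. Then for every a₀ ∈ ℤ, the natural density of P(g, f, a₀) exists and equals 0. -/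

import Mathlib

open Polynomial Filter

/-- The `n`-th iterate of a polynomial, with `f^0 = X`. -/
noncomputable def polyIter (f : Polynomial ℤ) : ℕ → Polynomial ℤ
  | 0 => X
  | n + 1 => f.comp (polyIter f n)

open scoped Classical in
/-- The number of elements of `S` that are at most `x`. -/
noncomputable def primeCount (S : Set ℕ) (x : ℕ) : ℕ :=
  ((Finset.range (x + 1)).filter (fun p => p ∈ S)).card

/-- A set `S` of primes has natural density zero:
`lim_{x → ∞} #{p ∈ S : p ≤ x} / #{p prime : p ≤ x}` exists and equals `0`. -/
def HasPrimeDensityZero (S : Set ℕ) : Prop :=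
  Tendsto (fun x : ℕ => (primeCount S x : ℝ) / (primeCount {p | p.Prime} x : ℝ))
    atTop (nhds 0)

/-- `P(g, f, a₀)`: the set of primes dividing some nonzero term of the sequence
`(g(f^n(a₀)))_{n ≥ 0}`. -/
def transOrbitPrimes (g f : Polynomial ℤ) (a₀ : ℤ) : Set ℕ :=
  {p | p.Prime ∧ ∃ n : ℕ, Polynomial.eval ((fun x => Polynomial.eval x f)^[n] a₀) g ≠ 0 ∧
    (p : ℤ) ∣ Polynomial.eval ((fun x => Polynomial.eval x f)^[n] a₀) g}


namespace SelbergBound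
open MeasureTheory Finset

/-- partial sums -/
noncomputable def psum (c : ℕ → ℝ) (t : ℝ) : ℝ := ∑ k ∈ Icc 0 ⌊t⌋₊, c k

lemma measurable_psum (c : ℕ → ℝ) : Measurable (psum c) := by
  have h : Measurable (fun n : ℕ => ∑ k ∈ Icc 0 n, c k) := measurable_from_top
  exact h.comp Nat.measurable_floor

lemma tail_int (e : ℝ → ℝ) (he : Measurable e) (C δ : ℝ) (hδ : 0 < δ)
    (hb : ∀ t, 1 ≤ t → |e t| ≤ C * t ^ (-1 - δ)) :
    IntegrableOn e (Set.Ioi 1) ∧ ∃ c K : ℝ, ∀ y, 1 ≤ y → |(∫ t in (1:ℝ)..y, e t) - c| ≤ K * y ^ (-δ) := by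
  have hintg : ∀ y : ℝ, 1 ≤ y → IntegrableOn (fun t : ℝ => C * t ^ (-1 - δ)) (Set.Ioi y) := fun y hy =>
    (integrableOn_Ioi_rpow_of_lt (by linarith) (by linarith)).const_mul C
  have hbd : ∀ y : ℝ, 1 ≤ y → ∀ᵐ t ∂(volume.restrict (Set.Ioi y)), ‖e t‖ ≤ C * t ^ (-1 - δ) := by
    intro y hy
    refine (ae_restrict_iff' measurableSet_Ioi).2 (Filter.Eventually.of_forall fun t ht => ?_)
    exact hb t (hy.trans (le_of_lt ht))
  have hI : ∀ y : ℝ, 1 ≤ y → IntegrableOn e (Set.Ioi y) := fun y hy =>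
    Integrable.mono' (hintg y hy) he.aestronglyMeasurable (hbd y hy)
  refine ⟨hI 1 le_rfl, ∫ t in Set.Ioi 1, e t, C / δ, fun y hy => ?_⟩
  have h1 := intervalIntegral.integral_interval_add_Ioi (hI 1 le_rfl) (hI y hy)
  have h2 : |∫ t in Set.Ioi y, e t| ≤ ∫ t in Set.Ioi y, C * t ^ (-1 - δ) :=
    norm_integral_le_of_norm_le (hintg y hy) (hbd y hy)
  rw [integral_const_mul, integral_Ioi_rpow_of_lt (by linarith) (by linarith)] at h2
  have h3 : (∫ t in (1:ℝ)..y, e t) - ∫ t in Set.Ioi 1, e t = - ∫ t in Set.Ioi y, e t := by linarith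
  rw [h3, abs_neg]
  refine h2.trans (le_of_eq ?_)
  rw [show (-1 - δ + 1) = -δ by ring]
  field_simp

lemma asym_int (T : ℝ → ℝ) (hT : Measurable T) (a b C δ : ℝ) (hδ : 0 < δ)
    (hb : ∀ t, 1 ≤ t → |T t - (a * Real.log t + b)| ≤ C * t ^ (-δ)) :
    ∃ c K : ℝ, ∀ y, 1 ≤ y →
      |(∫ t in (1:ℝ)..y, T t / t) - (a / 2 * Real.log y ^ 2 + b * Real.log y + c)| ≤ K * y ^ (-δ) := by
  have hm : Measurable (fun t => (T t - (a * Real.log t + b)) / t) := by fun_prop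
  obtain ⟨hI, c, K, h⟩ := tail_int (fun t => (T t - (a * Real.log t + b)) / t) hm C δ hδ (by
    intro t ht
    have ht0 : 0 < t := by linarith
    rw [abs_div, abs_of_pos ht0, show (-1 - δ) = -δ - 1 by ring, Real.rpow_sub_one ht0.ne', ← mul_div_assoc]
    exact div_le_div_of_nonneg_right (hb t ht) ht0.le)
  refine ⟨c, K, fun y hy => ?_⟩
  have hsub : Set.Ioc 1 y ⊆ Set.Ioi (1:ℝ) := fun t ht => ht.1
  have i1 : IntervalIntegrable (fun t => (T t - (a * Real.log t + b)) / t) volume 1 y := by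
    rw [intervalIntegrable_iff_integrableOn_Ioc_of_le hy]; exact hI.mono_set hsub
  have hder : ∀ t ∈ Set.uIcc 1 y, HasDerivAt (fun t => a / 2 * Real.log t ^ 2 + b * Real.log t)
      ((a * Real.log t + b) / t) t := by
    intro t ht
    rw [Set.uIcc_of_le hy] at ht
    have ht0 : t ≠ 0 := by linarith [ht.1]
    have := (((Real.hasDerivAt_log ht0).pow 2).const_mul (a/2)).add ((Real.hasDerivAt_log ht0).const_mul b)
    refine this.congr_deriv ?_
    norm_num
    ring
  have i2 : IntervalIntegrable (fun t => (a * Real.log t + b) / t) volume 1 y := by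
    apply ContinuousOn.intervalIntegrable
    rw [Set.uIcc_of_le hy]
    apply ContinuousOn.div
    · apply ContinuousOn.add _ continuousOn_const
      apply ContinuousOn.mul continuousOn_const
      exact Real.continuousOn_log.mono (fun t ht => by simp; linarith [ht.1])
    · exact continuousOn_id
    · intro t ht; linarith [ht.1]
  have h2 := intervalIntegral.integral_eq_sub_of_hasDerivAt hder i2
  have h3 := intervalIntegral.integral_add i1 i2
  have h4 : ∀ t, (T t - (a * Real.log t + b)) / t + (a * Real.log t + b) / t = T t / t := by
    intro t; ring
  simp only [h4] at h3
  rw [h3, h2]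
  have := h y hy
  simp only [Real.log_one]
  convert this using 2
  ring

lemma abel_inv (r : ℕ → ℝ) (h0 : r 0 = 0) (y : ℝ) (hy : 1 ≤ y) :
    psum (fun k => r k / k) y = psum r y / y + ∫ t in (1:ℝ)..y, (psum r t / t) / t := by
  have h := sum_mul_eq_sub_integral_mul₀ (f := fun t : ℝ => t⁻¹) r h0 y (by
    intro t ht
    exact differentiableAt_inv (by linarith [ht.1])) (by
    apply ContinuousOn.integrableOn_Icc
    rw [show deriv (fun t : ℝ => t⁻¹) = fun t => -(t^2)⁻¹ by ext; simp]
    apply ContinuousOn.neg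
    apply ContinuousOn.inv₀ (by fun_prop)
    intro t ht; have := ht.1; positivity)
  rw [intervalIntegral.integral_of_le hy]
  simp only [deriv_inv] at h
  rw [psum]
  simp only [div_eq_inv_mul] at *
  rw [h, psum, sub_eq_add_neg, ← integral_neg]
  congr 1
  apply integral_congr_ae
  refine Filter.Eventually.of_forall fun t => ?_
  simp only [psum]
  rcases eq_or_ne t 0 with rfl | ht
  · simp
  field_simp

lemma abel_log (c : ℕ → ℝ) (h0 : c 0 = 0) (y : ℝ) (hy : 1 ≤ y) :
    psum (fun k => c k * Real.log (y / k)) y = ∫ t in (1:ℝ)..y, psum c t / t := by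
  have hd : ∀ t : ℝ, t ≠ 0 → HasDerivAt (fun t : ℝ => Real.log y - Real.log t) (-t⁻¹) t := by
    intro t ht
    have := (Real.hasDerivAt_log ht).const_sub (Real.log y)
    simpa using this
  have hde : Set.EqOn (deriv (fun t : ℝ => Real.log y - Real.log t)) (fun t => -t⁻¹) (Set.Icc 1 y) := by
    intro t ht
    exact (hd t (by linarith [ht.1])).deriv
  have h := sum_mul_eq_sub_integral_mul₀ (f := fun t : ℝ => Real.log y - Real.log t) c h0 y (by
    intro t ht
    exact (hd t (by linarith [ht.1])).differentiableAt) (by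
    rw [integrableOn_congr_fun hde measurableSet_Icc]
    apply ContinuousOn.integrableOn_Icc
    apply ContinuousOn.neg
    apply ContinuousOn.inv₀ (by fun_prop)
    intro t ht; have := ht.1; positivity)
  rw [intervalIntegral.integral_of_le hy]
  rw [sub_self, zero_mul, zero_sub, ← integral_neg] at h
  rw [psum]
  trans ∑ k ∈ Icc 0 ⌊y⌋₊, (Real.log y - Real.log k) * c k
  · apply sum_congr rfl
    intro k hk
    rcases Nat.eq_zero_or_pos k with rfl | hk
    · simp [h0]
    · rw [Real.log_div (by linarith) (by positivity)]; ring
  rw [h]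
  apply setIntegral_congr_fun measurableSet_Ioc
  intro t ht
  have : t ∈ Set.Icc 1 y := ⟨ht.1.le, ht.2⟩
  simp only [hde this, psum]
  ring

/-- asymptotics of `H` and `H2` -/
lemma asym_H (r : ℕ → ℝ) (h0 : r 0 = 0) (ρ C δ : ℝ) (hδ : 0 < δ)
    (hR : ∀ y, 1 ≤ y → |psum r y - ρ * y| ≤ C * y ^ (1 - δ)) :
    ∃ c1 c2 K : ℝ, ∀ y, 1 ≤ y →
      |psum (fun k => r k / k) y - (ρ * Real.log y + c1)| ≤ K * y ^ (-δ) ∧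
      |psum (fun k => r k / k * Real.log (y / k)) y -
        (ρ / 2 * Real.log y ^ 2 + c1 * Real.log y + c2)| ≤ K * y ^ (-δ) := by
  have hA : ∀ t, 1 ≤ t → |psum r t / t - ρ| ≤ C * t ^ (-δ) := by
    intro t ht
    have ht0 : 0 < t := by linarith
    have := hR t ht
    rw [show psum r t / t - ρ = (psum r t - ρ * t) / t by field_simp, abs_div, abs_of_pos ht0,
      div_le_iff₀ ht0]
    refine this.trans (le_of_eq ?_)
    rw [mul_assoc]; congr 1
    rw [show (1 - δ) = -δ + 1 by ring, Real.rpow_add_one ht0.ne']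
  obtain ⟨c, K, h⟩ := asym_int (fun t => psum r t / t) ((measurable_psum r).div measurable_id) 0 ρ C δ hδ (by
    intro t ht; simpa using hA t ht)
  have hH : ∀ y, 1 ≤ y → |psum (fun k => r k / k) y - (ρ * Real.log y + (ρ + c))| ≤ (K + C) * y ^ (-δ) := by
    intro y hy
    rw [abel_inv r h0 y hy]
    have h1 := h y hy
    have h2 := hA y hy
    rw [abs_le] at *
    constructor <;> linarith
  obtain ⟨c2, K2, h2⟩ := asym_int _ (measurable_psum (fun k => r k / k)) ρ (ρ + c) (K + C) δ hδ hH
  refine ⟨ρ + c, c2, max (K + C) K2, fun y hy => ?_⟩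
  have hy0 : 0 ≤ y ^ (-δ) := by positivity
  constructor
  · exact (hH y hy).trans (mul_le_mul_of_nonneg_right (le_max_left _ _) hy0)
  · rw [abel_log (fun k => r k / k) (by simp [h0]) y hy]
    exact (h2 y hy).trans (mul_le_mul_of_nonneg_right (le_max_right _ _) hy0)

end SelbergBound

namespace SelbergBound
open MeasureTheory Finset ArithmeticFunction

/-- log-derivation -/
noncomputable def dlog (f : ArithmeticFunction ℝ) : ArithmeticFunction ℝ :=
  ⟨fun n => f n * Real.log n, by simp⟩

lemma dlog_apply (f : ArithmeticFunction ℝ) (n : ℕ) : dlog f n = f n * Real.log n := rfl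

lemma dlog_mul (f g : ArithmeticFunction ℝ) : dlog (f * g) = dlog f * g + f * dlog g := by
  ext n
  simp only [dlog_apply, mul_apply, ArithmeticFunction.add_apply, sum_mul, ← sum_add_distrib]
  apply sum_congr rfl
  intro x hx
  rw [Nat.mem_divisorsAntidiagonal] at hx
  have h1 : x.1 ≠ 0 := by rintro h; simp [h] at hx; exact hx.2 hx.1.symm
  have h2 : x.2 ≠ 0 := by rintro h; simp [h] at hx; exact hx.2 hx.1.symm
  rw [← hx.1]; push_cast
  rw [Real.log_mul (by positivity) (by positivity)]; ring

lemma sum_conv_phi (u v : ArithmeticFunction ℝ) (φ : ℕ → ℝ) (N : ℕ) :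
    ∑ d ∈ Ioc 0 N, u d * ∑ b ∈ Ioc 0 (N / d), v b * φ (d * b) = ∑ n ∈ Ioc 0 N, (u * v) n * φ n := by
  have h1 : ∀ n ∈ Ioc 0 N, (u * v) n * φ n =
      ∑ x ∈ Ioc 0 N ×ˢ Ioc 0 N with x.1 * x.2 = n, u x.1 * v x.2 * φ (x.1 * x.2) := by
    intro n hn
    simp only [mem_Ioc] at hn
    rw [mul_apply, sum_mul, Nat.divisorsAntidiagonal_eq_prod_filter_of_le hn.1.ne' hn.2]
    apply sum_congr rfl
    intro x hx
    rw [(mem_filter.1 hx).2]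
  rw [sum_congr rfl h1]
  simp_rw [sum_filter]
  rw [sum_comm]
  rw [sum_product]
  apply sum_congr rfl
  intro d hd
  simp only [mem_Ioc] at hd
  rw [mul_sum]
  have : Ioc 0 (N / d) ⊆ Ioc 0 N := Ioc_subset_Ioc_right (Nat.div_le_self _ _)
  rw [← sum_subset_zero_on_sdiff this (f := fun b => u d * (v b * φ (d * b)))
    (g := fun b => ∑ n ∈ Ioc 0 N, if d * b = n then u d * v b * φ (d * b) else 0)]
  · intro b hb
    simp only [Finset.mem_sdiff, mem_Ioc, not_and, not_le] at hb
    rw [sum_ite_eq]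
    rw [if_neg]
    simp only [mem_Ioc, not_and, not_le]
    intro _
    have := hb.2 hb.1.1
    rw [Nat.div_lt_iff_lt_mul hd.1] at this
    linarith
  · intro b hb
    simp only [mem_Ioc] at hb
    rw [sum_ite_eq, if_pos]
    · ring
    · simp only [mem_Ioc]
      refine ⟨Nat.mul_pos hd.1 hb.1, ?_⟩
      rw [mul_comm]
      exact (Nat.le_div_iff_mul_le hd.1).1 hb.2

lemma psum_eq (c : ℕ → ℝ) (h0 : c 0 = 0) (N d : ℕ) :
    psum c ((N : ℝ) / d) = ∑ b ∈ Ioc 0 (N / d), c b := by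
  rw [psum, Nat.floor_div_natCast, Nat.floor_natCast, Icc_eq_cons_Ioc (Nat.zero_le _), sum_cons, h0, zero_add]

/-- `∑ r(d) (N/d)^s ≤ K N` for `s<1`. -/
lemma sum_pow_le (r : ℕ → ℝ) (hr : ∀ n, 0 ≤ r n) (h0 : r 0 = 0) (s C : ℝ) (hs : s < 1) (hs0 : 0 ≤ s)
    (hC : ∀ y, 1 ≤ y → psum r y ≤ C * y) :
    ∃ K, ∀ N : ℕ, ∑ d ∈ Ioc 0 N, r d * ((N : ℝ) / d) ^ s ≤ K * N := by
  have hsum : Summable (fun k : ℕ => (k : ℝ) ^ (s - 2)) := by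
    rw [Real.summable_nat_rpow]; linarith
  have hC0 : 0 ≤ C := by
    have h1 := hC 1 le_rfl
    have : 0 ≤ psum r 1 := sum_nonneg fun k _ => hr k
    linarith
  refine ⟨2 ^ s * (C * ∑' k : ℕ, (k : ℝ) ^ (s - 2)), fun N => ?_⟩
  -- swap
  let rA : ArithmeticFunction ℝ := ⟨r, h0⟩
  let kA : ArithmeticFunction ℝ := ⟨fun k => if k = 0 then 0 else (k : ℝ) ^ (s - 1), by simp⟩
  have hswap : ∑ d ∈ Ioc 0 N, r d * ∑ k ∈ Ioc 0 (N / d), kA k =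
      ∑ k ∈ Ioc 0 N, kA k * ∑ d ∈ Ioc 0 (N / k), r d := by
    have h1 := sum_Ioc_mul_eq_sum_sum rA kA N
    have h2 := sum_Ioc_mul_eq_sum_sum kA rA N
    rw [mul_comm] at h2
    exact h1.symm.trans h2
  have hpt : ∀ d ∈ Ioc 0 N, r d * ((N : ℝ) / d) ^ s ≤ 2 ^ s * (r d * ∑ k ∈ Ioc 0 (N / d), kA k) := by
    intro d hd
    simp only [mem_Ioc] at hd
    have hq : 1 ≤ N / d := (Nat.one_le_div_iff hd.1).2 hd.2
    set q := N / d with hqd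
    have hNd : (N : ℝ) / d ≤ 2 * q := by
      rw [div_le_iff₀ (by exact_mod_cast hd.1)]
      have : N < (q + 1) * d := by
        rw [hqd]; have := Nat.lt_div_mul_add hd.1 (a := N); linarith
      have h2 : N ≤ 2 * q * d := by nlinarith
      exact_mod_cast h2
    have h1 : ((N : ℝ) / d) ^ s ≤ 2 ^ s * (q : ℝ) ^ s := by
      rw [← Real.mul_rpow (by norm_num) (by positivity)]
      exact Real.rpow_le_rpow (by positivity) hNd hs0
    have h2 : (q : ℝ) ^ s ≤ ∑ k ∈ Ioc 0 q, kA k := by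
      have : ∑ k ∈ Ioc 0 q, (q : ℝ) ^ (s - 1) ≤ ∑ k ∈ Ioc 0 q, kA k := by
        apply sum_le_sum
        intro k hk
        simp only [mem_Ioc] at hk
        change _ ≤ (if k = 0 then (0:ℝ) else (k : ℝ) ^ (s - 1))
        rw [if_neg (by omega)]
        apply Real.rpow_le_rpow_of_nonpos (by exact_mod_cast hk.1) (by exact_mod_cast hk.2) (by linarith)
      refine le_trans (le_of_eq ?_) this
      rw [sum_const, Nat.card_Ioc, nsmul_eq_mul, Real.rpow_sub_one (by positivity)]
      have : (q : ℝ) ≠ 0 := by positivity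
      field_simp
      simp
    calc r d * ((N : ℝ) / d) ^ s ≤ r d * (2 ^ s * ∑ k ∈ Ioc 0 q, kA k) := by
          apply mul_le_mul_of_nonneg_left _ (hr d)
          exact h1.trans (mul_le_mul_of_nonneg_left h2 (by positivity))
      _ = _ := by ring
  refine (sum_le_sum hpt).trans ?_
  rw [← mul_sum, hswap, mul_assoc]
  apply mul_le_mul_of_nonneg_left _ (by positivity)
  have h3 : ∀ k ∈ Ioc 0 N, kA k * ∑ d ∈ Ioc 0 (N / k), r d ≤ C * N * (k : ℝ) ^ (s - 2) := by
    intro k hk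
    simp only [mem_Ioc] at hk
    have hk0 : (0:ℝ) < k := by exact_mod_cast hk.1
    rw [← psum_eq r h0]
    have h1 := hC ((N : ℝ) / k) (by rw [le_div_iff₀ hk0, one_mul]; exact_mod_cast hk.2)
    change (if k = 0 then (0:ℝ) else (k : ℝ) ^ (s - 1)) * _ ≤ _
    rw [if_neg (by omega)]
    refine (mul_le_mul_of_nonneg_left h1 (by positivity)).trans (le_of_eq ?_)
    rw [show s - 2 = s - 1 - 1 by ring, Real.rpow_sub_one hk0.ne' (s - 1)]
    ring
  refine (sum_le_sum h3).trans ?_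
  rw [← mul_sum]
  have h4 : ∑ k ∈ Ioc 0 N, (k : ℝ) ^ (s - 2) ≤ ∑' k : ℕ, (k : ℝ) ^ (s - 2) :=
    hsum.sum_le_tsum _ (fun k _ => by positivity)
  have := mul_le_mul_of_nonneg_left h4 (show 0 ≤ C * (N:ℝ) by positivity)
  linarith

lemma log_sq_le (δ : ℝ) (hδ : 0 < δ) : ∃ K, 0 ≤ K ∧ ∀ y : ℝ, 1 ≤ y → Real.log y ^ 2 * y ^ (1 - δ) ≤ K * y ^ (1 - δ / 2) := by
  refine ⟨(δ / 4)⁻¹ ^ 2, by positivity, fun y hy => ?_⟩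
  have hy0 : 0 < y := by linarith
  have h := Real.log_le_rpow_div hy0.le (show 0 < δ / 4 by positivity)
  have h2 : Real.log y ^ 2 ≤ (y ^ (δ/4) / (δ/4)) ^ 2 := pow_le_pow_left₀ (Real.log_nonneg hy) h 2
  refine (mul_le_mul_of_nonneg_right h2 (by positivity)).trans (le_of_eq ?_)
  rw [show (1 - δ/2) = δ/4 + δ/4 + (1 - δ) by ring, Real.rpow_add hy0, Real.rpow_add hy0]
  ring

theorem selberg_bound (r Lam : ArithmeticFunction ℝ) (hr : ∀ n, 0 ≤ r n) (hr1 : r 1 = 1)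
    (hLam : ∀ n, 0 ≤ Lam n) (hD : dlog r = r * Lam) (ρ C δ : ℝ) (hρ : 0 < ρ) (hδ : 0 < δ) (hδ1 : δ ≤ 1)
    (hR : ∀ y, 1 ≤ y → |psum r y - ρ * y| ≤ C * y ^ (1 - δ)) :
    ∃ K, ∀ N : ℕ, 1 ≤ N → Real.log N * ∑ n ∈ Ioc 0 N, Lam n ≤ 2 * N * Real.log N + K * N := by
  have r0 : r 0 = 0 := r.map_zero
  have hLam1 : Lam 1 = 0 := by
    have := congrArg (fun f => f 1) hD
    simpa [dlog_apply, hr1] using this.symm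
  let inv1 : Invertible (r 1) := ⟨1, by simp [hr1], by simp [hr1]⟩
  let m := dirichletInverse r inv1
  have hmr : m * r = 1 := dirichletInverse_mul_self r inv1
  have hrm : r * m = 1 := self_mul_dirichletInverse r inv1
  have hd1 : dlog 1 = 0 := by
    ext n; rw [dlog_apply, one_apply]; split_ifs with h <;> simp [h]
  have hDm : dlog m = - (m * Lam) := by
    have h1 : dlog (m * r) = dlog m * r + m * dlog r := dlog_mul m r
    rw [hmr, hd1, hD, ← mul_assoc, hmr, one_mul] at h1
    have h2 := congrArg (fun f => f * m) h1
    simp only [add_mul, mul_assoc, hrm, mul_one, zero_mul] at h2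
    rw [mul_comm Lam m] at h2
    exact eq_neg_of_add_eq_zero_left h2.symm
  have hm1 : m 1 = 1 := by
    have := congrArg (fun f => f 1) hmr
    simpa [hr1] using this
  have hmle : ∀ n, |m n| ≤ r n := by
    intro n
    induction n using Nat.strong_induction_on with
    | _ n ih =>
      rcases Nat.lt_or_ge n 2 with h | h
      · interval_cases n
        · simp
        · simp [hm1, hr1]
      have hl : 0 < Real.log n := Real.log_pos (by exact_mod_cast h)
      have h1 : m n * Real.log n = - (m * Lam) n := by
        rw [← dlog_apply, hDm]; rfl
      have h2 : r n * Real.log n = (r * Lam) n := by rw [← dlog_apply, hD]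
      refine le_of_mul_le_mul_right ?_ hl
      rw [h2]
      rw [← abs_of_pos hl, ← abs_mul, h1, abs_neg, mul_apply, mul_apply]
      refine (abs_sum_le_sum_abs _ _).trans (sum_le_sum fun x hx => ?_)
      rw [Nat.mem_divisorsAntidiagonal] at hx
      rw [abs_mul, abs_of_nonneg (hLam _)]
      rcases eq_or_ne x.2 1 with h3 | h3
      · simp [h3, hLam1]
      apply mul_le_mul_of_nonneg_right _ (hLam _)
      apply ih
      have h4 : x.2 ≠ 0 := by intro h; simp [h] at hx; omega
      have h5 : x.1 ≠ 0 := by intro h; simp [h] at hx; omega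
      rw [← hx.1]
      have : 2 ≤ x.2 := by omega
      have : 1 ≤ x.1 := by omega
      nlinarith
  obtain ⟨c1, c2, K1, hH⟩ := asym_H r r0 ρ C δ hδ hR
  set a : ℝ := -2 * c1 / ρ with ha
  set a' : ℝ := -(2 * c2 + a * c1) / ρ with ha'
  have ha2 : a * ρ = -2 * c1 := by rw [ha]; field_simp
  have ha2' : a' * ρ = -(2 * c2 + a * c1) := by rw [ha']; field_simp
  let H : ℝ → ℝ := psum (fun k => r k / k)
  let H2 : ℝ → ℝ := fun y => psum (fun k => r k / k * Real.log (y / k)) y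
  let E : ℝ → ℝ := fun y => Real.log y ^ 2 * psum r y - 2 * (y * H2 y) - a * (y * H y) - a' * psum r y
  have hC0 : 0 ≤ C := by
    have := (abs_nonneg _).trans (hR 1 le_rfl); simpa using this
  have hK0 : 0 ≤ K1 := by
    have := (abs_nonneg _).trans (hH 1 le_rfl).1; simpa using this
  obtain ⟨K2, hK2, hlog⟩ := log_sq_le δ hδ
  obtain ⟨K3, hE⟩ : ∃ K3, ∀ y, 1 ≤ y → |E y| ≤ K3 * y ^ (1 - δ / 2) := by
    refine ⟨C * K2 + 2 * K1 + |a| * K1 + |a'| * C, fun y hy => ?_⟩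
    have hy0 : 0 < y := by linarith
    obtain ⟨h1, h2⟩ := hH y hy
    have h3 := hR y hy
    have h4 := hlog y hy
    have hpow : y ^ (1 - δ) ≤ y ^ (1 - δ / 2) := Real.rpow_le_rpow_of_exponent_le hy (by linarith)
    have hp : y * y ^ (-δ) = y ^ (1 - δ) := by
      rw [show (1 - δ) = -δ + 1 by ring, Real.rpow_add_one hy0.ne']; ring
    have hEq : E y = Real.log y ^ 2 * (psum r y - ρ * y)
        - 2 * (y * (H2 y - (ρ / 2 * Real.log y ^ 2 + c1 * Real.log y + c2)))
        - a * (y * (H y - (ρ * Real.log y + c1))) - a' * (psum r y - ρ * y) := by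
      simp only [E]
      linear_combination (-y * Real.log y) * ha2 - y * ha2'
    have b1 : |Real.log y ^ 2 * (psum r y - ρ * y)| ≤ C * K2 * y ^ (1 - δ / 2) := by
      rw [abs_mul, abs_of_nonneg (sq_nonneg _)]
      calc Real.log y ^ 2 * |psum r y - ρ * y| ≤ Real.log y ^ 2 * (C * y ^ (1 - δ)) :=
            mul_le_mul_of_nonneg_left h3 (sq_nonneg _)
        _ = C * (Real.log y ^ 2 * y ^ (1 - δ)) := by ring
        _ ≤ C * (K2 * y ^ (1 - δ / 2)) := mul_le_mul_of_nonneg_left h4 hC0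
        _ = _ := by ring
    have b2 : |2 * (y * (H2 y - (ρ / 2 * Real.log y ^ 2 + c1 * Real.log y + c2)))| ≤ 2 * K1 * y ^ (1 - δ / 2) := by
      rw [abs_mul, abs_mul, abs_of_pos hy0, abs_two]
      have : y * |H2 y - (ρ / 2 * Real.log y ^ 2 + c1 * Real.log y + c2)| ≤ y * (K1 * y ^ (-δ)) :=
        mul_le_mul_of_nonneg_left h2 hy0.le
      have h5 : y * (K1 * y ^ (-δ)) = K1 * y ^ (1 - δ) := by rw [← hp]; ring
      have h6 := mul_le_mul_of_nonneg_left hpow hK0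
      linarith
    have b3 : |a * (y * (H y - (ρ * Real.log y + c1)))| ≤ |a| * K1 * y ^ (1 - δ / 2) := by
      rw [abs_mul, abs_mul, abs_of_pos hy0, mul_assoc]
      apply mul_le_mul_of_nonneg_left _ (abs_nonneg a)
      have : y * |H y - (ρ * Real.log y + c1)| ≤ y * (K1 * y ^ (-δ)) :=
        mul_le_mul_of_nonneg_left h1 hy0.le
      have h5 : y * (K1 * y ^ (-δ)) = K1 * y ^ (1 - δ) := by rw [← hp]; ring
      have h6 := mul_le_mul_of_nonneg_left hpow hK0
      linarith
    have b4 : |a' * (psum r y - ρ * y)| ≤ |a'| * C * y ^ (1 - δ / 2) := by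
      rw [abs_mul, mul_assoc]
      apply mul_le_mul_of_nonneg_left _ (abs_nonneg a')
      exact h3.trans (mul_le_mul_of_nonneg_left hpow hC0)
    rw [hEq]
    refine (abs_sub _ _).trans ?_
    have t1 := abs_sub (Real.log y ^ 2 * (psum r y - ρ * y)
        - 2 * (y * (H2 y - (ρ / 2 * Real.log y ^ 2 + c1 * Real.log y + c2))))
        (a * (y * (H y - (ρ * Real.log y + c1))))
    have t2 := abs_sub (Real.log y ^ 2 * (psum r y - ρ * y))
        (2 * (y * (H2 y - (ρ / 2 * Real.log y ^ 2 + c1 * Real.log y + c2))))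
    linarith
  obtain ⟨K4, hK4⟩ := sum_pow_le r hr r0 (1 - δ / 2) (ρ + C) (by linarith) (by linarith) (by
    intro y hy
    have h1 := (abs_le.1 (hR y hy)).2
    have h2 : y ^ (1 - δ) ≤ y := by
      conv_rhs => rw [← Real.rpow_one y]
      exact Real.rpow_le_rpow_of_exponent_le hy (by linarith)
    have := mul_le_mul_of_nonneg_left h2 hC0
    linarith)
  have hK3 : 0 ≤ K3 := by
    have := (abs_nonneg _).trans (hE 1 le_rfl); simpa using this
  refine ⟨|a| + |a'| + K3 * K4, fun N hN => ?_⟩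
  have hN0 : (0:ℝ) < N := by exact_mod_cast hN
  set ℓ := Real.log N with hℓ
  -- the three identities
  have hid : ∀ φ : ℕ → ℝ, ∑ d ∈ Ioc 0 N, m d * ∑ b ∈ Ioc 0 (N / d), r b * φ (d * b) = φ 1 := by
    intro φ
    rw [sum_conv_phi, hmr]
    rw [sum_eq_single 1]
    · simp
    · intro b _ hb; simp [one_apply_ne hb]
    · intro h; simp at h; omega
  have id1 : ∑ d ∈ Ioc 0 N, m d * psum r ((N:ℝ) / d) = 1 := by
    have := hid (fun _ => 1)
    simp only [mul_one] at this
    rw [← this]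
    apply sum_congr rfl; intro d _; rw [psum_eq r r0]
  have id2 : ∑ d ∈ Ioc 0 N, m d * ((N:ℝ) / d * H ((N:ℝ) / d)) = N := by
    have := hid (fun n => (N:ℝ) / n)
    simp only [Nat.cast_one, div_one] at this
    refine Eq.trans ?_ this
    apply sum_congr rfl; intro d _
    simp only [H]
    rw [psum_eq _ (by simp), mul_sum]
    congr 1
    apply sum_congr rfl; intro b _
    push_cast
    ring
  have id3 : ∑ d ∈ Ioc 0 N, m d * ((N:ℝ) / d * H2 ((N:ℝ) / d)) = N * ℓ := by
    have := hid (fun n => (N:ℝ) / n * Real.log (N / n))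
    simp only [Nat.cast_one, div_one] at this
    refine Eq.trans ?_ this
    apply sum_congr rfl; intro d _
    simp only [H2]
    rw [psum_eq _ (by simp), mul_sum]
    congr 1
    apply sum_congr rfl; intro b _
    push_cast
    rw [div_div (N:ℝ)]
    ring
  have hTup : ∑ d ∈ Ioc 0 N, m d * (Real.log ((N:ℝ) / d) ^ 2 * psum r ((N:ℝ) / d)) ≤
      2 * N * ℓ + (|a| + |a'| + K3 * K4) * N := by
    have hsplit : ∑ d ∈ Ioc 0 N, m d * (Real.log ((N:ℝ) / d) ^ 2 * psum r ((N:ℝ) / d)) =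
        2 * (N * ℓ) + a * N + a' * 1 + ∑ d ∈ Ioc 0 N, m d * E ((N:ℝ) / d) := by
      rw [← id3, ← id2, ← id1, mul_sum, mul_sum, mul_sum, ← sum_add_distrib, ← sum_add_distrib, ← sum_add_distrib]
      apply sum_congr rfl; intro d _
      simp only [E]
      rw [id2]
      ring
    have hEs : ∑ d ∈ Ioc 0 N, m d * E ((N:ℝ) / d) ≤ K3 * (K4 * N) := by
      refine le_trans ?_ (mul_le_mul_of_nonneg_left (hK4 N) hK3)
      rw [mul_sum]
      apply sum_le_sum
      intro d hd
      simp only [mem_Ioc] at hd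
      have hd0 : (0:ℝ) < d := by exact_mod_cast hd.1
      have h1 := hE ((N : ℝ) / d) (by rw [le_div_iff₀ hd0, one_mul]; exact_mod_cast hd.2)
      refine (le_abs_self _).trans ?_
      rw [abs_mul]
      refine (mul_le_mul (hmle d) h1 (abs_nonneg _) (hr d)).trans (le_of_eq ?_)
      ring
    rw [hsplit]
    have h1 : a * N ≤ |a| * N := mul_le_mul_of_nonneg_right (le_abs_self a) hN0.le
    have h2 : a' * 1 ≤ |a'| * N := by
      rw [mul_one]
      refine (le_abs_self a').trans ?_
      have : (1:ℝ) ≤ N := by exact_mod_cast hN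
      nlinarith [abs_nonneg a']
    linarith
  have hTlow : ℓ * ∑ n ∈ Ioc 0 N, Lam n ≤ 
      ∑ d ∈ Ioc 0 N, m d * (Real.log ((N:ℝ) / d) ^ 2 * psum r ((N:ℝ) / d)) := by
    have hDDm : dlog (dlog m) * r = Lam * Lam - dlog Lam := by
      have e1 : dlog (dlog m) = - (dlog m * Lam + m * dlog Lam) := by
        rw [← dlog_mul]
        rw [hDm]; ext n; simp [dlog_apply]
      rw [e1, hDm]
      linear_combination (Lam * Lam - dlog Lam) * hmr
    have hDmr : dlog m * r = - Lam := by rw [hDm]; linear_combination (-Lam) * hmr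
    have hT : ∑ d ∈ Ioc 0 N, m d * (Real.log ((N:ℝ) / d) ^ 2 * psum r ((N:ℝ) / d)) =
        ∑ n ∈ Ioc 0 N, (ℓ ^ 2 * (1 : ArithmeticFunction ℝ) n + 2 * ℓ * Lam n + (Lam * Lam) n - Lam n * Real.log n) := by
      have q1 := sum_Ioc_mul_eq_sum_sum m r N
      have q2 := sum_Ioc_mul_eq_sum_sum (dlog m) r N
      have q3 := sum_Ioc_mul_eq_sum_sum (dlog (dlog m)) r N
      rw [hmr] at q1
      rw [hDmr] at q2
      rw [hDDm] at q3
      have e1 : ∑ n ∈ Ioc 0 N, (ℓ ^ 2 * (1 : ArithmeticFunction ℝ) n + 2 * ℓ * Lam n + (Lam * Lam) n - Lam n * Real.log n)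
          = ℓ ^ 2 * ∑ n ∈ Ioc 0 N, (1 : ArithmeticFunction ℝ) n - 2 * ℓ * ∑ n ∈ Ioc 0 N, (-Lam) n +
            ∑ n ∈ Ioc 0 N, (Lam * Lam - dlog Lam) n := by
        rw [mul_sum, mul_sum, ← sum_sub_distrib, ← sum_add_distrib]
        apply sum_congr rfl; intro n _
        rw [sub_eq_add_neg (Lam * Lam), ArithmeticFunction.add_apply, ArithmeticFunction.neg_apply, ArithmeticFunction.neg_apply, dlog_apply]; ring
      rw [e1, q1, q2, q3, mul_sum, mul_sum, ← sum_sub_distrib, ← sum_add_distrib]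
      apply sum_congr rfl; intro d hd
      simp only [mem_Ioc] at hd
      have hd0 : (0:ℝ) < d := by exact_mod_cast hd.1
      rw [psum_eq _ r0, Real.log_div hN0.ne' hd0.ne', dlog_apply, dlog_apply, dlog_apply, hℓ]
      ring
    rw [hT, mul_sum]
    apply sum_le_sum
    intro n hn
    simp only [mem_Ioc] at hn
    have hl : Real.log n ≤ ℓ := Real.log_le_log (by exact_mod_cast hn.1) (by exact_mod_cast hn.2)
    have h1 : 0 ≤ (Lam * Lam) n := by
      rw [mul_apply]; exact sum_nonneg fun x _ => mul_nonneg (hLam _) (hLam _)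
    have h2 : 0 ≤ ℓ ^ 2 * (1 : ArithmeticFunction ℝ) n := by
      apply mul_nonneg (sq_nonneg _)
      rw [one_apply]; split_ifs <;> norm_num
    nlinarith [mul_le_mul_of_nonneg_left hl (hLam n)]
  exact hTlow.trans hTup

end SelbergBound

namespace IdealCount
open MeasureTheory Module

variable {V : Type*} [NormedAddCommGroup V] [NormedSpace ℝ V] [FiniteDimensional ℝ V]
  [MeasurableSpace V] [BorelSpace V] (μ : Measure V) [μ.IsAddHaarMeasure]
  {ι : Type*} [Fintype ι] (b : Basis ι ℝ V)

/-- real-linear floor -/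
noncomputable def fl (x : V) : V := (ZSpan.floor b x : V)

lemma measurable_fl : Measurable (fl b) := by
  have : fl b = fun x => ∑ i, (⌊b.repr x i⌋ : ℝ) • b i := by
    ext x
    simp [fl, ZSpan.floor, Int.cast_smul_eq_zsmul]
  rw [this]
  apply Finset.measurable_sum
  intro i _
  have h1 : Measurable (fun x => b.repr x i) := by
    have : Continuous (fun x => b.repr x i) :=
      LinearMap.continuous_of_finiteDimensional ((Finsupp.lapply i).comp b.repr.toLinearMap)
    exact this.measurable
  have h2 : Measurable (fun x => (⌊b.repr x i⌋ : ℝ)) := measurable_from_top.comp (Int.measurable_floor.comp h1)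
  exact h2.smul_const (b i)

lemma dist_fl : ∃ d, 0 < d ∧ ∀ x : V, ‖x - fl b x‖ ≤ d := by
  refine ⟨(∑ i, ‖b i‖) + 1, by positivity, fun x => ?_⟩
  have := ZSpan.norm_fract_le (K := ℝ) b x
  have h2 : ‖x - fl b x‖ = ‖ZSpan.fract b x‖ := rfl
  rw [h2]; linarith

lemma fl_vadd (l : V) (hl : l ∈ Submodule.span ℤ (Set.range b)) (x : V)
    (hx : x ∈ ZSpan.fundamentalDomain b) : fl b (l + x) = l := by
  have h1 := ZSpan.fract_zSpan_add (K := ℝ) b x hl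
  rw [ZSpan.fract_eq_self.2 hx, ZSpan.fract_apply] at h1
  have : l + x - fl b (l + x) = x := h1
  rw [sub_eq_iff_eq_add] at this
  have h2 : x + fl b (l + x) = x + l := by rw [← this, add_comm]
  exact add_left_cancel h2

lemma integral_fl (G : V → ℝ) (hG : Integrable (fun x => G (fl b x)) μ) :
    ∫ x, G (fl b x) ∂μ = μ.real (ZSpan.fundamentalDomain b) *
      ∑' l : Submodule.span ℤ (Set.range b), G l := by
  haveI : Countable (Submodule.span ℤ (Set.range b)).toAddSubgroup :=
    inferInstanceAs (Countable (Submodule.span ℤ (Set.range b)))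
  have hD := ZSpan.isAddFundamentalDomain' b μ
  rw [hD.integral_eq_tsum'' _ hG, ← tsum_mul_left]
  change ∑' l : Submodule.span ℤ (Set.range b), _ = _
  congr 1
  ext l
  have : Set.EqOn (fun x : V => G (fl b ((l : V) + x))) (fun _ => G l) (ZSpan.fundamentalDomain b) := by
    intro x hx
    simp only [fl_vadd b l l.2 x hx]
  change ∫ x in ZSpan.fundamentalDomain b, G (fl b ((l : V) + x)) ∂μ = _
  rw [setIntegral_congr_fun (ZSpan.fundamentalDomain_measurableSet b) this]
  simp

/-- Quantitative lattice point sum for Lipschitz functions. -/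
theorem lattice_sum (R : ℝ) (hR : 0 ≤ R) : ∃ C : ℝ, 0 ≤ C ∧ ∀ (F : V → ℝ) (M : ℝ) (t : ℝ), 0 ≤ M → 1 ≤ t →
    (∀ x y, |F x - F y| ≤ M * ‖x - y‖) → (∀ x, R < ‖x‖ → F x = 0) →
    |μ.real (ZSpan.fundamentalDomain b) * ∑' l : Submodule.span ℤ (Set.range b), F (t⁻¹ • (l : V))
      - t ^ finrank ℝ V * ∫ x, F x ∂μ| ≤ C * M * t⁻¹ * t ^ finrank ℝ V := by
  obtain ⟨d, hd0, hd⟩ := dist_fl b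
  refine ⟨d * μ.real (Metric.ball 0 1) * (R + d + 1) ^ finrank ℝ V, by positivity, ?_⟩
  intro F M t hM ht hF hsupp
  have ht0 : 0 < t := by linarith
  have hFc : Continuous F := by
    have : LipschitzWith (Real.toNNReal M) F := by
      apply LipschitzWith.of_dist_le_mul
      intro x y
      rw [Real.dist_eq, dist_eq_norm, Real.coe_toNNReal _ hM]; exact hF x y
    exact this.continuous
  set G : V → ℝ := fun x => F (t⁻¹ • x) with hGdef
  have hGc : Continuous G := by fun_prop
  have hGsupp : ∀ x, t * R < ‖x‖ → G x = 0 := by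
    intro x hx
    apply hsupp
    rw [norm_smul, norm_inv, Real.norm_of_nonneg ht0.le, ← div_eq_inv_mul, lt_div_iff₀ ht0]
    linarith
  have hGl : ∀ x y, |G x - G y| ≤ M * t⁻¹ * ‖x - y‖ := by
    intro x y
    refine (hF _ _).trans (le_of_eq ?_)
    rw [← smul_sub, norm_smul, norm_inv, Real.norm_of_nonneg ht0.le]; ring
  have hGcs : HasCompactSupport G := by
    apply HasCompactSupport.of_support_subset_isCompact (isCompact_closedBall (0:V) (t * R))
    intro x hx
    rw [mem_closedBall_zero_iff]
    by_contra h
    exact hx (hGsupp x (not_le.1 h))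
  have hGi : Integrable G μ := hGc.integrable_of_hasCompactSupport hGcs
  set r := t * (R + d + 1) with hr
  have hr0 : 0 < r := by positivity
  have hbig : t * R + d < r := by rw [hr]; nlinarith
  -- the difference bound
  have hdiff : ∀ x, ‖G (fl b x) - G x‖ ≤ Set.indicator (Metric.ball (0:V) r) (fun _ => M * t⁻¹ * d) x := by
    intro x
    by_cases hx : x ∈ Metric.ball (0:V) r
    · rw [Set.indicator_of_mem hx, Real.norm_eq_abs]
      refine (hGl _ _).trans ?_
      rw [norm_sub_rev]
      exact mul_le_mul_of_nonneg_left (hd x) (by positivity)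
    · rw [Set.indicator_of_notMem hx]
      rw [mem_ball_zero_iff, not_lt] at hx
      have h1 : ‖x‖ ≤ ‖fl b x‖ + d := by
        have := norm_le_norm_add_norm_sub (fl b x) x
        have h3 := hd x
        rw [norm_sub_rev] at h3
        linarith
      rw [hGsupp x (by linarith), hGsupp (fl b x) (by linarith)]
      simp
  have hind : Integrable (Set.indicator (Metric.ball (0:V) r) (fun _ => M * t⁻¹ * d)) μ := by
    rw [integrable_indicator_iff measurableSet_ball]
    exact integrableOn_const measure_ball_lt_top.ne
  have hmeas : Measurable (fun x => G (fl b x)) := hGc.measurable.comp (measurable_fl b)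
  have hdi : Integrable (fun x => G (fl b x) - G x) μ :=
    Integrable.mono' hind (hmeas.sub hGc.measurable).aestronglyMeasurable (Filter.Eventually.of_forall hdiff)
  have hfi : Integrable (fun x => G (fl b x)) μ := by
    have := hdi.add hGi
    refine this.congr (Filter.Eventually.of_forall fun x => ?_)
    simp
  have e1 : ∫ x, G x ∂μ = t ^ finrank ℝ V * ∫ x, F x ∂μ := by
    have := Measure.integral_comp_smul μ F t⁻¹
    rw [hGdef, this, inv_pow, inv_inv, abs_of_pos (by positivity), smul_eq_mul]
  rw [← e1, ← integral_fl μ b G hfi, ← integral_sub hfi hGi]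
  have h2 := norm_integral_le_of_norm_le hind (Filter.Eventually.of_forall hdiff)
  rw [Real.norm_eq_abs] at h2
  refine h2.trans (le_of_eq ?_)
  rw [integral_indicator measurableSet_ball, setIntegral_const, smul_eq_mul]
  have e3 : μ.real (Metric.ball (0:V) r) = r ^ finrank ℝ V * μ.real (Metric.ball 0 1) := by
    rw [Measure.real, Measure.addHaar_ball_of_pos μ 0 hr0, ENNReal.toReal_mul, ENNReal.toReal_ofReal (by positivity)]
    rfl
  rw [e3, hr, mul_pow]
  ring

end IdealCount

namespace IdealCount
open MeasureTheory Module NumberField NumberField.mixedEmbedding NumberField.mixedEmbedding.fundamentalCone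
  NumberField.InfinitePlace NumberField.Units NumberField.Units.dirichletUnitTheorem

/-- telescoping bump -/
noncomputable def bw (t : ℝ) : ℝ := Real.smoothTransition (t + 1) - Real.smoothTransition t

lemma bw_contDiff : ContDiff ℝ 1 bw := by
  unfold bw
  exact (Real.smoothTransition.contDiff.comp (contDiff_id.add contDiff_const)).sub Real.smoothTransition.contDiff

lemma bw_zero_of_ge {t : ℝ} (h : 1 ≤ t) : bw t = 0 := by
  rw [bw, Real.smoothTransition.one_of_one_le h, Real.smoothTransition.one_of_one_le (by linarith), sub_self]

lemma bw_zero_of_le {t : ℝ} (h : t ≤ -1) : bw t = 0 := by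
  rw [bw, Real.smoothTransition.zero_of_nonpos (by linarith), Real.smoothTransition.zero_of_nonpos (by linarith), sub_self]

lemma bw_nonneg (t : ℝ) : 0 ≤ bw t := by
  rw [bw, sub_nonneg]
  exact Real.smoothTransition.monotone (by linarith)

lemma bw_le_one (t : ℝ) : bw t ≤ 1 := by
  rw [bw]
  linarith [Real.smoothTransition.le_one (t+1), Real.smoothTransition.nonneg t]

lemma bw_sum {t : ℝ} (h0 : 0 ≤ t) (h1 : t < 1) :
    ∑ n ∈ ({-1, 0} : Finset ℤ), bw (n + t) = 1 := by
  rw [Finset.sum_insert (by simp), Finset.sum_singleton, bw, bw]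
  push_cast
  rw [show (-1 + t + 1) = 0 + t by ring, Real.smoothTransition.zero_of_nonpos (x := -1 + t) (by linarith),
    Real.smoothTransition.one_of_one_le (x := 0 + t + 1) (by linarith)]
  ring

/-- smooth cut-off on the norm -/
noncomputable def chi (t : ℝ) : ℝ := Real.smoothTransition (12 * t - 3) * Real.smoothTransition (4 - 2 * t)

lemma chi_contDiff : ContDiff ℝ 1 chi := by
  unfold chi
  exact (Real.smoothTransition.contDiff.comp ((contDiff_const.mul contDiff_id).sub contDiff_const)).mul
    (Real.smoothTransition.contDiff.comp (contDiff_const.sub (contDiff_const.mul contDiff_id)))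

lemma chi_one {t : ℝ} (h1 : 1/3 ≤ t) (h2 : t ≤ 3/2) : chi t = 1 := by
  rw [chi, Real.smoothTransition.one_of_one_le (by linarith), Real.smoothTransition.one_of_one_le (by linarith), mul_one]

lemma chi_zero {t : ℝ} (h : t ≤ 1/4 ∨ 2 ≤ t) : chi t = 0 := by
  rcases h with h | h
  · rw [chi, Real.smoothTransition.zero_of_nonpos (by linarith), zero_mul]
  · rw [chi, Real.smoothTransition.zero_of_nonpos (x := 4 - 2 * t) (by linarith), mul_zero]

open scoped Classical

variable (K : Type*) [Field K] [NumberField K]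

/-- coordinates of `logMap` -/
noncomputable def co (x : mixedSpace K) (i : Fin (rank K)) : ℝ :=
  ((basisUnitLattice K).ofZLatticeBasis ℝ (unitLattice K)).repr (logMap x) i

noncomputable def Phi (x : mixedSpace K) : ℝ :=
  chi (mixedEmbedding.norm x) * ∏ i, bw (co K x i)

variable {K}

lemma normAtPlace_contDiffAt (w : InfinitePlace K) (x : mixedSpace K) (hx : normAtPlace w x ≠ 0) :
    ContDiffAt ℝ 1 (fun y : mixedSpace K => normAtPlace w y) x := by
  by_cases hw : IsReal w
  · simp only [normAtPlace_apply_of_isReal hw] at hx ⊢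
    apply ContDiffAt.norm ℝ _ (by simpa using hx)
    have : ContDiff ℝ 1 (fun y : mixedSpace K => y.1 ⟨w, hw⟩) := by fun_prop
    exact this.contDiffAt
  · rw [not_isReal_iff_isComplex] at hw
    simp only [normAtPlace_apply_of_isComplex hw] at hx ⊢
    apply ContDiffAt.norm ℝ _ (by simpa using hx)
    have : ContDiff ℝ 1 (fun y : mixedSpace K => y.2 ⟨w, hw⟩) := by fun_prop
    exact this.contDiffAt

lemma norm_contDiffAt (x : mixedSpace K) (hx : mixedEmbedding.norm x ≠ 0) :
    ContDiffAt ℝ 1 (fun y : mixedSpace K => mixedEmbedding.norm y) x := by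
  simp only [mixedEmbedding.norm_apply]
  apply contDiffAt_prod
  intro w _
  exact (normAtPlace_contDiffAt w x (mixedEmbedding.norm_ne_zero_iff.1 hx w)).pow _

lemma norm_continuous : Continuous (fun y : mixedSpace K => mixedEmbedding.norm y) := by
  exact mixedEmbedding.continuous_norm K

lemma co_contDiffAt (x : mixedSpace K) (hx : mixedEmbedding.norm x ≠ 0) (i : Fin (rank K)) :
    ContDiffAt ℝ 1 (fun y : mixedSpace K => co K y i) x := by
  have h1 : ContDiffAt ℝ 1 (fun y : mixedSpace K => logMap y) x := by
    rw [contDiffAt_pi]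
    intro w
    simp only [logMap_apply]
    apply ContDiffAt.mul contDiffAt_const
    apply ContDiffAt.sub
    · exact (normAtPlace_contDiffAt w.1 x (mixedEmbedding.norm_ne_zero_iff.1 hx w.1)).log
        (mixedEmbedding.norm_ne_zero_iff.1 hx w.1)
    · exact ((norm_contDiffAt x hx).log hx).mul contDiffAt_const
  let B := (basisUnitLattice K).ofZLatticeBasis ℝ (unitLattice K)
  have h2 : ContDiff ℝ 1 (fun v : logSpace K => B.repr v i) :=
    (LinearMap.toContinuousLinearMap (B.coord i)).contDiff
  exact h2.contDiffAt.comp x h1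

lemma Phi_contDiff : ContDiff ℝ 1 (Phi K) := by
  rw [contDiff_iff_contDiffAt]
  intro x
  by_cases hx : mixedEmbedding.norm x < 1/4
  · have : Phi K =ᶠ[nhds x] fun _ => 0 := by
      have h := norm_continuous.continuousAt.eventually (Iio_mem_nhds hx)
      filter_upwards [h] with y hy
      rw [Phi, chi_zero (Or.inl (le_of_lt hy)), zero_mul]
    exact contDiffAt_const.congr_of_eventuallyEq this
  · have hx0 : mixedEmbedding.norm x ≠ 0 := by intro h; rw [h] at hx; norm_num at hx
    unfold Phi
    apply ContDiffAt.mul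
    · exact chi_contDiff.contDiffAt.comp x (norm_contDiffAt x hx0)
    · apply contDiffAt_prod
      intro i _
      exact bw_contDiff.contDiffAt.comp x (co_contDiffAt x hx0 i)

/-- units from exponents -/
noncomputable def un (n : Fin (rank K) → ℤ) : (𝓞 K)ˣ := ∏ i, fundSystem K i ^ n i

lemma co_un (n : Fin (rank K) → ℤ) (x : mixedSpace K) (hx : mixedEmbedding.norm x ≠ 0) (i : Fin (rank K)) :
    co K (un n • x) i = n i + co K x i := by
  classical
  have h1 : logEmbedding K (Additive.ofMul (un n)) = ∑ j, n j • ((basisUnitLattice K j : unitLattice K) : logSpace K) := by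
    simp only [un, ofMul_prod, ofMul_zpow, map_sum, map_zsmul, logEmbedding_fundSystem]
  rw [co, logMap_unit_smul _ hx, map_add, Finsupp.add_apply, h1, co]
  congr 1
  have h2 : ∀ j, ((basisUnitLattice K j : unitLattice K) : logSpace K) =
      (basisUnitLattice K).ofZLatticeBasis ℝ (unitLattice K) j := fun j => by
    rw [Basis.ofZLatticeBasis_apply]
  simp only [h2, map_sum, map_zsmul, Basis.repr_self, Finsupp.finsetSum_apply, Finsupp.smul_apply, Finsupp.single_apply]
  simp

lemma mem_cone_iff (x : mixedSpace K) : x ∈ fundamentalCone K ↔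
    mixedEmbedding.norm x ≠ 0 ∧ ∀ i, 0 ≤ co K x i ∧ co K x i < 1 := by
  rw [fundamentalCone, Set.mem_sdiff, Set.mem_preimage, ZSpan.mem_fundamentalDomain]
  simp only [Set.mem_Ico, Set.mem_ofPred_eq, co]
  tauto

lemma Phi_support_bounded : Bornology.IsBounded (Function.support (Phi K)) := by
  let S : Set (mixedSpace K) := ⋃ n ∈ (Set.Finite.toFinset (Set.finite_Icc (fun _ : Fin (rank K) => (-1:ℤ)) (fun _ => 1))),
    (fun x => un (K := K) n • ((2:ℝ) • x)) '' (normLeOne K)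
  have hS : Bornology.IsBounded S := by
    rw [Bornology.isBounded_biUnion_finset]
    intro n _
    have hcont : ∀ u : (𝓞 K)ˣ, Continuous fun x : mixedSpace K => u • ((2:ℝ) • x) := by
      intro u
      simp only [unitSMul_smul]
      fun_prop
    have hc : IsCompact (closure (normLeOne K)) := (isBounded_normLeOne K).isCompact_closure
    exact ((hc.image (hcont (un n))).isBounded).subset (Set.image_mono subset_closure)
  refine hS.subset ?_
  intro x hx
  have hx' : Phi K x ≠ 0 := hx
  rw [Phi, mul_ne_zero_iff, Finset.prod_ne_zero_iff] at hx'
  obtain ⟨h1, h2⟩ := hx'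
  have hN1 : 1/4 < mixedEmbedding.norm x := by
    by_contra h; exact h1 (chi_zero (Or.inl (not_lt.1 h)))
  have hN2 : mixedEmbedding.norm x < 2 := by
    by_contra h; exact h1 (chi_zero (Or.inr (not_lt.1 h)))
  have hN0 : mixedEmbedding.norm x ≠ 0 := by intro h; rw [h] at hN1; norm_num at hN1
  have hco : ∀ i, -1 < co K x i ∧ co K x i < 1 := by
    intro i
    constructor
    · by_contra h; exact h2 i (Finset.mem_univ _) (bw_zero_of_le (not_lt.1 h))
    · by_contra h; exact h2 i (Finset.mem_univ _) (bw_zero_of_ge (not_lt.1 h))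
  let n : Fin (rank K) → ℤ := fun i => ⌊co K x i⌋
  simp only [S, Set.mem_iUnion]
  refine ⟨n, ?_, (2:ℝ)⁻¹ • (un (-n) • x), ?_, ?_⟩
  · simp only [Set.Finite.mem_toFinset, Set.mem_Icc, Pi.le_def]
    constructor
    · intro i; exact Int.le_floor.2 (by push_cast; exact (hco i).1.le)
    · intro i
      have : n i < 1 := Int.floor_lt.2 (by push_cast; exact (hco i).2)
      exact this.le
  · have hcone : un (-n) • x ∈ fundamentalCone K := by
      rw [mem_cone_iff]
      refine ⟨by rwa [norm_unit_smul], fun i => ?_⟩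
      rw [co_un _ _ hN0]
      simp only [Pi.neg_apply, n]
      push_cast
      constructor
      · linarith [Int.floor_le (co K x i)]
      · linarith [Int.lt_floor_add_one (co K x i)]
    refine ⟨smul_mem_of_mem hcone (by norm_num), ?_⟩
    change mixedEmbedding.norm _ ≤ 1
    rw [mixedEmbedding.norm_smul, norm_unit_smul, abs_of_pos (by norm_num)]
    have hd : 1 ≤ finrank ℚ K := finrank_pos
    have : ((2:ℝ)⁻¹) ^ finrank ℚ K ≤ (2:ℝ)⁻¹ ^ 1 := pow_le_pow_of_le_one (by norm_num) (by norm_num) hd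
    have h0 : 0 ≤ mixedEmbedding.norm x := mixedEmbedding.norm_nonneg x
    nlinarith
  · simp only [smul_smul]
    rw [mul_inv_cancel₀ (by norm_num), one_smul, smul_smul]
    have : un (K := K) n * un (-n) = 1 := by
      simp [un, ← Finset.prod_mul_distrib, ← zpow_add]
    rw [this, one_smul]

lemma Phi_compact : HasCompactSupport (Phi K) := by
  exact (Phi_support_bounded (K := K)).isCompact_closure

lemma Phi_bound (x : mixedSpace K) : 0 ≤ Phi K x ∧ Phi K x ≤ 1 := by
  have hc0 : 0 ≤ chi (mixedEmbedding.norm x) := mul_nonneg (Real.smoothTransition.nonneg _) (Real.smoothTransition.nonneg _)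
  have hc1 : chi (mixedEmbedding.norm x) ≤ 1 := mul_le_one₀ (Real.smoothTransition.le_one _) (Real.smoothTransition.nonneg _) (Real.smoothTransition.le_one _)
  have hp0 : 0 ≤ ∏ i, bw (co K x i) := Finset.prod_nonneg fun i _ => bw_nonneg _
  have hp1 : ∏ i, bw (co K x i) ≤ 1 := Finset.prod_le_one (fun i _ => bw_nonneg _) (fun i _ => bw_le_one _)
  exact ⟨mul_nonneg hc0 hp0, mul_le_one₀ hc1 hp0 hp1⟩

end IdealCount

namespace IdealCount
open MeasureTheory Module NumberField NumberField.mixedEmbedding NumberField.mixedEmbedding.fundamentalCone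
  NumberField.InfinitePlace NumberField.Units NumberField.Units.dirichletUnitTheorem
open scoped Classical nonZeroDivisors

variable {K : Type*} [Field K] [NumberField K]

lemma bw_prod_sum (c : Fin (rank K) → ℝ) (hc : ∀ i, 0 ≤ c i ∧ c i < 1) :
    ∑' n : Fin (rank K) → ℤ, ∏ i, bw (n i + c i) = 1 := by
  rw [tsum_eq_sum (s := Fintype.piFinset fun _ => ({-1, 0} : Finset ℤ))]
  · rw [← Finset.prod_univ_sum (fun _ => ({-1, 0} : Finset ℤ)) (fun i (n : ℤ) => bw (n + c i))]
    exact Finset.prod_eq_one fun i _ => bw_sum (hc i).1 (hc i).2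
  · intro n hn
    rw [Fintype.mem_piFinset] at hn
    push Not at hn
    obtain ⟨i, hi⟩ := hn
    apply Finset.prod_eq_zero (Finset.mem_univ i)
    simp only [Finset.mem_insert, Finset.mem_singleton, not_or] at hi
    rcases lt_or_ge (n i) (-1) with h | h
    · apply bw_zero_of_le
      have : (n i : ℝ) ≤ -2 := by exact_mod_cast (show n i ≤ -2 by omega)
      linarith [(hc i).2]
    · apply bw_zero_of_ge
      have : (1 : ℝ) ≤ n i := by exact_mod_cast (show 1 ≤ n i by omega)
      linarith [(hc i).1]

lemma un_mul_neg (n : Fin (rank K) → ℤ) : un (K := K) n * un (-n) = 1 := by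
  simp [un, ← Finset.prod_mul_distrib, ← zpow_add]

variable (J : (Ideal (𝓞 K))⁰)

/-- The lattice of the ideal `J`. -/
noncomputable abbrev Lat : Submodule ℤ (mixedSpace K) :=
  Submodule.span ℤ (Set.range (fractionalIdealLatticeBasis K (FractionalIdeal.mk0 K J)))

lemma mem_Lat (x : mixedSpace K) : x ∈ Lat J ↔ ∃ a : 𝓞 K, a ∈ (J : Ideal (𝓞 K)) ∧ mixedEmbedding K a = x := by
  rw [Lat, mem_span_fractionalIdealLatticeBasis]
  simp [FractionalIdeal.mem_coeIdeal]

lemma smul_mem_Lat (u : (𝓞 K)ˣ) {x : mixedSpace K} (hx : x ∈ Lat J) : u • x ∈ Lat J := by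
  rw [mem_Lat] at hx ⊢
  obtain ⟨a, ha, rfl⟩ := hx
  refine ⟨u * a, Ideal.mul_mem_left _ _ ha, ?_⟩
  rw [unitSMul_smul]; simp

lemma mem_idealSet' (x : mixedSpace K) : x ∈ idealSet K J ↔ x ∈ fundamentalCone K ∧ x ∈ Lat J := by
  rw [mem_idealSet, mem_Lat]; rfl

/-- Decomposition of the lattice via units. -/
noncomputable def latEquiv : (idealSet K J) × (Fin (rank K) → ℤ) ≃
    {x : Lat J // mixedEmbedding.norm (x : mixedSpace K) ≠ 0} := by
  refine Equiv.ofBijective (fun p => ⟨⟨un p.2 • (p.1 : mixedSpace K),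
    smul_mem_Lat J _ ((mem_idealSet' J _).1 p.1.2).2⟩, ?_⟩) ⟨?_, ?_⟩
  · change mixedEmbedding.norm (un p.2 • (p.1 : mixedSpace K)) ≠ 0
    rw [norm_unit_smul]
    exact ((mem_cone_iff _).1 ((mem_idealSet' J _).1 p.1.2).1).1
  · rintro ⟨a, n⟩ ⟨b, m⟩ h
    simp only [Subtype.mk.injEq] at h
    have ha := (mem_cone_iff _).1 ((mem_idealSet' J _).1 a.2).1
    have hb := (mem_cone_iff _).1 ((mem_idealSet' J _).1 b.2).1
    have hnm : n = m := by
      ext i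
      have h1 := co_un n _ ha.1 i
      rw [h, co_un m _ hb.1 i] at h1
      have h2 := ha.2 i
      have h3 := hb.2 i
      have h4 : (n i : ℝ) < m i + 1 := by linarith
      have h5 : (m i : ℝ) < n i + 1 := by linarith
      have h6 : n i < m i + 1 := by exact_mod_cast h4
      have h7 : m i < n i + 1 := by exact_mod_cast h5
      omega
    subst hnm
    have : (a : mixedSpace K) = b := by
      have h8 := congrArg (fun x => un (-n) • x) h
      simp only [smul_smul, mul_comm (un (-n)), un_mul_neg, one_smul] at h8
      exact h8
    rw [Subtype.ext this]
  · rintro ⟨⟨x, hx⟩, hN⟩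
    change mixedEmbedding.norm x ≠ 0 at hN
    let n : Fin (rank K) → ℤ := fun i => ⌊co K x i⌋
    have hcone : un (-n) • x ∈ fundamentalCone K := by
      rw [mem_cone_iff]
      refine ⟨by rwa [norm_unit_smul], fun i => ?_⟩
      rw [co_un _ _ hN]
      simp only [Pi.neg_apply, n]
      push_cast
      constructor
      · linarith [Int.floor_le (co K x i)]
      · linarith [Int.lt_floor_add_one (co K x i)]
    refine ⟨⟨⟨un (-n) • x, (mem_idealSet' J _).2 ⟨hcone, smul_mem_Lat J _ hx⟩⟩, n⟩, ?_⟩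
    apply Subtype.ext
    apply Subtype.ext
    change un n • (un (-n) • x) = x
    rw [smul_smul, un_mul_neg, one_smul]

lemma latEquiv_apply (p : (idealSet K J) × (Fin (rank K) → ℤ)) :
    ((latEquiv J p).1 : mixedSpace K) = un p.2 • (p.1 : mixedSpace K) := rfl

lemma unit_smul_real (u : (𝓞 K)ˣ) (c : ℝ) (x : mixedSpace K) : u • (c • x) = c • (u • x) := by
  rw [unitSMul_smul, unitSMul_smul, mul_smul_comm]

lemma Phi_un (n : Fin (rank K) → ℤ) (x : mixedSpace K) (hx : mixedEmbedding.norm x ≠ 0) (c : ℝ) (hc : 0 < c) :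
    Phi K (c • (un n • x)) = chi (mixedEmbedding.norm x * c ^ finrank ℚ K) * ∏ i, bw (n i + co K x i) := by
  have hN : mixedEmbedding.norm (un n • x) ≠ 0 := by rwa [norm_unit_smul]
  rw [Phi, mixedEmbedding.norm_smul, norm_unit_smul, abs_of_pos hc, mul_comm (c ^ finrank ℚ K)]
  congr 1
  apply Finset.prod_congr rfl
  intro i _
  rw [← co_un n x hx i]
  congr 1
  rw [co, co, logMap_real_smul hN hc.ne']

lemma finite_support (t : ℝ) (ht : 0 < t) (θ : ℝ → ℝ) :
    (Function.support fun l : Lat J => θ (mixedEmbedding.norm (t⁻¹ • (l : mixedSpace K))) * Phi K (t⁻¹ • (l : mixedSpace K))).Finite := by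
  have hb : Bornology.IsBounded ((fun x : mixedSpace K => t • x) '' (Function.support (Phi K))) := by
    have hc : IsCompact (closure (Function.support (Phi K))) := Phi_support_bounded.isCompact_closure
    exact ((hc.image (continuous_const_smul t)).isBounded).subset (Set.image_mono subset_closure)
  have hf := ZSpan.setFinite_inter (fractionalIdealLatticeBasis K (FractionalIdeal.mk0 K J)) hb
  refine Set.Finite.of_finite_image (f := Subtype.val) (hf.subset ?_) Subtype.val_injective.injOn
  rintro _ ⟨l, hl, rfl⟩
  refine ⟨⟨t⁻¹ • (l : mixedSpace K), ?_, ?_⟩, l.2⟩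
  · exact right_ne_zero_of_mul hl
  · simp [smul_smul, ht.ne']

theorem weighted (θ : ℝ → ℝ) (hθ : ∀ t, t < 1/3 ∨ 3/2 < t → θ t = 0) (t : ℝ) (ht : 0 < t) :
    ∑' l : Lat J, θ (mixedEmbedding.norm (t⁻¹ • (l : mixedSpace K))) * Phi K (t⁻¹ • (l : mixedSpace K))
      = ∑' a : idealSet K J, θ (mixedEmbedding.norm (a : mixedSpace K) / t ^ finrank ℚ K) := by
  set H : Lat J → ℝ := fun l => θ (mixedEmbedding.norm (t⁻¹ • (l : mixedSpace K))) * Phi K (t⁻¹ • (l : mixedSpace K)) with hH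
  have hfin : (Function.support H).Finite := finite_support J t ht θ
  have hsub : Function.support H ⊆ {x : Lat J | mixedEmbedding.norm (x : mixedSpace K) ≠ 0} := by
    intro l hl h0
    apply hl
    simp only [hH, Phi]
    rw [mixedEmbedding.norm_smul, h0, mul_zero, chi_zero (Or.inl (by norm_num)), zero_mul, mul_zero]
  have h1 : ∑' l : Lat J, H l = ∑' l : {x : Lat J // mixedEmbedding.norm (x : mixedSpace K) ≠ 0}, H l :=
    (tsum_subtype_eq_of_support_subset hsub).symm
  rw [h1, ← (latEquiv J).tsum_eq]
  have hval : ∀ p : (idealSet K J) × (Fin (rank K) → ℤ), H (latEquiv J p).1 =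
      θ (mixedEmbedding.norm (p.1 : mixedSpace K) / t ^ finrank ℚ K) * ∏ i, bw (p.2 i + co K p.1 i) := by
    intro p
    have ha := (mem_cone_iff _).1 ((mem_idealSet' J _).1 p.1.2).1
    simp only [hH, latEquiv_apply]
    rw [Phi_un _ _ ha.1 _ (inv_pos.2 ht), mixedEmbedding.norm_smul, norm_unit_smul, abs_of_pos (inv_pos.2 ht),
      inv_pow, ← div_eq_mul_inv, mul_comm _ (mixedEmbedding.norm (p.1 : mixedSpace K)), ← div_eq_mul_inv]
    by_cases h : mixedEmbedding.norm (p.1 : mixedSpace K) / t ^ finrank ℚ K < 1/3 ∨ 3/2 < mixedEmbedding.norm (p.1 : mixedSpace K) / t ^ finrank ℚ K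
    · rw [hθ _ h, zero_mul, zero_mul]
    · push Not at h
      rw [chi_one h.1 h.2, one_mul]
  have hs : Summable fun p => H (latEquiv J p).1 := by
    apply summable_of_hasFiniteSupport
    have : (fun p => H (latEquiv J p).1) = H ∘ (Subtype.val ∘ latEquiv J) := rfl
    rw [this]
    exact Set.Finite.subset (hfin.preimage ((Subtype.val_injective.comp (latEquiv J).injective).injOn)) (fun x hx => hx)
  rw [hs.tsum_prod]
  apply tsum_congr
  intro a
  have ha := (mem_cone_iff _).1 ((mem_idealSet' J _).1 a.2).1
  simp only [hval]
  rw [tsum_mul_left, bw_prod_sum _ ha.2, mul_one]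

end IdealCount

namespace IdealCount
open Filter

/-- trapezoid function -/
noncomputable def trap (a b k t : ℝ) : ℝ := max 0 (min 1 (min ((t - a) / k) ((b - t) / k)))

lemma trap_nonneg (a b k t : ℝ) : 0 ≤ trap a b k t := le_max_left _ _
lemma trap_le_one (a b k t : ℝ) : trap a b k t ≤ 1 := max_le zero_le_one (min_le_left _ _)
lemma trap_zero {a b k t : ℝ} (hk : 0 < k) (h : t ≤ a ∨ b ≤ t) : trap a b k t = 0 := by
  unfold trap
  apply max_eq_left
  rcases h with h | h
  · exact (min_le_right _ _).trans ((min_le_left _ _).trans (div_nonpos_of_nonpos_of_nonneg (by linarith) hk.le))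
  · exact (min_le_right _ _).trans ((min_le_right _ _).trans (div_nonpos_of_nonpos_of_nonneg (by linarith) hk.le))
lemma trap_one {a b k t : ℝ} (hk : 0 < k) (h1 : a + k ≤ t) (h2 : t ≤ b - k) : trap a b k t = 1 := by
  unfold trap
  rw [min_eq_left, max_eq_right zero_le_one]
  refine le_min ?_ ?_
  · rw [le_div_iff₀ hk]; linarith
  · rw [le_div_iff₀ hk]; linarith

lemma trap_lip {a b k : ℝ} (hk : 0 < k) (x y : ℝ) : |trap a b k x - trap a b k y| ≤ k⁻¹ * |x - y| := by
  unfold trap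
  have h1 : |(x - a) / k - (y - a) / k| = k⁻¹ * |x - y| := by
    rw [← sub_div, abs_div, abs_of_pos hk, div_eq_inv_mul]; congr 2; ring
  have h2 : |(b - x) / k - (b - y) / k| = k⁻¹ * |x - y| := by
    rw [← sub_div, abs_div, abs_of_pos hk, div_eq_inv_mul, abs_sub_comm x y]; congr 2; ring
  have hp : 0 ≤ k⁻¹ * |x - y| := by positivity
  refine (abs_max_sub_max_le_max _ _ _ _).trans (max_le (by simpa using hp) ?_)
  refine (abs_min_sub_min_le_max _ _ _ _).trans (max_le (by simpa using hp) ?_)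
  exact (abs_min_sub_min_le_max _ _ _ _).trans (max_le h1.le h2.le)

section
variable {X : Type*} (ν : X → ℝ)

/-- counting function -/
noncomputable def cA (s : ℝ) : ℝ := Nat.card {a : X // ν a ≤ s}

variable {ν} (hfin : ∀ s, {a : X | ν a ≤ s}.Finite)

lemma cA_eq (hfin : ∀ s, {a : X | ν a ≤ s}.Finite) (s : ℝ) : cA ν s = ((hfin s).toFinset.card : ℝ) := by
  rw [cA, ← Set.ncard_eq_toFinset_card _ (hfin s)]; rfl

lemma cA_mono (hfin : ∀ s, {a : X | ν a ≤ s}.Finite) {s t : ℝ} (h : s ≤ t) : cA ν s ≤ cA ν t := by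
  rw [cA_eq hfin, cA_eq hfin]
  exact_mod_cast Finset.card_le_card (by intro a; simp only [Set.Finite.mem_toFinset, Set.mem_ofPred_eq]; intro ha; linarith)

lemma cA_nonneg (s : ℝ) : 0 ≤ cA ν s := Nat.cast_nonneg _

lemma sub_cA (hfin : ∀ s, {a : X | ν a ≤ s}.Finite) {s t : ℝ} (h : s ≤ t) :
    cA ν t - cA ν s = (((hfin t).toFinset.filter fun a => s < ν a).card : ℝ) := by
  classical
  rw [cA_eq hfin, cA_eq hfin, sub_eq_iff_eq_add]
  have := Finset.card_filter_add_card_filter_not (s := (hfin t).toFinset) (fun a => s < ν a)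
  have h2 : ((hfin t).toFinset.filter fun a => ¬ s < ν a) = (hfin s).toFinset := by
    ext a; simp only [Finset.mem_filter, Set.Finite.mem_toFinset, Set.mem_ofPred_eq, not_lt]
    constructor
    · exact fun h => h.2
    · exact fun h' => ⟨h'.trans h, h'⟩
  rw [h2] at this
  exact_mod_cast this.symm

lemma trap_sum_le (hfin : ∀ s, {a : X | ν a ≤ s}.Finite) {a b k s : ℝ} (hk : 0 < k) (hab : a ≤ b) (hs : 0 < s) :
    ∑' x, trap a b k (ν x / s) ≤ cA ν (b * s) - cA ν (a * s) := by
  rw [sub_cA hfin (by nlinarith), tsum_eq_sum (s := (hfin (b * s)).toFinset.filter fun x => a * s < ν x)]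
  · refine (Finset.sum_le_card_nsmul _ _ 1 fun x _ => trap_le_one _ _ _ _).trans ?_
    simp
  · intro x hx
    simp only [Finset.mem_filter, Set.Finite.mem_toFinset, Set.mem_ofPred_eq, not_and, not_lt] at hx
    apply trap_zero hk
    rw [div_le_iff₀ hs, le_div_iff₀ hs]
    by_cases h : ν x ≤ b * s
    · exact Or.inl (hx h)
    · exact Or.inr (not_le.1 h).le

lemma le_trap_sum (hfin : ∀ s, {a : X | ν a ≤ s}.Finite) {a b k s : ℝ} (hk : 0 < k) (hab : a + k ≤ b - k) (hs : 0 < s) :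
    cA ν ((b - k) * s) - cA ν ((a + k) * s) ≤ ∑' x, trap a b k (ν x / s) := by
  rw [sub_cA hfin (by nlinarith)]
  have hsum : Summable fun x => trap a b k (ν x / s) := by
    apply summable_of_hasFiniteSupport
    refine (hfin (b * s)).subset ?_
    intro x hx
    by_contra h
    simp only [Set.mem_ofPred_eq, not_le] at h
    exact hx (trap_zero hk (Or.inr (by rw [le_div_iff₀ hs]; exact h.le)))
  refine le_trans ?_ (hsum.sum_le_tsum ((hfin ((b - k) * s)).toFinset.filter fun x => (a + k) * s < ν x)
    (fun x _ => trap_nonneg _ _ _ _))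
  rw [Finset.sum_congr rfl (g := fun _ => (1:ℝ))]
  · simp
  · intro x hx
    simp only [Finset.mem_filter, Set.Finite.mem_toFinset, Set.mem_ofPred_eq] at hx
    apply trap_one hk
    · rw [le_div_iff₀ hs]; exact hx.2.le
    · rw [div_le_iff₀ hs]; exact hx.1

theorem abstract_count (hfin : ∀ s, {a : X | ν a ≤ s}.Finite) (ρ : ℝ) (hρ : 0 ≤ ρ)
    (hlim : Tendsto (fun s => cA ν s / s) atTop (nhds ρ)) (η C : ℝ) (hη0 : 0 < η) (hη1 : η ≤ 1) (hC : 0 ≤ C)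
    (H : ∀ a b k : ℝ, 1/3 ≤ a → b ≤ 3/2 → 0 < k → k ≤ 1 → ∃ J : ℝ, ∀ s : ℝ, 1 ≤ s →
      |∑' x, trap a b k (ν x / s) - s * J| ≤ C * k⁻¹ * s ^ (1 - η)) :
    ∃ B, ∀ s : ℝ, 1 ≤ s → |cA ν s - ρ * s| ≤ B * s ^ (1 - η / 2) := by
  have hscale : ∀ c : ℝ, 0 < c → Tendsto (fun s => cA ν (c * s) / s) atTop (nhds (ρ * c)) := by
    intro c hc
    have h1 := (hlim.comp (tendsto_id.const_mul_atTop hc)).mul_const c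
    refine h1.congr' ?_
    filter_upwards [eventually_gt_atTop 0] with s hs
    simp only [Function.comp, id]
    field_simp
  have herr : ∀ D : ℝ, Tendsto (fun s : ℝ => D * s ^ (1 - η) / s) atTop (nhds 0) := by
    intro D
    have h1 := (tendsto_rpow_neg_atTop hη0).const_mul D
    rw [mul_zero] at h1
    refine h1.congr' ?_
    filter_upwards [eventually_gt_atTop 0] with s hs
    rw [Real.rpow_sub hs, Real.rpow_one, Real.rpow_neg hs.le]; field_simp
  have hstep : ∀ s : ℝ, 1 ≤ s → |(cA ν s - ρ * s) - (cA ν (s / 2) - ρ * (s / 2))| ≤ (ρ / 3 + 6 * C) * s ^ (1 - η / 2) := by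
    intro s hs
    have hs0 : 0 < s := by linarith
    set k : ℝ := s ^ (-(η/2)) / 6 with hk
    have hk0 : 0 < k := by positivity
    have hk6 : k ≤ 1/6 := by
      have : s ^ (-(η/2)) ≤ 1 := Real.rpow_le_one_of_one_le_of_nonpos hs (by linarith)
      rw [hk]; linarith
    have hks : k * s = s ^ (1 - η/2) / 6 := by
      rw [hk, show (1 - η/2) = -(η/2) + 1 by ring, Real.rpow_add hs0, Real.rpow_one]; ring
    have hkinv : C * k⁻¹ * s ^ (1 - η) = 6 * C * s ^ (1 - η/2) := by
      rw [hk, show (1 - η/2) = (1 - η) + η/2 by ring, Real.rpow_add hs0, Real.rpow_neg hs0.le]; field_simp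
    obtain ⟨J1, hJ1⟩ := H (1/2 - k) (1 + k) k (by linarith) (by linarith) hk0 (by linarith)
    obtain ⟨J2, hJ2⟩ := H (1/2) 1 k (by linarith) (by linarith) hk0 (by linarith)
    have hb1 : J1 ≤ ρ * (1 + k) - ρ * (1/2 - k) := by
      have hl := ((hscale (1 + k) (by linarith)).sub (hscale (1/2 - k) (by linarith))).add (herr (C * k⁻¹))
      rw [add_zero] at hl
      refine ge_of_tendsto hl ?_
      filter_upwards [eventually_ge_atTop 1] with y hy
      have hy0 : 0 < y := by linarith
      have h1 := hJ1 y hy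
      have h2 := trap_sum_le hfin (a := 1/2 - k) (b := 1 + k) hk0 (by linarith) hy0
      rw [abs_le] at h1
      rw [← sub_div, ← add_div, le_div_iff₀ hy0]
      linarith [h1.1, mul_comm y J1]
    have hb2 : ρ * (1 - k) - ρ * (1/2 + k) ≤ J2 := by
      have hl := ((hscale (1 - k) (by linarith)).sub (hscale (1/2 + k) (by linarith))).sub (herr (C * k⁻¹))
      rw [sub_zero] at hl
      refine le_of_tendsto hl ?_
      filter_upwards [eventually_ge_atTop 1] with y hy
      have hy0 : 0 < y := by linarith
      have h1 := hJ2 y hy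
      have h2 := le_trap_sum hfin (a := 1/2) (b := 1) hk0 (by linarith) hy0
      rw [abs_le] at h1
      rw [← sub_div, ← sub_div, div_le_iff₀ hy0]
      linarith [h1.2, mul_comm y J2]
    have e1 := le_trap_sum hfin (a := 1/2 - k) (b := 1 + k) hk0 (by linarith) hs0
    have e2 := trap_sum_le hfin (a := 1/2) (b := 1) hk0 (by linarith) hs0
    rw [show (1 + k - k) * s = s by ring, show (1/2 - k + k) * s = s / 2 by ring] at e1
    rw [show 1 * s = s by ring, show (1/2) * s = s / 2 by ring] at e2
    have f1 := hJ1 s hs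
    have f2 := hJ2 s hs
    rw [abs_le, hkinv] at f1 f2
    have g1 : s * J1 ≤ s * (ρ * (1 + k) - ρ * (1/2 - k)) := mul_le_mul_of_nonneg_left hb1 hs0.le
    have g2 : s * (ρ * (1 - k) - ρ * (1/2 + k)) ≤ s * J2 := mul_le_mul_of_nonneg_left hb2 hs0.le
    have g3 : ρ * (k * s) = ρ * (s ^ (1 - η/2) / 6) := by rw [hks]
    rw [abs_le]
    constructor
    · nlinarith [f1.1, f1.2, f2.1, f2.2]
    · nlinarith [f1.1, f1.2, f2.1, f2.2]
  set D := ρ / 3 + 6 * C with hD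
  have hD0 : 0 ≤ D := by positivity
  set B := 4 * D + 2 * (cA ν 1 + ρ) with hB
  have hB0 : 0 ≤ B := by have := cA_nonneg (ν := ν) 1; positivity
  have hmain : ∀ n : ℕ, ∀ s : ℝ, 1/2 ≤ s → s < 2 ^ n → |cA ν s - ρ * s| ≤ B * s ^ (1 - η/2) := by
    intro n
    induction n with
    | zero =>
      intro s hs1 hs2
      rw [pow_zero] at hs2
      have h1 := cA_mono hfin hs2.le
      have h2 := cA_nonneg (ν := ν) s
      have h3 : |cA ν s - ρ * s| ≤ cA ν 1 + ρ := by
        rw [abs_le]; constructor <;> nlinarith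
      have h4 : (1/2 : ℝ) ≤ s ^ (1 - η/2) := by
        calc (1/2 : ℝ) ≤ s := hs1
          _ = s ^ (1:ℝ) := (Real.rpow_one s).symm
          _ ≤ s ^ (1 - η/2) := Real.rpow_le_rpow_of_exponent_ge (by linarith) hs2.le (by linarith)
      nlinarith
    | succ n ih =>
      intro s hs1 hs2
      rcases lt_or_ge s 1 with h | h
      · have h2 : s < 2 ^ n := lt_of_lt_of_le h (one_le_pow₀ (by norm_num))
        exact ih s hs1 h2
      · have h1 := ih (s / 2) (by linarith) (by rw [pow_succ] at hs2; linarith)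
        have h2 := hstep s h
        have h3 : (s / 2) ^ (1 - η/2) ≤ 3/4 * s ^ (1 - η/2) := by
          rw [Real.div_rpow (by linarith) (by norm_num), div_eq_inv_mul]
          apply mul_le_mul_of_nonneg_right _ (by positivity)
          have h5 : (2:ℝ) ^ (1/2 : ℝ) ≤ 2 ^ (1 - η/2) := Real.rpow_le_rpow_of_exponent_le (by norm_num) (by linarith)
          have h6 : (4/3 : ℝ) ≤ 2 ^ (1/2 : ℝ) := by
            rw [← Real.sqrt_eq_rpow]; exact Real.le_sqrt_of_sq_le (by norm_num)
          calc ((2:ℝ) ^ (1 - η/2))⁻¹ ≤ (4/3 : ℝ)⁻¹ := inv_anti₀ (by norm_num) (h6.trans h5)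
            _ = 3/4 := by norm_num
        have h7 : |cA ν s - ρ * s| ≤ |(cA ν s - ρ * s) - (cA ν (s / 2) - ρ * (s / 2))| + |cA ν (s/2) - ρ * (s/2)| := by
          have := abs_add_le ((cA ν s - ρ * s) - (cA ν (s / 2) - ρ * (s / 2))) (cA ν (s/2) - ρ * (s/2))
          simpa using this
        have h8 : B * (s / 2) ^ (1 - η/2) ≤ B * (3/4 * s ^ (1 - η/2)) := mul_le_mul_of_nonneg_left h3 hB0
        have h9 : D ≤ B / 4 := by have := cA_nonneg (ν := ν) 1; rw [hB]; linarith
        have h10 : 0 ≤ s ^ (1 - η/2) := by positivity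
        nlinarith
  refine ⟨B, fun s hs => ?_⟩
  obtain ⟨n, hn⟩ := pow_unbounded_of_one_lt s (one_lt_two)
  exact hmain n s (by linarith) hn

end
end IdealCount

namespace IdealCount
open MeasureTheory Module NumberField NumberField.mixedEmbedding NumberField.mixedEmbedding.fundamentalCone
  NumberField.InfinitePlace NumberField.Units NumberField.Units.dirichletUnitTheorem Filter Topology
open scoped Classical nonZeroDivisors

variable {K : Type*} [Field K] [NumberField K]

/-- bounded and Lipschitz on a ball -/
def LB (R : ℝ) (f : mixedSpace K → ℝ) : Prop :=
  ∃ B, 0 ≤ B ∧ ∀ x y, ‖x‖ ≤ R → ‖y‖ ≤ R → |f x| ≤ B ∧ |f x - f y| ≤ B * ‖x - y‖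

lemma LB.mul {R : ℝ} {f g : mixedSpace K → ℝ} (hf : LB R f) (hg : LB R g) : LB R (f * g) := by
  obtain ⟨B, hB, h1⟩ := hf
  obtain ⟨D, hD, h2⟩ := hg
  refine ⟨B * D + (B * D + B * D), by positivity, fun x y hx hy => ⟨?_, ?_⟩⟩
  · have h3 : |f x * g x| ≤ B * D := by
      rw [abs_mul]; exact mul_le_mul (h1 x y hx hy).1 (h2 x y hx hy).1 (abs_nonneg _) hB
    simp only [Pi.mul_apply]
    nlinarith [mul_nonneg hB hD]
  · simp only [Pi.mul_apply]
    have e : f x * g x - f y * g y = f x * (g x - g y) + (f x - f y) * g y := by ring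
    rw [e]
    refine (abs_add_le _ _).trans ?_
    rw [abs_mul, abs_mul]
    have h3 : |f x| * |g x - g y| ≤ B * (D * ‖x - y‖) :=
      mul_le_mul (h1 x y hx hy).1 (h2 x y hx hy).2 (abs_nonneg _) hB
    have h4 : |f x - f y| * |g y| ≤ (B * ‖x - y‖) * D :=
      mul_le_mul (h1 x y hx hy).2 (h2 y x hy hx).1 (abs_nonneg _) (by positivity)
    have h5 : 0 ≤ B * D * ‖x - y‖ := by positivity
    nlinarith

lemma LB_one (R : ℝ) : LB R (1 : mixedSpace K → ℝ) := ⟨1, zero_le_one, fun x y _ _ => by simp⟩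

lemma LB_normAtPlace (R : ℝ) (hR : 0 ≤ R) (w : InfinitePlace K) : LB R (fun x : mixedSpace K => normAtPlace w x) := by
  have key : ∀ x y : mixedSpace K, |normAtPlace w x - normAtPlace w y| ≤ ‖x - y‖ := by
    intro x y
    by_cases hw : IsReal w
    · simp only [normAtPlace_apply_of_isReal hw]
      refine (abs_norm_sub_norm_le _ _).trans ?_
      exact (norm_le_pi_norm (x - y).1 ⟨w, hw⟩).trans (norm_fst_le _)
    · rw [not_isReal_iff_isComplex] at hw
      simp only [normAtPlace_apply_of_isComplex hw]
      refine (abs_norm_sub_norm_le _ _).trans ?_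
      exact (norm_le_pi_norm (x - y).2 ⟨w, hw⟩).trans (norm_snd_le _)
  refine ⟨R + 1, by positivity, fun x y hx hy => ⟨?_, ?_⟩⟩
  · have := key x 0
    simp only [map_zero, sub_zero] at this
    linarith
  · have := key x y
    nlinarith [norm_nonneg (x - y)]

lemma LB_norm (R : ℝ) (hR : 0 ≤ R) : LB R (fun x : mixedSpace K => mixedEmbedding.norm x) := by
  have : (fun x : mixedSpace K => mixedEmbedding.norm x) =
      ∏ w : InfinitePlace K, ∏ _i ∈ Finset.range (mult w), (fun x : mixedSpace K => normAtPlace w x) := by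
    ext x
    simp [mixedEmbedding.norm_apply, Finset.prod_apply]
  rw [this]
  apply Finset.prod_induction _ (LB R) (fun _ _ => LB.mul) (LB_one R)
  intro w _
  apply Finset.prod_induction _ (LB R) (fun _ _ => LB.mul) (LB_one R)
  intro _ _
  exact LB_normAtPlace R hR w

variable (K) in
lemma F_lip : ∃ R C : ℝ, 0 ≤ R ∧ 0 ≤ C ∧ (∀ x : mixedSpace K, R < ‖x‖ → Phi K x = 0) ∧ ∀ a b k : ℝ, 0 < k → k ≤ 1 →
    ∀ x y : mixedSpace K, |trap a b k (mixedEmbedding.norm x) * Phi K x - trap a b k (mixedEmbedding.norm y) * Phi K y|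
      ≤ C * k⁻¹ * ‖x - y‖ := by
  obtain ⟨R, hR⟩ := (Phi_support_bounded (K := K)).exists_norm_le
  obtain ⟨L, hL⟩ := Phi_contDiff.lipschitzWith_of_hasCompactSupport (Phi_compact (K := K)) one_ne_zero
  set R' := max R 0
  obtain ⟨B, hB, hN⟩ := LB_norm (K := K) R' (le_max_right _ _)
  have hsupp : ∀ x : mixedSpace K, Phi K x ≠ 0 → ‖x‖ ≤ R' := fun x hx => (hR x hx).trans (le_max_left _ _)
  refine ⟨R', L + B, le_max_right _ _, by positivity, fun x hx => by_contra fun h => not_le.2 hx (hsupp x h), ?_⟩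
  have key : ∀ a b k : ℝ, 0 < k → k ≤ 1 → ∀ x y : mixedSpace K, Phi K x ≠ 0 →
      |trap a b k (mixedEmbedding.norm x) * Phi K x - trap a b k (mixedEmbedding.norm y) * Phi K y|
      ≤ (L + B) * k⁻¹ * ‖x - y‖ := by
    intro a b k hk hk1 x y hx
    have hk2 : 1 ≤ k⁻¹ := (one_le_inv₀ hk).2 hk1
    have hl : |Phi K x - Phi K y| ≤ L * ‖x - y‖ := by
      have := hL.dist_le_mul x y
      rwa [Real.dist_eq, dist_eq_norm] at this
    have e : trap a b k (mixedEmbedding.norm x) * Phi K x - trap a b k (mixedEmbedding.norm y) * Phi K y =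
      trap a b k (mixedEmbedding.norm x) * (Phi K x - Phi K y) +
        (trap a b k (mixedEmbedding.norm x) - trap a b k (mixedEmbedding.norm y)) * Phi K y := by ring
    rw [e]
    refine (abs_add_le _ _).trans ?_
    rw [abs_mul, abs_mul, abs_of_nonneg (trap_nonneg _ _ _ _)]
    have h1 : trap a b k (mixedEmbedding.norm x) * |Phi K x - Phi K y| ≤ L * ‖x - y‖ := by
      refine (mul_le_of_le_one_left (abs_nonneg _) (trap_le_one _ _ _ _)).trans hl
    have h2 : |trap a b k (mixedEmbedding.norm x) - trap a b k (mixedEmbedding.norm y)| * |Phi K y| ≤ B * k⁻¹ * ‖x - y‖ := by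
      by_cases hy : Phi K y = 0
      · rw [hy, abs_zero, mul_zero]; positivity
      · have h3 := (hN x y (hsupp x hx) (hsupp y hy)).2
        have h4 := trap_lip (a := a) (b := b) hk (mixedEmbedding.norm x) (mixedEmbedding.norm y)
        have h5 : |Phi K y| ≤ 1 := by rw [abs_of_nonneg (Phi_bound y).1]; exact (Phi_bound y).2
        refine (mul_le_of_le_one_right (abs_nonneg _) h5).trans (h4.trans ?_)
        calc k⁻¹ * |mixedEmbedding.norm x - mixedEmbedding.norm y| ≤ k⁻¹ * (B * ‖x - y‖) :=
              mul_le_mul_of_nonneg_left h3 (by positivity)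
          _ = B * k⁻¹ * ‖x - y‖ := by ring
    have h3 : (L:ℝ) * ‖x - y‖ ≤ L * k⁻¹ * ‖x - y‖ := by
      apply mul_le_mul_of_nonneg_right _ (norm_nonneg _)
      exact le_mul_of_one_le_right (by positivity) hk2
    linarith [add_mul (L:ℝ) B k⁻¹, add_mul ((L:ℝ) * k⁻¹) (B * k⁻¹) ‖x - y‖, congrArg (· * ‖x - y‖) (add_mul (L:ℝ) B k⁻¹)]
  intro a b k hk hk1 x y
  by_cases hx : Phi K x = 0
  · by_cases hy : Phi K y = 0
    · rw [hx, hy]; simp; positivity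
    · have := key a b k hk hk1 y x hy
      rwa [abs_sub_comm, norm_sub_rev]
  · exact key a b k hk hk1 x y hx

variable (J : (Ideal (𝓞 K))⁰)

/-- the norm on the ideal set -/
noncomputable def nu (a : idealSet K J) : ℝ := mixedEmbedding.norm (a : mixedSpace K)

lemma nu_fin (s : ℝ) : {a : idealSet K J | nu J a ≤ s}.Finite := by
  obtain ⟨t, ht, hts⟩ : ∃ t : ℝ, 1 ≤ t ∧ s ≤ t ^ finrank ℚ K := by
    refine ⟨max s 1, le_max_right _ _, (le_max_left s 1).trans ?_⟩
    exact le_self_pow₀ (le_max_right _ _) finrank_pos.ne'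
  have ht0 : 0 < t := by linarith
  have hb : Bornology.IsBounded ((fun x : mixedSpace K => t • x) '' (normLeOne K)) := by
    have hc : IsCompact (closure (normLeOne K)) := (isBounded_normLeOne K).isCompact_closure
    exact ((hc.image (continuous_const_smul t)).isBounded).subset (Set.image_mono subset_closure)
  have hf := ZSpan.setFinite_inter (fractionalIdealLatticeBasis K (FractionalIdeal.mk0 K J)) hb
  refine Set.Finite.of_finite_image (f := Subtype.val) (hf.subset ?_) Subtype.val_injective.injOn
  rintro _ ⟨l, hl, rfl⟩
  have hl' : mixedEmbedding.norm (l : mixedSpace K) ≤ s := hl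
  have hm := (mem_idealSet' J _).1 l.2
  refine ⟨⟨t⁻¹ • (l : mixedSpace K), ⟨smul_mem_of_mem hm.1 (inv_pos.2 ht0).ne', ?_⟩, ?_⟩, hm.2⟩
  · change mixedEmbedding.norm _ ≤ 1
    rw [mixedEmbedding.norm_smul, abs_of_pos (inv_pos.2 ht0), inv_pow, inv_mul_le_iff₀ (by positivity), mul_one]
    linarith
  · simp [smul_smul, ht0.ne']

lemma trap_asymp : ∃ C : ℝ, 0 ≤ C ∧ ∀ a b k : ℝ, 1/3 ≤ a → b ≤ 3/2 → 0 < k → k ≤ 1 → ∃ I : ℝ, ∀ s : ℝ, 1 ≤ s →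
      |∑' x, trap a b k (nu J x / s) - s * I| ≤ C * k⁻¹ * s ^ (1 - (1 / finrank ℚ K : ℝ)) := by
  obtain ⟨R, C0, hR, hC0, hsupp, hlip⟩ := F_lip K
  let b := fractionalIdealLatticeBasis K (FractionalIdeal.mk0 K J)
  obtain ⟨C1, hC1, hlat⟩ := lattice_sum (volume : Measure (mixedSpace K)) b R hR
  set v := (volume : Measure (mixedSpace K)).real (ZSpan.fundamentalDomain b) with hv
  have hv0 : 0 < v := by
    rw [hv, MeasureTheory.measureReal_def]
    exact ENNReal.toReal_pos (ZSpan.measure_fundamentalDomain_ne_zero b) (ZSpan.fundamentalDomain_isBounded b).measure_lt_top.ne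
  refine ⟨C1 * C0 / v, by positivity, ?_⟩
  intro a b' k ha hb hk hk1
  set F : mixedSpace K → ℝ := fun x => trap a b' k (mixedEmbedding.norm x) * Phi K x with hF
  refine ⟨(∫ x, F x) / v, fun s hs => ?_⟩
  have hs0 : 0 < s := by linarith
  set d := finrank ℚ K with hd
  have hd0 : 0 < d := finrank_pos
  set t := s ^ (1 / d : ℝ) with ht
  have htd : t ^ d = s := by
    rw [ht, ← Real.rpow_natCast, ← Real.rpow_mul hs0.le, one_div, inv_mul_cancel₀ (by positivity), Real.rpow_one]
  have ht1 : 1 ≤ t := Real.one_le_rpow hs (by positivity)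
  have h1 := hlat F (C0 * k⁻¹) t (by positivity) ht1 (hlip a b' k hk hk1) (fun x hx => by simp [hF, hsupp x hx])
  rw [mixedEmbedding.finrank, ← hd, htd] at h1
  have h2 := weighted J (trap a b' k) (fun u hu => trap_zero hk (by rcases hu with h | h; exacts [Or.inl (by linarith), Or.inr (by linarith)])) t (by linarith)
  rw [← hd, htd] at h2
  change ∑' l : Lat J, F (t⁻¹ • (l : mixedSpace K)) = ∑' x, trap a b' k (nu J x / s) at h2
  change |v * ∑' l : Lat J, F (t⁻¹ • (l : mixedSpace K)) - _| ≤ _ at h1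
  rw [h2] at h1
  have h3 : v * ∑' x, trap a b' k (nu J x / s) - s * ∫ x, F x = v * (∑' x, trap a b' k (nu J x / s) - s * ((∫ x, F x) / v)) := by
    field_simp
  rw [h3, abs_mul, abs_of_pos hv0] at h1
  have h4 : t⁻¹ * s = s ^ (1 - (1 / d : ℝ)) := by
    rw [Real.rpow_sub hs0, Real.rpow_one, ← ht]; field_simp
  rw [← h4, show C1 * C0 / v * k⁻¹ * (t⁻¹ * s) = (C1 * (C0 * k⁻¹) * t⁻¹ * s) / v by ring, le_div_iff₀ hv0, mul_comm]
  exact h1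

variable (K) in
/-- number of ideals in a class -/
noncomputable def cC (C : ClassGroup (𝓞 K)) (s : ℝ) : ℝ :=
  Nat.card {I : (Ideal (𝓞 K))⁰ // Ideal.absNorm (I : Ideal (𝓞 K)) ≤ s ∧ ClassGroup.mk0 I = C}

lemma class_aux (C : ClassGroup (𝓞 K)) (hJ : ClassGroup.mk0 J = C⁻¹) (s : ℝ) :
    cC K C s * torsionOrder K = cA (nu J) (s * Ideal.absNorm (J : Ideal (𝓞 K))) := by
  have h1 : Nat.card {I : (Ideal (𝓞 K))⁰ // Ideal.absNorm (I : Ideal (𝓞 K)) ≤ s ∧ ClassGroup.mk0 I = C}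
      = Nat.card {I : (Ideal (𝓞 K))⁰ // (J : Ideal (𝓞 K)) ∣ I ∧ Submodule.IsPrincipal (I : Ideal (𝓞 K)) ∧
        Ideal.absNorm (I : Ideal (𝓞 K)) ≤ s * Ideal.absNorm (J : Ideal (𝓞 K))} := by
    simp_rw [← nonZeroDivisors_dvd_iff_dvd_coe]
    refine Nat.card_congr ?_
    refine ((Equiv.dvd J).subtypeEquiv fun I ↦ ?_).trans
      (Equiv.subtypeSubtypeEquivSubtypeInter (fun I : (Ideal (𝓞 K))⁰ ↦ J ∣ I) _)
    rw [← ClassGroup.mk0_eq_one_iff (SetLike.coe_mem _)]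
    simp_rw [Equiv.dvd_apply, Submonoid.coe_mul, ← Submonoid.mul_def, _root_.map_mul, hJ,
      inv_mul_eq_one, Nat.cast_mul, mul_comm s, eq_comm, and_comm, and_congr_left_iff]
    exact fun _ ↦
      (mul_le_mul_iff_of_pos_left (Nat.cast_pos.mpr (Ideal.absNorm_pos_of_nonZeroDivisors J))).symm
  have h2 := card_isPrincipal_dvd_norm_le K J (s * Ideal.absNorm (J : Ideal (𝓞 K)))
  rw [cC, h1, cA]
  exact_mod_cast h2

variable (K) in
lemma class_count : ∃ ρ : ℝ, 0 < ρ ∧ ∀ C : ClassGroup (𝓞 K), ∃ B, ∀ s : ℝ, 1 ≤ s →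
    |cC K C s - ρ * s| ≤ B * s ^ (1 - (1 / finrank ℚ K : ℝ) / 2) := by
  set ρ := (2 ^ nrRealPlaces K * (2 * Real.pi) ^ nrComplexPlaces K * regulator K) /
            (torsionOrder K * Real.sqrt |discr K|) with hρ
  have hw : (0:ℝ) < torsionOrder K := Nat.cast_pos.2 (Nat.pos_of_ne_zero (torsionOrder_ne_zero K))
  have hρ0 : 0 < ρ := by
    have h1 := regulator_pos K
    have h3 : (0:ℝ) < Real.sqrt |discr K| := Real.sqrt_pos.2 (by
      have := abs_pos.2 (discr_ne_zero K); exact_mod_cast this)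
    positivity
  refine ⟨ρ, hρ0, fun C => ?_⟩
  obtain ⟨J, hJ⟩ := ClassGroup.mk0_surjective C⁻¹
  set n : ℝ := ((Ideal.absNorm (J : Ideal (𝓞 K)) : ℕ) : ℝ) with hn
  have hn1 : 1 ≤ n := by
    have := Ideal.absNorm_pos_of_nonZeroDivisors J
    rw [hn]; exact_mod_cast this
  have hn0 : 0 < n := by linarith
  set w : ℝ := ((torsionOrder K : ℕ) : ℝ) with hwdef
  have hcA : ∀ s, cA (nu J) s = cC K C (s / n) * w := by
    intro s
    rw [class_aux J C hJ, ← hn, div_mul_cancel₀ _ hn0.ne']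
  have hlim0 : Tendsto (fun s => cC K C s / s) atTop (𝓝 ρ) := NumberField.Ideal.tendsto_norm_le_and_mk_eq_div_atTop K C
  have hlim : Tendsto (fun s => cA (nu J) s / s) atTop (𝓝 (ρ * (w / n))) := by
    have h1 := (hlim0.comp (tendsto_id.atTop_div_const hn0)).mul_const (w / n)
    refine h1.congr' ?_
    filter_upwards [eventually_gt_atTop 0] with s hs
    simp only [Function.comp, id, hcA]
    field_simp
  obtain ⟨C1, hC1, hasym⟩ := trap_asymp J
  have hd0 : (0:ℝ) < finrank ℚ K := Nat.cast_pos.2 finrank_pos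
  have hd1 : (1:ℝ) ≤ finrank ℚ K := Nat.one_le_cast.2 finrank_pos
  obtain ⟨B, hB⟩ := abstract_count (nu_fin J) (ρ * (w / n)) (by positivity) hlim (1 / finrank ℚ K) C1 (by positivity)
    (by rw [div_le_one hd0]; exact hd1) hC1 hasym
  refine ⟨B * n ^ (1 - (1 / finrank ℚ K : ℝ) / 2) / w, fun s hs => ?_⟩
  have h1 := hB (s * n) (by nlinarith)
  rw [hcA, mul_div_cancel_right₀ _ hn0.ne', Real.mul_rpow (by linarith) hn0.le,
    show cC K C s * w - ρ * (w / n) * (s * n) = (cC K C s - ρ * s) * w by field_simp, abs_mul, abs_of_pos hw] at h1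
  have h2 := (le_div_iff₀ hw).2 h1
  calc _ ≤ _ := h2
    _ = _ := by ring

variable (K) in
lemma sum_cC (s : ℝ) (hs : 0 ≤ s) : (Nat.card {I : (Ideal (𝓞 K))⁰ // Ideal.absNorm (I : Ideal (𝓞 K)) ≤ s} : ℝ) = ∑ C, cC K C s := by
  have : Fintype {I : (Ideal (𝓞 K))⁰ // Ideal.absNorm (I : Ideal (𝓞 K)) ≤ s} := by
    simp_rw [← Nat.le_floor_iff hs]
    refine @Fintype.ofFinite _ (Ideal.finite_setOfPred_absNorm_le₀ ⌊s⌋₊)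
  let e := fun C : ClassGroup (𝓞 K) ↦ Equiv.subtypeSubtypeEquivSubtypeInter
    (fun I : (Ideal (𝓞 K))⁰ ↦ Ideal.absNorm I.1 ≤ s) (fun I ↦ ClassGroup.mk0 I = C)
  simp_rw [cC, ← Nat.card_congr (e _), Nat.card_eq_fintype_card, Fintype.subtype_card]
  rw [Fintype.card, Finset.card_eq_sum_card_fiberwise (f := fun I ↦ ClassGroup.mk0 I.1)
    (t := Finset.univ) (fun _ _ ↦ Finset.mem_univ _), Nat.cast_sum]

variable (K) in
theorem ideal_count : ∃ ρ δ B : ℝ, 0 < ρ ∧ 0 < δ ∧ δ ≤ 1 ∧ ∀ s : ℝ, 1 ≤ s →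
    |(Nat.card {I : (Ideal (𝓞 K))⁰ // Ideal.absNorm (I : Ideal (𝓞 K)) ≤ s} : ℝ) - ρ * s| ≤ B * s ^ (1 - δ) := by
  obtain ⟨ρ, hρ, hC⟩ := class_count K
  choose B hB using hC
  have hd0 : (0:ℝ) < finrank ℚ K := Nat.cast_pos.2 finrank_pos
  have hd1 : (1:ℝ) ≤ finrank ℚ K := Nat.one_le_cast.2 finrank_pos
  refine ⟨∑ _C : ClassGroup (𝓞 K), ρ, (1 / finrank ℚ K : ℝ) / 2, ∑ C, B C, ?_, by positivity, ?_, fun s hs => ?_⟩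
  · rw [Finset.sum_const, nsmul_eq_mul]
    have : 0 < (Finset.univ : Finset (ClassGroup (𝓞 K))).card := Finset.card_pos.2 Finset.univ_nonempty
    positivity
  · have : (1 / finrank ℚ K : ℝ) ≤ 1 := by rw [div_le_one hd0]; exact hd1
    linarith
  · rw [sum_cC K s (by linarith), Finset.sum_mul, Finset.sum_mul, ← Finset.sum_sub_distrib]
    exact (Finset.abs_sum_le_sum_abs _ _).trans (Finset.sum_le_sum fun C _ => hB C s hs)

end IdealCount

namespace PrimeIdealBound
open NumberField Finset SelbergBound UniqueFactorizationMonoid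
open scoped Classical nonZeroDivisors

variable (K : Type*) [Field K] [NumberField K]

lemma fin_ID (n : ℕ) (_hn : 0 < n) : {I : Ideal (𝓞 K) | Ideal.absNorm I = n}.Finite :=
  Ideal.finite_setOfPred_absNorm_eq n

/-- ideals of norm `n` -/
noncomputable def ID (n : ℕ) : Finset (Ideal (𝓞 K)) :=
  if h : 0 < n then (fin_ID K n h).toFinset else ∅

variable {K}

lemma mem_ID {n : ℕ} {I : Ideal (𝓞 K)} : I ∈ ID K n ↔ 0 < n ∧ Ideal.absNorm I = n := by
  unfold ID
  split_ifs with h <;> simp [h]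

lemma ID_ne_bot {n : ℕ} {I : Ideal (𝓞 K)} (h : I ∈ ID K n) : I ≠ ⊥ := by
  rw [mem_ID] at h
  rintro rfl
  simp at h
  omega

variable (K)

/-- number of ideals of norm `n` -/
noncomputable def rE : ArithmeticFunction ℝ := ⟨fun n => ((ID K n).card : ℝ), by simp [ID]⟩

/-- pairs (prime, exponent) -/
noncomputable def SP (n : ℕ) : Finset (Ideal (𝓞 K) × ℕ) :=
  (((Finset.Icc 1 n).biUnion (ID K)).filter fun P => Prime P) ×ˢ Finset.Icc 1 n

variable {K}

lemma mem_SP {n : ℕ} {q : Ideal (𝓞 K) × ℕ} : q ∈ SP K n ↔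
    (Prime q.1 ∧ Ideal.absNorm q.1 ≤ n) ∧ 1 ≤ q.2 ∧ q.2 ≤ n := by
  simp only [SP, mem_product, mem_filter, mem_biUnion, mem_Icc, mem_ID]
  constructor
  · rintro ⟨⟨⟨a, h1, h2⟩, h3⟩, h4⟩
    exact ⟨⟨h3, by omega⟩, h4⟩
  · rintro ⟨⟨h3, h5⟩, h4⟩
    have : Ideal.absNorm q.1 ≠ 0 := by
      rw [Ne, Ideal.absNorm_eq_zero_iff]; exact h3.ne_zero
    exact ⟨⟨⟨Ideal.absNorm q.1, ⟨by omega, h5⟩, by omega, rfl⟩, h3⟩, h4⟩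

lemma two_le_norm {P : Ideal (𝓞 K)} (hP : Prime P) : 2 ≤ Ideal.absNorm P := by
  have h0 : Ideal.absNorm P ≠ 0 := by
    rw [Ne, Ideal.absNorm_eq_zero_iff]; exact hP.ne_zero
  have h1 : Ideal.absNorm P ≠ 1 := by
    rw [Ne, Ideal.absNorm_eq_one_iff]; intro h; exact hP.not_isUnit (by rw [h, ← Ideal.one_eq_top]; exact isUnit_one)
  omega

/-- the von Mangoldt function of `K` -/
noncomputable def LE (K : Type*) [Field K] [NumberField K] : ArithmeticFunction ℝ :=
  ⟨fun n => ∑ q ∈ (SP K n).filter (fun q => Ideal.absNorm q.1 ^ q.2 = n), Real.log (Ideal.absNorm q.1), by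
    simp [SP]⟩

lemma LE_eq {b n : ℕ} (hbn : b ≤ n) : LE K b =
    ∑ q ∈ (SP K n).filter (fun q => Ideal.absNorm q.1 ^ q.2 = b), Real.log (Ideal.absNorm q.1) := by
  change ∑ q ∈ (SP K b).filter (fun q => Ideal.absNorm q.1 ^ q.2 = b), Real.log (Ideal.absNorm q.1) = _
  congr 1
  ext q
  simp only [mem_filter, mem_SP]
  constructor
  · rintro ⟨⟨⟨h1, h2⟩, h3, h4⟩, h5⟩
    exact ⟨⟨⟨h1, by omega⟩, h3, by omega⟩, h5⟩
  · rintro ⟨⟨⟨h1, h2⟩, h3, h4⟩, h5⟩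
    refine ⟨⟨⟨h1, ?_⟩, h3, ?_⟩, h5⟩
    · rw [← h5]; exact Nat.le_self_pow (by omega) _
    · rw [← h5]
      exact (Nat.lt_pow_self (two_le_norm h1)).le

lemma LE_nonneg (n : ℕ) : 0 ≤ LE K n :=
  Finset.sum_nonneg fun _ _ => Real.log_natCast_nonneg _

lemma log_norm_eq {n : ℕ} {I : Ideal (𝓞 K)} (hI : I ∈ ID K n) :
    Real.log n = ∑ q ∈ (SP K n).filter (fun q => q.1 ^ q.2 ∣ I), Real.log (Ideal.absNorm q.1) := by
  have hI0 := ID_ne_bot hI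
  have hI' := mem_ID.1 hI
  have hcount : ∀ P : Ideal (𝓞 K), Prime P → ∀ k : ℕ, P ^ k ∣ I ↔ k ≤ (normalizedFactors I).count P := by
    intro P hP k
    have h := normalizedFactors_of_irreducible_pow hP.irreducible k
    rw [normalize_eq] at h
    rw [Multiset.le_count_iff_replicate_le, ← h,
      ← dvd_iff_normalizedFactors_le_normalizedFactors (pow_ne_zero _ hP.ne_zero) hI0]
  have hle : ∀ P : Ideal (𝓞 K), Prime P → ∀ k : ℕ, P ^ k ∣ I → k ≤ n := by
    intro P hP k hk
    have := Ideal.absNorm_dvd_absNorm_of_le (Ideal.dvd_iff_le.1 hk)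
    rw [hI'.2, map_pow] at this
    have h1 := Nat.le_of_dvd hI'.1 this
    exact (Nat.lt_pow_self (two_le_norm hP)).le.trans h1
  have h1 : (normalizedFactors I).prod = I := by
    have := Ideal.prod_normalizedFactors_eq_self hI0
    simpa using this
  have h2 : (n : ℝ) = ∏ P ∈ (normalizedFactors I).toFinset, (Ideal.absNorm P : ℝ) ^ (normalizedFactors I).count P := by
    rw [← hI'.2]
    conv_lhs => rw [← h1]
    rw [Finset.prod_multiset_count, map_prod]
    push_cast
    simp
  rw [h2, Real.log_prod (fun P hP => by
    have hP' := prime_of_normalized_factor P (Multiset.mem_toFinset.1 hP)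
    have := two_le_norm hP'
    positivity)]
  rw [SP, Finset.sum_filter, Finset.sum_product]
  have hsub : (normalizedFactors I).toFinset ⊆ ((Finset.Icc 1 n).biUnion (ID K)).filter fun P => Prime P := by
    intro P hP
    rw [Multiset.mem_toFinset] at hP
    have hP' := prime_of_normalized_factor P hP
    have hd := dvd_of_mem_normalizedFactors hP
    have := Ideal.absNorm_dvd_absNorm_of_le (Ideal.dvd_iff_le.1 hd)
    rw [hI'.2] at this
    have h3 := Nat.le_of_dvd hI'.1 this
    have h4 := two_le_norm hP'
    simp only [mem_filter, mem_biUnion, mem_Icc, mem_ID]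
    exact ⟨⟨Ideal.absNorm P, by omega, by omega, rfl⟩, hP'⟩
  rw [← Finset.sum_subset hsub]
  · apply Finset.sum_congr rfl
    intro P hP
    have hP' := prime_of_normalized_factor P (Multiset.mem_toFinset.1 hP)
    simp only
    rw [Real.log_pow, ← Finset.sum_filter, Finset.sum_const, nsmul_eq_mul]
    congr 2
    have : (Finset.Icc 1 n).filter (fun k => P ^ k ∣ I) = Finset.Icc 1 ((normalizedFactors I).count P) := by
      ext k
      simp only [mem_filter, mem_Icc]
      constructor
      · rintro ⟨⟨h3, h4⟩, h5⟩; exact ⟨h3, (hcount P hP' k).1 h5⟩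
      · rintro ⟨h3, h4⟩
        have h5 := (hcount P hP' k).2 h4
        exact ⟨⟨h3, hle P hP' k h5⟩, h5⟩
    rw [this, Nat.card_Icc, Nat.add_sub_cancel]
  · intro P hP hP2
    rw [mem_filter] at hP
    apply Finset.sum_eq_zero
    intro k hk
    rw [if_neg]
    rw [hcount P hP.2, Multiset.count_eq_zero_of_notMem (by rwa [Multiset.mem_toFinset] at hP2)]
    rw [mem_Icc] at hk
    omega

lemma card_dvd (n : ℕ) (hn : 0 < n) (Q : Ideal (𝓞 K)) (hQ : Q ≠ ⊥) :
    ((ID K n).filter fun I => Q ∣ I).card =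
      if Ideal.absNorm Q ∣ n then (ID K (n / Ideal.absNorm Q)).card else 0 := by
  have hQ0 : Ideal.absNorm Q ≠ 0 := by rwa [Ne, Ideal.absNorm_eq_zero_iff]
  split_ifs with h
  · symm
    apply Finset.card_bij (fun I _ => Q * I)
    · intro I hI
      rw [mem_ID] at hI
      rw [mem_filter, mem_ID, map_mul, hI.2]
      exact ⟨⟨hn, Nat.mul_div_cancel' h⟩, dvd_mul_right _ _⟩
    · intro I _ I' _ h'
      exact mul_left_cancel₀ hQ h'
    · intro I hI
      rw [mem_filter, mem_ID] at hI
      obtain ⟨⟨_, h1⟩, I', rfl⟩ := hI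
      refine ⟨I', ?_, rfl⟩
      rw [map_mul] at h1
      rw [mem_ID]
      have : n / Ideal.absNorm Q = Ideal.absNorm I' := by
        rw [← h1, Nat.mul_div_cancel_left _ (Nat.pos_of_ne_zero hQ0)]
      refine ⟨?_, this.symm⟩
      exact Nat.div_pos (Nat.le_of_dvd hn h) (Nat.pos_of_ne_zero hQ0)
  · rw [Finset.card_eq_zero, Finset.filter_eq_empty_iff]
    intro I hI hd
    rw [mem_ID] at hI
    apply h
    rw [← hI.2]
    exact Ideal.absNorm_dvd_absNorm_of_le (Ideal.dvd_iff_le.1 hd)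

lemma dlog_rE : dlog (rE K) = rE K * LE K := by
  ext n
  rcases Nat.eq_zero_or_pos n with rfl | hn
  · simp
  have hl : dlog (rE K) n = rE K n * Real.log n := rfl
  rw [hl, ArithmeticFunction.mul_apply]
  have h1 : rE K n * Real.log n = ∑ I ∈ ID K n, Real.log n := by
    rw [Finset.sum_const, nsmul_eq_mul]; rfl
  rw [h1, Finset.sum_congr rfl (fun I hI => log_norm_eq hI)]
  simp only [Finset.sum_filter]
  have h2 : ∑ x ∈ n.divisorsAntidiagonal, rE K x.1 * LE K x.2 =
      ∑ x ∈ n.divisorsAntidiagonal, ∑ q ∈ SP K n,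
        if Ideal.absNorm q.1 ^ q.2 = x.2 then rE K x.1 * Real.log (Ideal.absNorm q.1) else 0 := by
    apply Finset.sum_congr rfl
    intro x hx
    rw [LE_eq (Nat.divisor_le (Nat.snd_mem_divisors_of_mem_antidiagonal hx)), Finset.mul_sum, Finset.sum_filter]
  rw [h2, Finset.sum_comm, Finset.sum_comm (s := n.divisorsAntidiagonal)]
  apply Finset.sum_congr rfl
  intro q hq
  rw [← Finset.sum_filter, Finset.sum_const, nsmul_eq_mul]
  have hq' := mem_SP.1 hq
  rw [card_dvd n hn (q.1 ^ q.2) (pow_ne_zero _ hq'.1.1.ne_zero), map_pow]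
  have hb0 : 0 < Ideal.absNorm q.1 ^ q.2 := pow_pos (by have := two_le_norm hq'.1.1; omega) _
  split_ifs with h
  · rw [Finset.sum_eq_single (n / (Ideal.absNorm q.1 ^ q.2), Ideal.absNorm q.1 ^ q.2)]
    · simp; left; rfl
    · rintro ⟨a, b⟩ hx hne
      rw [if_neg]
      intro hb
      apply hne
      simp only at hb
      subst hb
      rw [Nat.mem_divisorsAntidiagonal] at hx
      simp only at hx
      rw [← hx.1, Nat.mul_div_cancel _ hb0]
    · intro hx
      exfalso
      apply hx
      rw [Nat.mem_divisorsAntidiagonal]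
      exact ⟨Nat.div_mul_cancel h, hn.ne'⟩
  · rw [Nat.cast_zero, zero_mul]
    symm
    apply Finset.sum_eq_zero
    rintro ⟨a, b⟩ hx
    rw [if_neg]
    intro hb
    apply h
    rw [hb]
    rw [Nat.mem_divisorsAntidiagonal] at hx
    exact Dvd.intro_left _ hx.1

lemma rE_one : rE K 1 = 1 := by
  have : ID K 1 = {⊤} := by
    ext I; simp [mem_ID, Ideal.absNorm_eq_one_iff]
  change ((ID K 1).card : ℝ) = 1
  rw [this]; simp

lemma psum_rE (y : ℝ) (hy : 0 ≤ y) : psum (rE K) y =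
    (Nat.card {I : (Ideal (𝓞 K))⁰ // Ideal.absNorm (I : Ideal (𝓞 K)) ≤ y} : ℝ) := by
  have h1 : psum (rE K) y = (((Finset.Icc 0 ⌊y⌋₊).biUnion (ID K)).card : ℝ) := by
    rw [Finset.card_biUnion]
    · push_cast; rfl
    · intro a _ b _ hab
      rw [Function.onFun, Finset.disjoint_left]
      intro I h1 h2
      rw [mem_ID] at h1 h2
      exact hab (h1.2.symm.trans h2.2)
  rw [h1]
  congr 1
  rw [← Fintype.card_coe, ← Nat.card_eq_fintype_card]
  have hmem : ∀ I : Ideal (𝓞 K), I ∈ (Finset.Icc 0 ⌊y⌋₊).biUnion (ID K) ↔ I ∈ (Ideal (𝓞 K))⁰ ∧ (Ideal.absNorm I : ℝ) ≤ y := by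
    intro I
    simp only [mem_biUnion, mem_Icc, mem_ID, mem_nonZeroDivisors_iff_ne_zero, ← Nat.le_floor_iff hy]
    constructor
    · rintro ⟨a, ⟨_, h1⟩, h2, h3⟩
      refine ⟨?_, by omega⟩
      rintro rfl
      simp at h3
      omega
    · rintro ⟨h1, h2⟩
      have : Ideal.absNorm I ≠ 0 := by rwa [Ne, Ideal.absNorm_eq_zero_iff]
      exact ⟨_, ⟨Nat.zero_le _, h2⟩, Nat.pos_of_ne_zero this, rfl⟩
  exact Nat.card_congr ⟨fun I => ⟨⟨I.1, ((hmem _).1 I.2).1⟩, ((hmem _).1 I.2).2⟩,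
    fun I => ⟨I.1.1, (hmem _).2 ⟨I.1.2, I.2⟩⟩, fun _ => rfl, fun _ => rfl⟩

variable (K) in
lemma psi_bound : ∃ D, ∀ N : ℕ, 1 ≤ N → Real.log N * ∑ n ∈ Finset.Ioc 0 N, LE K n ≤ 2 * N * Real.log N + D * N := by
  obtain ⟨ρ, δ, B, h1, h2, h3, h4⟩ := IdealCount.ideal_count K
  exact selberg_bound (rE K) (LE K) (fun n => Nat.cast_nonneg _) rE_one LE_nonneg dlog_rE ρ B δ h1 h2 h3
    (fun y hy => by rw [psum_rE y (by linarith)]; exact h4 y hy)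

variable (K) in
lemma R_bound : ∃ D, 0 ≤ D ∧ ∀ y : ℝ, 1 ≤ y → psum (rE K) y ≤ D * y := by
  obtain ⟨ρ, δ, B, h1, h2, h3, h4⟩ := IdealCount.ideal_count K
  have hB : 0 ≤ B := by have := (abs_nonneg _).trans (h4 1 le_rfl); simpa using this
  refine ⟨ρ + B, by positivity, fun y hy => ?_⟩
  have h5 := (abs_le.1 (h4 y hy)).2
  rw [← psum_rE y (by linarith)] at h5
  have h6 : y ^ (1 - δ) ≤ y := by
    calc y ^ (1 - δ) ≤ y ^ (1:ℝ) := Real.rpow_le_rpow_of_exponent_le hy (by linarith)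
      _ = y := Real.rpow_one y
  nlinarith

lemma LE_prime {p : ℕ} (hp : p.Prime) : LE K p = rE K p * Real.log p := by
  have h1 : dlog (rE K) 1 = (rE K * LE K) 1 := by rw [dlog_rE]
  have h2 : dlog (rE K) p = (rE K * LE K) p := by rw [dlog_rE]
  rw [dlog_apply, ArithmeticFunction.mul_apply] at h1 h2
  rw [Nat.sum_divisorsAntidiagonal (f := fun i j => rE K i * LE K j), hp.sum_divisors] at h2
  simp [rE_one] at h1 h2
  rw [Nat.div_self hp.pos, ← h1] at h2
  linarith

variable (K) in
theorem prime_sum_bound : ∀ᶠ N : ℕ in Filter.atTop,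
    ∑ p ∈ (Finset.range (N + 1)).filter Nat.Prime, ((ID K p).card : ℝ) ≤ 8 * ((Finset.range (N + 1)).filter Nat.Prime).card := by
  obtain ⟨D, hD⟩ := psi_bound K
  obtain ⟨E, hE0, hE⟩ := R_bound K
  have hpi : ∀ N : ℕ, (((Finset.range (N + 1)).filter Nat.Prime).card : ℝ) = (Nat.primeCounting N : ℝ) := by
    intro N
    rw [Nat.primeCounting, Nat.primeCounting', Nat.count_eq_card_filter_range]
  have hmain : ∀ N : ℕ, 4 ≤ N → Real.log N * ∑ p ∈ (Finset.range (N + 1)).filter Nat.Prime, ((ID K p).card : ℝ) ≤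
      4 * N + 2 * |D| * N / Real.log N + E * (Real.log N * Real.sqrt N) := by
    intro N hN
    have hN0 : (0:ℝ) < N := by positivity
    have hlog : 0 < Real.log N := Real.log_pos (by exact_mod_cast (by omega : 1 < N))
    rw [← Finset.sum_filter_add_sum_filter_not _ (fun p : ℕ => (p:ℝ) ≤ Real.sqrt N), mul_add]
    have h1 : ∑ p ∈ ((Finset.range (N + 1)).filter Nat.Prime).filter (fun p : ℕ => (p:ℝ) ≤ Real.sqrt N), ((ID K p).card : ℝ) ≤ E * Real.sqrt N := by
      refine le_trans ?_ (hE (Real.sqrt N) (Real.one_le_sqrt.2 (by exact_mod_cast (by omega : 1 ≤ N))))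
      apply Finset.sum_le_sum_of_subset_of_nonneg
      · intro p hp
        simp only [mem_filter] at hp
        rw [mem_Icc]
        exact ⟨Nat.zero_le _, Nat.le_floor hp.2⟩
      · intro p _ _; exact Nat.cast_nonneg _
    have h2 : Real.log N * ∑ p ∈ ((Finset.range (N + 1)).filter Nat.Prime).filter (fun p : ℕ => ¬ (p:ℝ) ≤ Real.sqrt N), ((ID K p).card : ℝ)
        ≤ 2 * ∑ n ∈ Finset.Ioc 0 N, LE K n := by
      rw [Finset.mul_sum, Finset.mul_sum]
      refine le_trans (Finset.sum_le_sum (g := fun p => 2 * LE K p) ?_) (Finset.sum_le_sum_of_subset_of_nonneg ?_ ?_)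
      · intro p hp
        simp only [mem_filter, not_le] at hp
        rw [LE_prime hp.1.2]
        have h3 : Real.log N ≤ 2 * Real.log p := by
          have : Real.log (Real.sqrt N) ≤ Real.log p := Real.log_le_log (Real.sqrt_pos.2 hN0) hp.2.le
          rw [Real.log_sqrt hN0.le] at this
          linarith
        change _ ≤ 2 * (((ID K p).card : ℝ) * Real.log p)
        nlinarith [(Nat.cast_nonneg (ID K p).card : (0:ℝ) ≤ _)]
      · intro p hp
        simp only [mem_filter, mem_range] at hp
        rw [mem_Ioc]
        exact ⟨hp.1.2.pos, by omega⟩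
      · intro n _ _
        exact mul_nonneg (by norm_num) (LE_nonneg n)
    have h3 : ∑ n ∈ Finset.Ioc 0 N, LE K n ≤ 2 * N + |D| * N / Real.log N := by
      have h4 := hD N (by omega)
      have h5 : D * N ≤ |D| * N := mul_le_mul_of_nonneg_right (le_abs_self D) hN0.le
      have h6 : ∑ n ∈ Finset.Ioc 0 N, LE K n ≤ (2 * N * Real.log N + |D| * N) / Real.log N := by
        rw [le_div_iff₀ hlog]; linarith
      refine h6.trans (le_of_eq ?_)
      field_simp
    have h7 := mul_le_mul_of_nonneg_left h1 hlog.le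
    have h8 : 2 * (|D| * N / Real.log N) = 2 * |D| * N / Real.log N := by ring
    linarith
  -- error terms are small
  have hcast : Filter.Tendsto (fun N : ℕ => (N : ℝ)) Filter.atTop Filter.atTop := tendsto_natCast_atTop_atTop
  have e1 : ∀ᶠ N : ℕ in Filter.atTop, 20 * |D| ≤ Real.log N :=
    (Real.tendsto_log_atTop.comp hcast).eventually_ge_atTop _
  have e2 : ∀ᶠ N : ℕ in Filter.atTop, Real.log N ≤ (1 / (20 * (E + 1))) * Real.sqrt N := by
    have := (isLittleO_log_rpow_atTop (r := 1/2) (by norm_num)).bound (c := 1 / (20 * (E + 1))) (by positivity)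
    filter_upwards [hcast.eventually this, Filter.eventually_ge_atTop 1] with N h1 h2
    rw [Real.norm_of_nonneg (Real.log_natCast_nonneg N), Real.norm_of_nonneg (by positivity), ← Real.sqrt_eq_rpow] at h1
    exact h1
  have e3 : ∀ᶠ N : ℕ in Filter.atTop, Real.log (N + 1) ≤ (1/100) * N := by
    have := Real.isLittleO_log_id_atTop.bound (c := 1/200) (by norm_num)
    have hc1 : Filter.Tendsto (fun N : ℕ => (N : ℝ) + 1) Filter.atTop Filter.atTop := Filter.tendsto_atTop_add_const_right _ _ hcast
    filter_upwards [hc1.eventually this, Filter.eventually_ge_atTop 1] with N h1 h2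
    have h2' : (1:ℝ) ≤ N := by exact_mod_cast h2
    simp only [id] at h1
    rw [Real.norm_of_nonneg (Real.log_nonneg (by linarith)), Real.norm_of_nonneg (by positivity)] at h1
    linarith
  filter_upwards [e1, e2, e3, Filter.eventually_ge_atTop 4] with N h1 h2 h3 h4
  have hN0 : (0:ℝ) < N := by positivity
  have hlog : 0 < Real.log N := Real.log_pos (by exact_mod_cast (by omega : 1 < N))
  have hm := hmain N h4
  rw [hpi]
  have hpg := Chebyshev.pi_ge N
  rw [div_le_iff₀ hlog] at hpg
  have hl2 := Real.log_two_gt_d9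
  have a1 : 2 * |D| * N / Real.log N ≤ N / 10 := by
    rw [div_le_iff₀ hlog]; nlinarith
  have a2 : E * (Real.log N * Real.sqrt N) ≤ N / 20 := by
    have hs := Real.mul_self_sqrt hN0.le
    have hs0 := Real.sqrt_nonneg (N:ℝ)
    have b1 : Real.log N * Real.sqrt N ≤ (1 / (20 * (E + 1))) * N := by
      calc Real.log N * Real.sqrt N ≤ (1 / (20 * (E + 1))) * Real.sqrt N * Real.sqrt N := mul_le_mul_of_nonneg_right h2 hs0
        _ = (1 / (20 * (E + 1))) * N := by rw [mul_assoc, hs]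
    have b2 : E * ((1 / (20 * (E + 1))) * N) ≤ N / 20 := by
      have : E * (1 / (20 * (E + 1))) ≤ 1 / 20 := by
        rw [mul_one_div, div_le_div_iff₀ (by positivity) (by norm_num)]; linarith
      nlinarith
    exact (mul_le_mul_of_nonneg_left b1 hE0).trans b2
  have a3 : Real.log N * ∑ p ∈ (Finset.range (N + 1)).filter Nat.Prime, ((ID K p).card : ℝ) ≤ Real.log N * (8 * (Nat.primeCounting N : ℝ)) := by
    nlinarith
  exact le_of_mul_le_mul_left a3 hlog

end PrimeIdealBound


namespace TreeGroup

open Finset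

variable {G X : Type*} [Group G] [Fintype G] [DecidableEq X] [MulAction G X]

/-- fixed points of `σ` in `S` -/
def fixIn (S : Finset X) (σ : G) : Finset X := S.filter (fun x => σ • x = x)

/-- elements having a fixed point in `S` -/
def hasFix (G : Type*) {X : Type*} [Group G] [Fintype G] [DecidableEq X] [MulAction G X]
    (S : Finset X) : Finset G := univ.filter (fun σ => ∃ x ∈ S, σ • x = x)

lemma burnside (S : Finset X) (hS : ∀ σ : G, ∀ x ∈ S, σ • x ∈ S)
    (htr : ∀ x ∈ S, ∀ y ∈ S, ∃ σ : G, σ • x = y) :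
    ∑ σ : G, (fixIn S σ).card ≤ Fintype.card G := by
  classical
  have h1 : ∑ σ : G, (fixIn S σ).card = ∑ x ∈ S, (univ.filter (fun σ : G => σ • x = x)).card := by
    simp only [fixIn, card_filter]
    rw [sum_comm]
  have h2 : ∀ x ∈ S, S.card * (univ.filter (fun σ : G => σ • x = x)).card = Fintype.card G := by
    intro x hx
    haveI : Fintype (MulAction.orbit G x) := (Set.finite_range _).fintype
    have h3 := MulAction.card_orbit_mul_card_stabilizer_eq_card_group G x
    have h4 : Fintype.card (MulAction.orbit G x) = S.card := by
      rw [← Fintype.card_coe]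
      apply Fintype.card_congr
      refine Equiv.subtypeEquivRight (fun y => ?_)
      constructor
      · rintro ⟨σ, rfl⟩; exact hS σ x hx
      · intro hy; obtain ⟨σ, h⟩ := htr x hx y hy; exact ⟨σ, h⟩
    have h5 : Fintype.card (MulAction.stabilizer G x) = (univ.filter (fun σ : G => σ • x = x)).card := by
      rw [Fintype.card_subtype]; rfl
    rw [← h3, h4, h5]
  rw [h1]
  rcases S.eq_empty_or_nonempty with rfl | hne
  · simp
  · have h6 : S.card * ∑ x ∈ S, (univ.filter (fun σ : G => σ • x = x)).card = S.card * Fintype.card G := by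
      rw [mul_sum, sum_congr rfl h2]; simp
    exact (Nat.eq_of_mul_eq_mul_left hne.card_pos h6).le

lemma markov (S : Finset X) (hS : ∀ σ : G, ∀ x ∈ S, σ • x ∈ S)
    (htr : ∀ x ∈ S, ∀ y ∈ S, ∃ σ : G, σ • x = y) (M : ℕ) :
    M * (univ.filter (fun σ : G => M < (fixIn S σ).card)).card ≤ Fintype.card G := by
  refine le_trans ?_ (burnside S hS htr)
  calc M * (univ.filter (fun σ : G => M < (fixIn S σ).card)).card
      = ∑ σ ∈ (univ.filter (fun σ : G => M < (fixIn S σ).card)), M := by simp [mul_comm]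
    _ ≤ ∑ σ ∈ (univ.filter (fun σ : G => M < (fixIn S σ).card)), (fixIn S σ).card :=
        sum_le_sum (fun σ hσ => (mem_filter.1 hσ).2.le)
    _ ≤ _ := sum_le_sum_of_subset (subset_univ _)

lemma exists_eU (S T : Finset X) (π : X → X)
    (htwo : ∀ x ∈ T, ∀ y ∈ T, ∀ z ∈ T, π x = π y → π x = π z → x ≠ y → x ≠ z → y = z)
    (heq : ∀ σ : G, ∀ x, π (σ • x) = σ • π x)
    (hT : ∀ σ : G, ∀ x ∈ T, σ • x ∈ T)
    (hmap : ∀ x ∈ T, π x ∈ S)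
    (he : ∀ β ∈ S, ∃ e : G, (∀ x ∈ S, e • x = x) ∧ ∀ x ∈ T, (e • x = x ↔ π x ≠ β))
    (U : Finset X) (hU : U ⊆ S) :
    ∃ e : G, (∀ x ∈ S, e • x = x) ∧ ∀ x ∈ T, (e • x = x ↔ π x ∉ U) := by
  induction U using Finset.induction_on with
  | empty => exact ⟨1, by simp, by simp⟩
  | insert β U hβ ih =>
    obtain ⟨e, h1, h2⟩ := ih (fun x hx => hU (mem_insert_of_mem hx))
    obtain ⟨e', h1', h2'⟩ := he β (hU (mem_insert_self _ _))
    refine ⟨e * e', fun x hx => by rw [mul_smul, h1' x hx, h1 x hx], fun x hx => ?_⟩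
    have hpe : π (e' • x) = π x := by rw [heq, h1' _ (hmap x hx)]
    rw [mul_smul, mem_insert, not_or]
    by_cases hb : π x = β
    · have h3 : e • (e' • x) = e' • x := (h2 _ (hT _ x hx)).2 (by rw [hpe, hb]; exact hβ)
      rw [h3, h2' x hx]
      constructor
      · intro h; exact absurd hb h
      · intro h; exact h.1
    · have h3 : e' • x = x := (h2' x hx).2 hb
      rw [h3, h2 x hx]
      tauto

/-- The main step. -/
lemma step (S T : Finset X) (π : X → X)
    (hS : ∀ σ : G, ∀ x ∈ S, σ • x ∈ S) (hT : ∀ σ : G, ∀ x ∈ T, σ • x ∈ T)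
    (htr : ∀ x ∈ S, ∀ y ∈ S, ∃ σ : G, σ • x = y)
    (htwo : ∀ x ∈ T, ∀ y ∈ T, ∀ z ∈ T, π x = π y → π x = π z → x ≠ y → x ≠ z → y = z)
    (heq : ∀ σ : G, ∀ x, π (σ • x) = σ • π x)
    (hmap : ∀ x ∈ T, π x ∈ S)
    (he : ∀ β ∈ S, ∃ e : G, (∀ x ∈ S, e • x = x) ∧ ∀ x ∈ T, (e • x = x ↔ π x ≠ β)) (M : ℕ) :
    (hasFix G S).card ≤ (univ.filter (fun σ : G => M < (fixIn S σ).card)).card +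
      2 ^ M * ((hasFix G S).card - (hasFix G T).card) := by
  classical
  have hex := exists_eU S T π htwo heq hT hmap he
  choose! e he1 he2 using hex
  set B : Finset G := (hasFix G S).filter (fun σ => (fixIn S σ).card ≤ M) with hB
  let U : G → Finset X := fun σ => (fixIn S σ).filter (fun β => ∃ x ∈ T, π x = β ∧ σ • x = x)
  have hUS : ∀ σ, U σ ⊆ S := fun σ x hx => (mem_filter.1 (mem_filter.1 hx).1).1
  let φ : G → G := fun σ => σ * e (U σ)
  have hfix : ∀ σ, fixIn S (φ σ) = fixIn S σ := by
    intro σ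
    apply filter_congr
    intro x hx
    simp only [φ, mul_smul, he1 _ (hUS σ) x hx]
  have hsub : hasFix G T ⊆ hasFix G S := by
    intro σ hσ
    simp only [hasFix, mem_filter, mem_univ, true_and] at hσ ⊢
    obtain ⟨x, hx, h⟩ := hσ
    exact ⟨π x, hmap x hx, by rw [← heq, h]⟩
  have hnofix : ∀ σ, φ σ ∉ hasFix G T := by
    intro σ hσ
    simp only [hasFix, mem_filter, mem_univ, true_and] at hσ
    obtain ⟨x, hx, h⟩ := hσ
    simp only [φ, mul_smul] at h
    have hpx : π (e (U σ) • x) = π x := by rw [heq, he1 _ (hUS σ) _ (hmap x hx)]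
    have hσβ : σ • π x = π x := by
      rw [← hpx, ← heq, h, hpx]
    by_cases hb : π x ∈ U σ
    · have h1 : e (U σ) • x ≠ x := fun h' => ((he2 _ (hUS σ) x hx).1 h') hb
      obtain ⟨y, hy, hyx, hyf⟩ := (mem_filter.1 hb).2
      -- sigma fixes x and e x
      have hyy : e (U σ) • x ∈ T := hT _ x hx
      have key : ∀ z ∈ T, π z = π x → σ • z = z := by
        intro z hz hzx
        by_cases hyz : y = z
        · rw [← hyz, hyf]
        · refine (htwo y hy z hz (σ • z) (hT _ _ hz) (by rw [hyx, hzx]) (by rw [hyx, heq, hzx, hσβ]) hyz ?_).symm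
          intro h'
          apply hyz
          have : σ • y = σ • z := by rw [hyf, ← h']
          exact (MulAction.injective σ) this
      rw [key _ hyy hpx] at h
      exact h1 h
    · have h1 : e (U σ) • x = x := (he2 _ (hUS σ) x hx).2 hb
      rw [h1] at h
      exact hb (mem_filter.2 ⟨mem_filter.2 ⟨hmap x hx, hσβ⟩, x, hx, rfl, h⟩)
  have himg : B.image φ ⊆ hasFix G S \ hasFix G T := by
    intro τ hτ
    obtain ⟨σ, hσ, rfl⟩ := mem_image.1 hτ
    rw [Finset.mem_sdiff]
    refine ⟨?_, hnofix σ⟩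
    have h1 := (mem_filter.1 hσ).1
    simp only [hasFix, mem_filter, mem_univ, true_and] at h1 ⊢
    obtain ⟨x, hx, h⟩ := h1
    have : x ∈ fixIn S (φ σ) := by rw [hfix]; exact mem_filter.2 ⟨hx, h⟩
    exact ⟨x, hx, (mem_filter.1 this).2⟩
  have hcard : B.card ≤ 2 ^ M * (B.image φ).card := by
    apply card_le_mul_card_image
    intro τ hτ
    obtain ⟨σ₀, hσ₀, rfl⟩ := mem_image.1 hτ
    have hM : (fixIn S (φ σ₀)).card ≤ M := by rw [hfix]; exact (mem_filter.1 hσ₀).2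
    calc _ ≤ ((fixIn S (φ σ₀)).powerset).card := by
          apply card_le_card_of_injOn U
          · intro σ hσ
            have hσ' := (mem_filter.1 (mem_coe.1 hσ)).2
            rw [mem_coe, mem_powerset, ← hσ', hfix]
            exact filter_subset _ _
          · intro σ hσ σ' hσ' hUU
            have h1 := (mem_filter.1 (mem_coe.1 hσ)).2
            have h2 := (mem_filter.1 (mem_coe.1 hσ')).2
            have h3 : σ * e (U σ) = σ' * e (U σ') := h1.trans h2.symm
            rw [hUU] at h3
            exact mul_right_cancel h3
      _ = 2 ^ (fixIn S (φ σ₀)).card := card_powerset _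
      _ ≤ 2 ^ M := Nat.pow_le_pow_right (by norm_num) hM
  have h1 : (hasFix G S).card ≤ B.card + (univ.filter (fun σ : G => M < (fixIn S σ).card)).card := by
    rw [← card_filter_add_card_filter_not (s := hasFix G S) (fun σ => (fixIn S σ).card ≤ M)]
    gcongr
    · intro x; simp
  have h2 : (B.image φ).card ≤ (hasFix G S).card - (hasFix G T).card := by
    rw [← card_sdiff_of_subset hsub]
    exact card_le_card himg
  calc (hasFix G S).card ≤ B.card + (univ.filter (fun σ : G => M < (fixIn S σ).card)).card := h1
    _ ≤ 2 ^ M * (B.image φ).card + (univ.filter (fun σ : G => M < (fixIn S σ).card)).card := by gcongr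
    _ ≤ 2 ^ M * ((hasFix G S).card - (hasFix G T).card) + (univ.filter (fun σ : G => M < (fixIn S σ).card)).card := by gcongr
    _ = _ := add_comm _ _

lemma hasFix_mono (S T : Finset X) (π : X → X)
    (heq : ∀ σ : G, ∀ x, π (σ • x) = σ • π x)
    (hmap : ∀ x ∈ T, π x ∈ S) : (hasFix G T).card ≤ (hasFix G S).card := by
  apply card_le_card
  intro σ hσ
  simp only [hasFix, mem_filter, mem_univ, true_and] at hσ ⊢
  obtain ⟨x, hx, h⟩ := hσ
  exact ⟨π x, hmap x hx, by rw [← heq, h]⟩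

/-- If there are enough good levels, the proportion of elements with a fixed point is small. -/
theorem small_fix (S : ℕ → Finset X) (π : X → X) (N : ℕ)
    (hS : ∀ k, k ≤ N → ∀ σ : G, ∀ x ∈ S k, σ • x ∈ S k)
    (htr : ∀ k, k ≤ N → ∀ x ∈ S k, ∀ y ∈ S k, ∃ σ : G, σ • x = y)
    (htwo : ∀ x y z : X, π x = π y → π x = π z → x ≠ y → x ≠ z → y = z)
    (heq : ∀ σ : G, ∀ x, π (σ • x) = σ • π x)
    (hmap : ∀ k, k < N → ∀ x ∈ S (k + 1), π x ∈ S k)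
    (A : Finset ℕ) (hA : ∀ k ∈ A, k < N)
    (he : ∀ k ∈ A, ∀ β ∈ S k, ∃ e : G, (∀ x ∈ S k, e • x = x) ∧ ∀ x ∈ S (k + 1), (e • x = x ↔ π x ≠ β))
    (M : ℕ) (hM : 0 < M) (hcard : 2 ^ M * M ≤ A.card) :
    M * (hasFix G (S N)).card ≤ 2 * Fintype.card G := by
  classical
  by_contra hcon
  push Not at hcon
  set F : ℕ → ℕ := fun k => (hasFix G (S k)).card with hF
  have hanti : ∀ k, k < N → F (k + 1) ≤ F k := fun k hk => hasFix_mono _ _ π heq (hmap k hk)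
  have hle : ∀ j, j ≤ N → F N ≤ F (N - j) := by
    intro j
    induction j with
    | zero => simp
    | succ j ih =>
      intro hj
      have h1 := hanti (N - (j + 1)) (by omega)
      rw [show N - (j + 1) + 1 = N - j by omega] at h1
      exact (ih (by omega)).trans h1
  have hle' : ∀ k, k ≤ N → F N ≤ F k := by
    intro k hk
    have := hle (N - k) (by omega)
    rwa [show N - (N - k) = k by omega] at this
  have hstep : ∀ k ∈ A, Fintype.card G < 2 ^ M * M * (F k - F (k + 1)) := by
    intro k hk
    have hkN := hA k hk
    have h1 := step (S k) (S (k + 1)) π (hS k hkN.le) (hS (k + 1) hkN) (htr k hkN.le)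
      (fun x _ y _ z _ => htwo x y z) heq (hmap k hkN) (he k hk) M
    have h2 := markov (S k) (hS k hkN.le) (htr k hkN.le) M
    have h3 := hle' k hkN.le
    have h4 : M * F k ≤ Fintype.card G + 2 ^ M * M * (F k - F (k + 1)) := by
      calc M * F k ≤ M * ((univ.filter (fun σ : G => M < (fixIn (S k) σ).card)).card + 2 ^ M * (F k - F (k + 1))) :=
            Nat.mul_le_mul_left _ h1
        _ = M * (univ.filter (fun σ : G => M < (fixIn (S k) σ).card)).card + 2 ^ M * M * (F k - F (k + 1)) := by ring
        _ ≤ _ := by gcongr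
    have h5 : M * F N ≤ M * F k := Nat.mul_le_mul_left _ h3
    have h6 : 2 * Fintype.card G < M * F N := hcon
    omega
  have hsum : ∀ n, n ≤ N → ∑ k ∈ A.filter (· < n), (F k - F (k + 1)) + F n ≤ F 0 := by
    intro n
    induction n with
    | zero => intro _; simp
    | succ n ih =>
      intro hn
      have h1 := ih (by omega)
      have h2 := hanti n (by omega)
      by_cases hmem : n ∈ A
      · have : A.filter (· < n + 1) = insert n (A.filter (· < n)) := by
          ext x; simp only [mem_filter, mem_insert]
          constructor
          · rintro ⟨h, h'⟩
            rcases Nat.lt_succ_iff_lt_or_eq.1 h' with h'' | h''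
            · exact Or.inr ⟨h, h''⟩
            · exact Or.inl h''
          · rintro (rfl | ⟨h, h'⟩)
            · exact ⟨hmem, by omega⟩
            · exact ⟨h, by omega⟩
        rw [this, sum_insert (by simp)]
        omega
      · have : A.filter (· < n + 1) = A.filter (· < n) := by
          apply filter_congr
          intro x hx
          have : x ≠ n := fun h => hmem (h ▸ hx)
          omega
        rw [this]
        omega
  have h7 := hsum N le_rfl
  rw [filter_true_of_mem hA] at h7
  have h8 : F 0 ≤ Fintype.card G := card_le_univ _
  have h9 : A.card * Fintype.card G ≤ 2 ^ M * M * ∑ k ∈ A, (F k - F (k + 1)) := by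
    rw [mul_sum, ← smul_eq_mul, ← sum_const]
    exact sum_le_sum (fun k hk => (hstep k hk).le)
  have hG : 0 < Fintype.card G := Fintype.card_pos
  have hFN : 0 < F N := by
    rcases Nat.eq_zero_or_pos (F N) with h | h
    · have : M * F N = 0 := by rw [h]; simp
      have h6 : 2 * Fintype.card G < M * F N := hcon
      omega
    · exact h
  have h10 : 2 ^ M * M * Fintype.card G ≤ 2 ^ M * M * ∑ k ∈ A, (F k - F (k + 1)) :=
    (Nat.mul_le_mul_right _ hcard).trans h9
  have h11 := Nat.le_of_mul_le_mul_left h10 (by positivity)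
  omega

end TreeGroup


namespace Runge

open Polynomial

/-- Approximate square root of a monic even degree polynomial. -/
lemma exists_sqrt (P : ℤ[X]) (m : ℕ) (hP : P.Monic) (hdeg : P.natDegree = 2 * m) :
    ∃ (A : ℕ) (S R : ℤ[X]), S.natDegree ≤ m ∧ S.coeff m = 2 ^ A ∧
      C (4 ^ A) * P = S ^ 2 + R ∧ ∀ i, m ≤ i → R.coeff i = 0 := by
  have key : ∀ j, j ≤ m → ∃ (A : ℕ) (S : ℤ[X]), S.natDegree ≤ m ∧ S.coeff m = 2 ^ A ∧
      ∀ i, 2 * m - j ≤ i → (C (4 ^ A) * P - S ^ 2).coeff i = 0 := by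
    intro j
    induction j with
    | zero =>
      intro _
      refine ⟨0, X ^ m, natDegree_X_pow_le m, by simp, ?_⟩
      intro i hi
      simp only [pow_zero, map_one, one_mul, coeff_sub, ← pow_mul, coeff_X_pow]
      rcases Nat.eq_or_lt_of_le hi with h | h
      · have h1 : P.coeff (2 * m) = 1 := by rw [← hdeg]; exact hP
        have : i = 2 * m := by omega
        rw [this, h1, if_pos (by ring), sub_self]
      · rw [coeff_eq_zero_of_natDegree_lt (by omega), if_neg (by rw [mul_comm]; omega), sub_zero]
    | succ j ih =>
      intro hj
      obtain ⟨A, S, h1, h2, h3⟩ := ih (by omega)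
      set e := (C (4 ^ A) * P - S ^ 2).coeff (2 * m - (j + 1)) with he
      set r := m - (j + 1) with hr
      refine ⟨2 * A + 1, C (2 ^ (A + 1)) * S + C e * X ^ r, ?_, ?_, ?_⟩
      · refine (natDegree_add_le _ _).trans (max_le ((natDegree_C_mul_le _ _).trans h1) ?_)
        refine (natDegree_C_mul_X_pow_le _ _).trans (by omega)
      · rw [coeff_add, coeff_C_mul, h2, coeff_C_mul, coeff_X_pow, if_neg (by omega)]
        ring
      · intro i hi
        have hexp : C (4 ^ (2 * A + 1)) * P - (C (2 ^ (A + 1)) * S + C e * X ^ r) ^ 2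
            = C (4 ^ (A + 1)) * (C (4 ^ A) * P - S ^ 2) - C (2 ^ (A + 2) * e) * (S * X ^ r)
              - C (e ^ 2) * X ^ (2 * r) := by
          have h4 : (4 : ℤ) ^ (2 * A + 1) = 4 ^ (A + 1) * 4 ^ A := by rw [← pow_add]; congr 1; ring
          have h5 : (4 : ℤ) ^ (A + 1) = (2 ^ (A + 1)) ^ 2 := by
            rw [← pow_mul, mul_comm, pow_mul]; norm_num
          have h6 : (2 : ℤ) ^ (A + 2) = 2 * 2 ^ (A + 1) := by ring
          rw [h4, h5, h6]
          simp only [map_mul, map_pow]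
          have : (C (2:ℤ) : ℤ[X]) = 2 := rfl
          rw [this]
          ring
        rw [hexp, coeff_sub, coeff_sub, coeff_C_mul, coeff_C_mul, coeff_C_mul, coeff_X_pow,
          if_neg (by omega), mul_zero, sub_zero]
        rcases Nat.eq_or_lt_of_le hi with h | h
        · rw [← h, ← he]
          have : (S * X ^ r).coeff (2 * m - (j + 1)) = 2 ^ A := by
            rw [show 2 * m - (j + 1) = m + r by omega, coeff_mul_X_pow, h2]
          rw [this]
          have h5 : (4 : ℤ) ^ (A + 1) = (2 ^ (A + 1)) ^ 2 := by
            rw [← pow_mul, mul_comm, pow_mul]; norm_num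
          rw [h5]; ring
        · rw [h3 i (by omega)]
          have : (S * X ^ r).coeff i = 0 := by
            rw [show i = (i - r) + r by omega, coeff_mul_X_pow]
            exact coeff_eq_zero_of_natDegree_lt (by omega)
          rw [this]; ring
  obtain ⟨A, S, h1, h2, h3⟩ := key m le_rfl
  exact ⟨A, S, C (4 ^ A) * P - S ^ 2, h1, h2, by ring, fun i hi => h3 i (by omega)⟩

/-- Homogenised evaluation is an integer congruent to the leading term. -/
lemma homog (p : ℤ[X]) (m : ℕ) (hp : p.natDegree ≤ m) (u w : ℤ) (hw : w ≠ 0) :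
    ∃ t : ℤ, (w : ℚ) ^ m * aeval ((u : ℚ) / w) p = ((p.coeff m * u ^ m + w * t : ℤ) : ℚ) := by
  have hw' : (w : ℚ) ≠ 0 := by exact_mod_cast hw
  refine ⟨∑ i ∈ Finset.range m, p.coeff i * u ^ i * w ^ (m - 1 - i), ?_⟩
  rw [aeval_eq_sum_range' (Nat.lt_succ_of_le hp), Finset.sum_range_succ, mul_add, Finset.mul_sum]
  push_cast
  rw [add_comm, Finset.mul_sum]
  congr 1
  · rw [zsmul_eq_mul, div_pow]; field_simp
  · apply Finset.sum_congr rfl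
    intro i hi
    have hi' := Finset.mem_range.1 hi
    rw [zsmul_eq_mul, div_pow]
    have : (w : ℚ) ^ m = w * w ^ (m - 1 - i) * w ^ i := by
      rw [← pow_succ', ← pow_add]; congr 1; omega
    rw [this]; field_simp

lemma bounded (p : ℤ[X]) (B : ℚ) : ∃ C : ℚ, ∀ z : ℚ, |z| ≤ B → |aeval z p| ≤ C := by
  refine ⟨∑ i ∈ Finset.range (p.natDegree + 1), |(p.coeff i : ℚ)| * B ^ i, fun z hz => ?_⟩
  rw [aeval_eq_sum_range]
  refine (Finset.abs_sum_le_sum_abs _ _).trans (Finset.sum_le_sum fun i _ => ?_)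
  rw [zsmul_eq_mul, abs_mul, abs_pow]
  gcongr

lemma eventually_pos (p : ℤ[X]) (h0 : 0 < p.leadingCoeff) :
    ∃ B : ℚ, ∀ z : ℚ, B < z → 0 < aeval z p := by
  have key : ∀ᶠ z : ℚ in Filter.atTop, 0 < (p.map (Int.castRingHom ℚ)).eval z := by
    by_cases hd : 0 < p.natDegree
    · have := tendsto_atTop_of_leadingCoeff_nonneg (p.map (Int.castRingHom ℚ)) (by
        rw [degree_map_eq_of_injective Int.cast_injective]; exact natDegree_pos_iff_degree_pos.1 hd) (by
        rw [leadingCoeff_map_of_injective Int.cast_injective]; simpa using h0.le)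
      exact this.eventually_gt_atTop 0
    · have h1 : p = C (p.coeff 0) := eq_C_of_natDegree_eq_zero (by omega)
      have h2 : 0 < p.coeff 0 := by
        have : p.natDegree = 0 := by omega
        rwa [leadingCoeff, this] at h0
      refine Filter.Eventually.of_forall fun z => ?_
      rw [h1]; simpa using h2
  obtain ⟨B, hB⟩ := Filter.eventually_atTop.1 key
  refine ⟨B, fun z hz => ?_⟩
  have := hB z hz.le
  rwa [eval_map, ← algebraMap_int_eq, ← aeval_def] at this

lemma eventually_ne (p : ℤ[X]) (h0 : p ≠ 0) : ∃ B : ℚ, ∀ z : ℚ, B < z → aeval z p ≠ 0 := by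
  rcases lt_or_gt_of_ne (leadingCoeff_ne_zero.2 h0) with h | h
  · obtain ⟨B, hB⟩ := eventually_pos (-p) (by rw [leadingCoeff_neg]; omega)
    refine ⟨B, fun z hz hz0 => ?_⟩
    have := hB z hz
    rw [map_neg, hz0] at this
    simp at this
  · obtain ⟨B, hB⟩ := eventually_pos p h
    exact ⟨B, fun z hz => (hB z hz).ne'⟩

/-- The data needed for Runge's argument. -/
lemma runge_data (h1 h2 : ℤ[X]) (m : ℕ) (hm : 0 < m) (hm1 : h1.Monic) (hm2 : h2.Monic)
    (hdeg : h1.natDegree + h2.natDegree = 2 * m) (hlt : h1.natDegree < h2.natDegree)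
    (hi1 : Irreducible (h1.map (Int.castRingHom ℚ))) (hi2 : Irreducible (h2.map (Int.castRingHom ℚ))) :
    ∃ (A : ℕ) (S R : ℤ[X]) (B : ℚ), S.natDegree ≤ m ∧ S.coeff m = 2 ^ A ∧ R ≠ 0 ∧ R.natDegree ≤ m - 1 ∧
      (C (4 ^ A) * (h1 * h2) = S ^ 2 + R) ∧
      ∀ z : ℚ, B < z → |aeval z R| < aeval z S ∧ aeval z R ≠ 0 ∧ 0 < aeval z h1 := by
  obtain ⟨A, S, R, hS1, hS2, hSR, hR⟩ := exists_sqrt (h1 * h2) m (hm1.mul hm2)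
    (by rw [hm1.natDegree_mul hm2, hdeg])
  have hSd : S.natDegree = m := le_antisymm hS1 (le_natDegree_of_ne_zero (by rw [hS2]; positivity))
  have hRd : R.natDegree ≤ m - 1 := by
    rw [natDegree_le_iff_coeff_eq_zero]
    intro i hi
    exact hR i (by omega)
  have hR0 : R ≠ 0 := by
    intro h0
    rw [h0, add_zero] at hSR
    have hQ := congrArg (Polynomial.map (Int.castRingHom ℚ)) hSR
    rw [Polynomial.map_mul, Polynomial.map_mul, Polynomial.map_pow, map_C] at hQ
    set q1 := h1.map (Int.castRingHom ℚ)
    set q2 := h2.map (Int.castRingHom ℚ)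
    set s := S.map (Int.castRingHom ℚ)
    have hd : q1 ∣ s := by
      apply hi1.prime.dvd_of_dvd_pow (n := 2)
      rw [← hQ]
      exact ⟨C ((Int.castRingHom ℚ) (4 ^ A)) * q2, by ring⟩
    obtain ⟨t, ht⟩ := hd
    rw [ht] at hQ
    have h3 : C ((Int.castRingHom ℚ) (4 ^ A)) * q2 = q1 * t ^ 2 := by
      apply mul_left_cancel₀ hi1.ne_zero
      rw [← mul_assoc, mul_comm q1 (C _), mul_assoc, hQ]; ring
    have hu : IsUnit (C ((Int.castRingHom ℚ) (4 ^ A)) : ℚ[X]) := by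
      rw [isUnit_C, isUnit_iff_ne_zero]; simp
    have h4 : q1 ∣ q2 := by
      rw [← hu.dvd_mul_left (b := q2), h3]; exact dvd_mul_right _ _
    have h5 : Associated q1 q2 := (hi1.dvd_irreducible_iff_associated hi2).1 h4
    have h6 := natDegree_eq_of_degree_eq (degree_eq_degree_of_associated h5)
    rw [natDegree_map_eq_of_injective Int.cast_injective, natDegree_map_eq_of_injective Int.cast_injective] at h6
    omega
  have hl : ∀ T : ℤ[X], T.natDegree ≤ m - 1 → 0 < (S + T).leadingCoeff := by
    intro T hT
    have h1 : (S + T).natDegree = m := by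
      rw [natDegree_add_eq_left_of_natDegree_lt (by omega), hSd]
    rw [leadingCoeff, h1, coeff_add, hS2, coeff_eq_zero_of_natDegree_lt (by omega)]
    positivity
  obtain ⟨B1, hB1⟩ := eventually_pos _ (hl R hRd)
  obtain ⟨B2, hB2⟩ := eventually_pos _ (hl (-R) (by rwa [natDegree_neg]))
  obtain ⟨B3, hB3⟩ := eventually_ne R hR0
  obtain ⟨B4, hB4⟩ := eventually_pos h1 (by rw [hm1.leadingCoeff]; norm_num)
  refine ⟨A, S, R, max (max B1 B2) (max B3 B4), hS1, hS2, hR0, hRd, hSR, fun z hz => ?_⟩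
  simp only [max_lt_iff] at hz
  refine ⟨abs_lt.2 ⟨?_, ?_⟩, hB3 z hz.2.1, hB4 z hz.2.2⟩
  · have := hB1 z hz.1.1; rw [map_add] at this; linarith
  · have := hB2 z hz.1.2; rw [map_add, map_neg] at this; linarith

end Runge


namespace Runge

open Polynomial

lemma int_pair (h1 h2 : ℤ[X]) (m : ℕ) (hm : 0 < m) (hm1 : h1.Monic) (hm2 : h2.Monic)
    (hdeg : h1.natDegree + h2.natDegree = 2 * m) (hlt : h1.natDegree < h2.natDegree)
    (hi1 : Irreducible (h1.map (Int.castRingHom ℚ))) (hi2 : Irreducible (h2.map (Int.castRingHom ℚ))) :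
    ∃ B : ℚ, ∀ z : ℤ, B < z → ¬ IsSquare (aeval (z : ℚ) h1 * aeval (z : ℚ) h2) := by
  obtain ⟨A, S, R, B, hS1, hS2, hR0, hRd, hSR, hB⟩ := runge_data h1 h2 m hm hm1 hm2 hdeg hlt hi1 hi2
  refine ⟨B, fun z hz hsq => ?_⟩
  obtain ⟨b1, b2, -⟩ := hB z hz
  have hcast : ∀ p : ℤ[X], aeval (z : ℚ) p = ((p.eval z : ℤ) : ℚ) := fun p => by
    have := aeval_algebraMap_apply ℚ z p
    simpa using this
  rw [hcast, hcast, ← Int.cast_mul, Rat.isSquare_intCast_iff] at hsq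
  obtain ⟨y, hy⟩ := hsq
  rw [hcast, hcast, ← Int.cast_abs, Int.cast_lt] at b1
  rw [hcast, Int.cast_ne_zero] at b2
  have h3 := congrArg (eval z) hSR
  simp only [eval_mul, eval_C, eval_add, eval_pow] at h3
  rw [hy] at h3
  set s := S.eval z
  set r := R.eval z
  have h4 : (4 : ℤ) ^ A = 2 ^ A * 2 ^ A := by rw [← mul_pow]; norm_num
  have h5 : (2 ^ A * |y| - s) * (2 ^ A * |y| + s) = r := by
    have : |y| * |y| = y * y := abs_mul_abs_self y
    rw [h4] at h3
    linear_combination h3 + (2 ^ A * 2 ^ A) * this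
  have hs : 0 < s := lt_of_le_of_lt (abs_nonneg r) b1
  have h6 : 0 ≤ 2 ^ A * |y| := by positivity
  have h7 : 2 ^ A * |y| - s ≠ 0 := by
    intro h; rw [h, zero_mul] at h5; exact b2 h5.symm
  have h8 : 1 ≤ |2 ^ A * |y| - s| := Int.one_le_abs h7
  have h9 : |r| = |2 ^ A * |y| - s| * (2 ^ A * |y| + s) := by
    rw [← h5, abs_mul, abs_of_pos (by linarith : 0 < 2 ^ A * |y| + s)]
  nlinarith

lemma half_pair (h1 h2 : ℤ[X]) (m : ℕ) (hm : 0 < m) (hm1 : h1.Monic) (hm2 : h2.Monic)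
    (hdeg : h1.natDegree + h2.natDegree = 2 * m) (hlt : h1.natDegree < h2.natDegree)
    (hi1 : Irreducible (h1.map (Int.castRingHom ℚ))) (hi2 : Irreducible (h2.map (Int.castRingHom ℚ)))
    (B0 : ℚ) :
    ∃ e0 : ℕ, ∀ e, e0 ≤ e → ∀ u V : ℤ, u % 4 = 1 → V % 4 = 1 → -B0 ≤ (u : ℚ) / ((2 ^ e : ℤ) : ℚ) →
      (V : ℚ) ^ 2 = (((2 ^ e : ℤ) : ℚ) ^ m) ^ 2 *
        (aeval ((u : ℚ) / ((2 ^ e : ℤ) : ℚ)) h1 * aeval ((u : ℚ) / ((2 ^ e : ℤ) : ℚ)) h2) →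
      V < 0 ∧ 0 < aeval ((u : ℚ) / ((2 ^ e : ℤ) : ℚ)) h1 := by
  obtain ⟨A, S, R, B, hS1, hS2, hR0, hRd, hSR, hB⟩ := runge_data h1 h2 m hm hm1 hm2 hdeg hlt hi1 hi2
  obtain ⟨C1, hC1⟩ := bounded (h1 * h2) (max B0 B)
  obtain ⟨C2, hC2⟩ := bounded S (max B0 B)
  obtain ⟨e1, he1⟩ := exists_nat_gt ((2:ℚ) ^ (A + 1) * (2 ^ A * (|C1| + 1) + |C2| + 1))
  refine ⟨max (max (A + 2) e1) R.leadingCoeff.natAbs, fun e he u V hu hV hz hsq => ?_⟩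
  simp only [max_le_iff] at he
  obtain ⟨⟨heA, hee1⟩, heR⟩ := he
  set w : ℤ := 2 ^ e with hw
  have hwpos : 0 < w := by positivity
  have hwe : (e : ℤ) < w := by
    have : e < 2 ^ e := Nat.lt_two_pow_self
    rw [hw]; exact_mod_cast this
  have hwQ : (0:ℚ) < w := by exact_mod_cast hwpos
  set z : ℚ := (u : ℚ) / w with hzdef
  -- u odd, coprime to w
  have huodd : Odd u := by rw [Int.odd_iff]; omega
  have hcop : ∀ v : ℤ, Odd v → ∀ j : ℕ, IsCoprime ((2:ℤ) ^ j) v := by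
    intro v hv j
    apply IsCoprime.pow_left
    exact (Int.isCoprime_two_left.2 hv)
  have hRz : aeval z R ≠ 0 := by
    intro h0
    obtain ⟨t, ht⟩ := homog R R.natDegree le_rfl u w hwpos.ne'
    rw [h0, mul_zero] at ht
    have ht' : R.coeff R.natDegree * u ^ R.natDegree + w * t = 0 := by exact_mod_cast ht.symm
    have h3 : w ∣ u ^ R.natDegree * R.leadingCoeff := ⟨-t, by rw [leadingCoeff]; linear_combination ht'⟩
    have h4 : w ∣ R.leadingCoeff := (hcop _ huodd.pow e).dvd_of_dvd_mul_left h3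
    have h5 := Int.le_of_dvd (abs_pos.2 (leadingCoeff_ne_zero.2 hR0)) ((dvd_abs _ _).2 h4)
    have h6 : |R.leadingCoeff| = (R.leadingCoeff.natAbs : ℤ) := Int.abs_eq_natAbs _
    omega
  obtain ⟨t, ht⟩ := homog S m hS1 u w hwpos.ne'
  rw [hS2, ← hzdef] at ht
  obtain ⟨t', ht'⟩ := homog R (m - 1) hRd u w hwpos.ne'
  rw [← hzdef] at ht'
  set s : ℤ := 2 ^ A * u ^ m + w * t with hs
  set r : ℤ := R.coeff (m - 1) * u ^ (m - 1) + w * t' with hr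
  have hPz : (4:ℚ) ^ A * (aeval z h1 * aeval z h2) = aeval z S ^ 2 + aeval z R := by
    have := congrArg (aeval z) hSR
    rw [map_mul, aeval_C, map_mul, map_add, map_pow] at this
    simpa only [algebraMap_int_eq, eq_intCast, Int.cast_pow, Int.cast_ofNat, map_pow] using this
  have hfac : (2 ^ A * V - s) * (2 ^ A * V + s) = w ^ (m + 1) * r := by
    have h4 : (4 : ℚ) ^ A = 2 ^ A * 2 ^ A := by rw [← mul_pow]; norm_num
    have : (((2 ^ A * V - s) * (2 ^ A * V + s) : ℤ) : ℚ) = ((w ^ (m + 1) * r : ℤ) : ℚ) := by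
      push_cast
      rw [← ht, ← ht']
      have h5 : (w : ℚ) ^ (m + 1) * (w ^ (m - 1) * aeval z R) = (w ^ m) ^ 2 * aeval z R := by
        rw [← mul_assoc, ← pow_add, ← pow_mul]; congr 2; omega
      rw [h5]
      have h6 : (2 ^ A * (V:ℚ)) ^ 2 = (w ^ m) ^ 2 * (aeval z S ^ 2 + aeval z R) := by
        rw [← hPz, h4, mul_pow, hsq]; ring
      linear_combination h6
    exact_mod_cast this
  have hr0 : r ≠ 0 := by
    intro h0
    rw [h0, Int.cast_zero] at ht'
    rcases mul_eq_zero.1 ht' with h | h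
    · exact absurd h (by positivity)
    · exact hRz h
  have hsum : ∃ v : ℤ, Odd v ∧ 2 ^ A * V + s = 2 ^ (A + 1) * v := by
    have h3 : u ^ m % 4 = 1 := by
      have : u ^ m ≡ 1 ^ m [ZMOD 4] := Int.ModEq.pow m hu
      rw [one_pow] at this; exact this
    obtain ⟨q, hq⟩ : ∃ q, V + u ^ m = 4 * q + 2 := ⟨(V + u ^ m) / 4, by omega⟩
    have hw2 : w = 2 ^ (A + 2) * 2 ^ (e - (A + 2)) := by
      rw [hw, ← pow_add]; congr 1; omega
    refine ⟨2 * (q + 2 ^ (e - (A + 2)) * t) + 1, odd_two_mul_add_one _, ?_⟩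
    rw [hs]
    calc 2 ^ A * V + (2 ^ A * u ^ m + w * t) = 2 ^ A * (V + u ^ m) + w * t := by ring
      _ = _ := by rw [hq, hw2]; ring
  obtain ⟨v, hv, hvs⟩ := hsum
  set D : ℤ := 2 ^ A * V - s with hD
  have hDne : D ≠ 0 := by
    intro h0
    rw [h0, zero_mul] at hfac
    have : w ^ (m + 1) * r ≠ 0 := mul_ne_zero (by positivity) hr0
    exact this hfac.symm
  have hdvd : w ^ (m + 1) ∣ D * 2 ^ (A + 1) := by
    have h3 : w ^ (m + 1) ∣ v * (D * 2 ^ (A + 1)) := ⟨r, by rw [← hfac, hvs]; ring⟩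
    refine IsCoprime.dvd_of_dvd_mul_left ?_ h3
    rw [hw, ← pow_mul]; exact hcop v hv _
  have hDge : w ^ (m + 1) ≤ |D| * 2 ^ (A + 1) := by
    have := Int.le_of_dvd (abs_pos.2 (mul_ne_zero hDne (by positivity))) ((dvd_abs _ _).2 hdvd)
    rwa [abs_mul, abs_of_pos (by positivity : (0:ℤ) < 2 ^ (A + 1))] at this
  -- pass to rationals
  set y : ℚ := V / w ^ m with hy
  have hVy : (V : ℚ) = w ^ m * y := by rw [hy]; field_simp
  have hy2 : y ^ 2 = aeval z h1 * aeval z h2 := by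
    rw [hVy, mul_pow] at hsq
    exact mul_left_cancel₀ (by positivity) hsq
  have hDq : (D : ℚ) = w ^ m * (2 ^ A * y - aeval z S) := by
    rw [hD]; push_cast
    rw [hVy, ← ht]; ring
  have hge : (w : ℚ) ≤ |2 ^ A * y - aeval z S| * 2 ^ (A + 1) := by
    have h3 : ((w ^ (m + 1) : ℤ) : ℚ) ≤ ((|D| * 2 ^ (A + 1) : ℤ) : ℚ) := by exact_mod_cast hDge
    push_cast at h3
    rw [hDq, abs_mul, abs_of_pos (by positivity : (0:ℚ) < w ^ m), pow_succ, mul_assoc] at h3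
    exact le_of_mul_le_mul_left h3 (by positivity)
  have hwbig : (2:ℚ) ^ (A + 1) * (2 ^ A * (|C1| + 1) + |C2| + 1) < w := by
    refine he1.trans_le ?_
    have : (e1 : ℤ) ≤ w := by omega
    exact_mod_cast this
  have hpow : (0:ℚ) < 2 ^ (A + 1) := by positivity
  have habs : 2 ^ A * (|C1| + 1) + |C2| + 1 < |2 ^ A * y - aeval z S| := by
    have : (2:ℚ) ^ (A + 1) * (2 ^ A * (|C1| + 1) + |C2| + 1) < 2 ^ (A + 1) * |2 ^ A * y - aeval z S| := by
      rw [mul_comm _ |_|]; exact hwbig.trans_le hge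
    exact lt_of_mul_lt_mul_left this hpow.le
  have hzB : max B0 B < z := by
    by_contra hcon
    push Not at hcon
    have hzabs : |z| ≤ max B0 B := abs_le.2 ⟨by
      have := le_max_left B0 B
      linarith, hcon⟩
    have b1 := hC1 z hzabs
    have b2 := hC2 z hzabs
    rw [map_mul, ← hy2, abs_of_nonneg (sq_nonneg y)] at b1
    have b3 : |y| ≤ |C1| + 1 := by
      have : |y| ^ 2 ≤ |C1| := by rw [sq_abs]; exact b1.trans (le_abs_self _)
      nlinarith [abs_nonneg y, abs_nonneg C1]
    have b4 : |2 ^ A * y - aeval z S| ≤ 2 ^ A * |y| + |aeval z S| := by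
      refine (abs_sub _ _).trans ?_
      rw [abs_mul, abs_of_pos (by positivity : (0:ℚ) < 2 ^ A)]
    have b5 : 2 ^ A * |y| ≤ 2 ^ A * (|C1| + 1) := mul_le_mul_of_nonneg_left b3 (by positivity)
    have b6 := le_abs_self C2
    linarith
  obtain ⟨k1, k2, k3⟩ := hB z (lt_of_le_of_lt (le_max_right _ _) hzB)
  refine ⟨?_, k3⟩
  by_contra hV0
  push Not at hV0
  have hy0 : 0 ≤ y := by
    rw [hy]
    have : (0:ℚ) ≤ V := by exact_mod_cast hV0
    positivity
  have hSpos : 0 < aeval z S := lt_of_le_of_lt (abs_nonneg _) k1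
  have h5 : (2 ^ A * y - aeval z S) * (2 ^ A * y + aeval z S) = aeval z R := by
    have h4 : (4 : ℚ) ^ A = 2 ^ A * 2 ^ A := by rw [← mul_pow]; norm_num
    rw [← hy2, h4] at hPz
    linear_combination hPz
  have h6 : (0:ℚ) ≤ 2 ^ A * y := by positivity
  have h9 : |aeval z R| = |2 ^ A * y - aeval z S| * (2 ^ A * y + aeval z S) := by
    rw [← h5, abs_mul, abs_of_pos (by linarith : 0 < 2 ^ A * y + aeval z S)]
  have h10 : 1 < |2 ^ A * y - aeval z S| := by
    have : 0 ≤ (2:ℚ) ^ A * (|C1| + 1) := by positivity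
    have := abs_nonneg C2
    linarith
  nlinarith

end Runge


namespace CritOrbit

open Polynomial

/-- orbit of a rational -/
noncomputable def cs (f : ℤ[X]) (γ : ℚ) (n : ℕ) : ℚ := (fun x : ℚ => aeval x f)^[n] γ

lemma cs_zero (f : ℤ[X]) (γ : ℚ) : cs f γ 0 = γ := rfl

lemma cs_succ (f : ℤ[X]) (γ : ℚ) (n : ℕ) : cs f γ (n + 1) = aeval (cs f γ n) f :=
  Function.iterate_succ_apply' _ _ _

lemma aeval_polyIter {R : Type*} [CommRing R] (f : ℤ[X]) (k : ℕ) (x : R) :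
    aeval x (polyIter f k) = (fun y : R => aeval y f)^[k] x := by
  induction k with
  | zero => simp [polyIter]
  | succ k ih => rw [polyIter, aeval_comp, ih, Function.iterate_succ_apply']

lemma aeval_h {R : Type*} [CommRing R] (f g : ℤ[X]) (k : ℕ) (x : R) :
    aeval x (g.comp (polyIter f k)) = aeval ((fun y : R => aeval y f)^[k] x) g := by
  rw [aeval_comp, aeval_polyIter]

lemma aeval_h_cs (f g : ℤ[X]) (γ : ℚ) (k n : ℕ) :
    aeval (cs f γ n) (g.comp (polyIter f k)) = aeval (cs f γ (n + k)) g := by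
  rw [aeval_h, cs, cs, ← Function.iterate_add_apply, add_comm]

lemma polyIter_monic (f : ℤ[X]) (hf : f.Monic) (hfd : f.natDegree = 2) (k : ℕ) :
    (polyIter f k).Monic ∧ (polyIter f k).natDegree = 2 ^ k := by
  induction k with
  | zero => exact ⟨monic_X, natDegree_X⟩
  | succ k ih =>
    have h2 : (polyIter f k).natDegree ≠ 0 := by rw [ih.2]; positivity
    refine ⟨hf.comp ih.1 h2, ?_⟩
    rw [polyIter, natDegree_comp, hfd, ih.2, pow_succ, mul_comm]

lemma h_monic (f g : ℤ[X]) (hf : f.Monic) (hfd : f.natDegree = 2) (hg : g.Monic) (k : ℕ) :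
    (g.comp (polyIter f k)).Monic ∧ (g.comp (polyIter f k)).natDegree = g.natDegree * 2 ^ k := by
  obtain ⟨h1, h2⟩ := polyIter_monic f hf hfd k
  refine ⟨hg.comp h1 (by rw [h2]; positivity), ?_⟩
  rw [natDegree_comp, h2]

lemma aeval_f {R : Type*} [CommRing R] (f : ℤ[X]) (hf : f.Monic) (hfd : f.natDegree = 2) (x : R) :
    aeval x f = x ^ 2 + (f.coeff 1 : R) * x + (f.coeff 0 : R) := by
  have h2 : f.coeff 2 = 1 := by rw [← hfd]; exact hf
  rw [aeval_eq_sum_range, hfd]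
  simp only [Finset.sum_range_succ, Finset.sum_range_zero, zsmul_eq_mul, h2]
  push_cast; ring

lemma g_pos (f g : ℤ[X]) (hirr : Irreducible ((g.comp (polyIter f 0)).map (Int.castRingHom ℚ))) (hg : g.Monic) :
    0 < g.natDegree := by
  rw [polyIter, comp_X] at hirr
  have := hirr.natDegree_pos
  rwa [hg.natDegree_map] at this

lemma cs_inj (f g : ℤ[X]) (γ : ℚ)
    (hinf : {q : ℚ | ∃ n : ℕ, 1 ≤ n ∧ aeval (cs f γ n) g = q}.Infinite) : Function.Injective (cs f γ) := by
  have key : ∀ i j, i < j → cs f γ i ≠ cs f γ j := by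
    intro i j hij h
    have h1 : ∀ n, ∃ k < j, cs f γ n = cs f γ k := by
      intro n
      induction n using Nat.strong_induction_on with
      | _ n ih =>
        by_cases hn : n < j
        · exact ⟨n, hn, rfl⟩
        · obtain ⟨k, hk, hk'⟩ := ih (n - j + i) (by omega)
          refine ⟨k, hk, ?_⟩
          rw [← hk']
          have h2 : cs f γ (n - j + j) = cs f γ (n - j + i) := by
            simp only [cs] at h ⊢
            rw [Function.iterate_add_apply, Function.iterate_add_apply, h]
          rwa [Nat.sub_add_cancel (by omega)] at h2
    apply hinf
    apply Set.Finite.subset ((Finset.range j).image (fun k => aeval (cs f γ k) g)).finite_toSet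
    rintro q ⟨n, -, rfl⟩
    obtain ⟨k, hk, hk'⟩ := h1 n
    rw [hk']
    simp only [Finset.coe_image, Set.mem_image, Finset.coe_range, Set.mem_Iio]
    exact ⟨k, hk, rfl⟩
  intro i j h
  rcases lt_trichotomy i j with h1 | h1 | h1
  · exact absurd h (key i j h1)
  · exact h1
  · exact absurd h.symm (key j i h1)

section

variable (f g : ℤ[X]) (hf : f.Monic) (hfdeg : f.natDegree = 2) (hg : g.Monic)
    (γ : ℚ) (hγ : γ = -(f.coeff 1 : ℚ) / 2)
    (hirr : ∀ n : ℕ, Irreducible ((g.comp (polyIter f n)).map (Int.castRingHom ℚ)))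
    (hinf : {q : ℚ | ∃ n : ℕ, 1 ≤ n ∧ aeval (cs f γ n) g = q}.Infinite)

lemma cs_ge (hf : f.Monic) (hfdeg : f.natDegree = 2) (hγ : γ = -(f.coeff 1 : ℚ) / 2) (n : ℕ) (hn : 1 ≤ n) :
    cs f γ 1 ≤ cs f γ n := by
  obtain ⟨k, rfl⟩ : ∃ k, n = k + 1 := ⟨n - 1, by omega⟩
  rw [cs_succ, cs_succ, cs_zero, aeval_f f hf hfdeg, aeval_f f hf hfdeg]
  have h1 : (f.coeff 1 : ℚ) = -2 * γ := by rw [hγ]; ring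
  rw [h1]
  nlinarith [sq_nonneg (cs f γ k - γ)]

lemma triple_int (hf : f.Monic) (hfdeg : f.natDegree = 2) (hg : g.Monic)
    (hγ : γ = -(f.coeff 1 : ℚ) / 2)
    (hirr : ∀ n : ℕ, Irreducible ((g.comp (polyIter f n)).map (Int.castRingHom ℚ)))
    (hinf : {q : ℚ | ∃ n : ℕ, 1 ≤ n ∧ aeval (cs f γ n) g = q}.Infinite)
    (z0 : ℤ) (hz0 : γ = z0) (K : ℕ) :
    ∃ n0, ∀ n1 n2, n0 ≤ n1 → n1 < n2 → n2 ≤ n1 + K →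
      ¬ IsSquare (aeval (cs f γ n1) g * aeval (cs f γ n2) g) := by
  have hinj := cs_inj f g γ hinf
  have hintg : ∀ n, ∃ z : ℤ, cs f γ n = z := by
    intro n
    induction n with
    | zero => exact ⟨z0, hz0⟩
    | succ n ih =>
      obtain ⟨z, hz⟩ := ih
      exact ⟨z ^ 2 + f.coeff 1 * z + f.coeff 0, by rw [cs_succ, aeval_f f hf hfdeg, hz]; push_cast; ring⟩
  choose cz hcz using hintg
  have hczinj : Function.Injective cz := by
    intro i j h
    apply hinj
    rw [hcz, hcz, h]
  have hlarge : ∀ B : ℚ, ∃ n0, ∀ n, n0 ≤ n → B < cs f γ n := by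
    intro B
    have hfin : {n | cz n ∈ Set.Icc (cz 1) ⌈B⌉}.Finite :=
      (Set.finite_Icc (cz 1) ⌈B⌉).preimage hczinj.injOn
    obtain ⟨M, hM⟩ := hfin.bddAbove
    refine ⟨M + 1, fun n hn => ?_⟩
    by_contra hcon
    push Not at hcon
    have h1 := cs_ge f γ hf hfdeg hγ n (by omega)
    rw [hcz, hcz, Int.cast_le] at h1
    rw [hcz] at hcon
    have h2 : cz n ≤ ⌈B⌉ := by
      have := hcon.trans (Int.le_ceil B)
      exact_mod_cast this
    have := hM (show n ∈ {n | cz n ∈ Set.Icc (cz 1) ⌈B⌉} from ⟨h1, h2⟩)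
    omega
  have hd := g_pos f g (hirr 0) hg
  have hpair : ∀ k : ℕ, ∃ n0, 1 ≤ k → ∀ n, n0 ≤ n → ¬ IsSquare (aeval (cs f γ (n + 1)) g * aeval (cs f γ (n + 1 + k)) g) := by
    intro k
    by_cases hk : 1 ≤ k
    swap
    · exact ⟨0, fun h => absurd h hk⟩
    obtain ⟨m1, l1⟩ := h_monic f g hf hfdeg hg 1
    obtain ⟨m2, l2⟩ := h_monic f g hf hfdeg hg (k + 1)
    obtain ⟨B, hB⟩ := Runge.int_pair _ _ (g.natDegree * (1 + 2 ^ k)) (by positivity) m1 m2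
      (by rw [l1, l2]; ring) (by
        rw [l1, l2]
        apply Nat.mul_lt_mul_of_pos_left _ hd
        apply Nat.pow_lt_pow_right (by norm_num); omega) (hirr 1) (hirr (k + 1))
    obtain ⟨n0, hn0⟩ := hlarge B
    refine ⟨n0, fun _ n hn => ?_⟩
    have h1 := hn0 n hn
    rw [hcz] at h1
    have h2 := hB (cz n) h1
    rw [← hcz, aeval_h_cs, aeval_h_cs] at h2
    rwa [show n + (k + 1) = n + 1 + k by ring] at h2
  choose n0 hn0 using hpair
  refine ⟨(Finset.range (K + 1)).sup n0 + 1, fun n1 n2 h1 h2 h3 => ?_⟩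
  have h4 := Finset.le_sup (f := n0) (Finset.mem_range.2 (show n2 - n1 < K + 1 by omega))
  have h5 := hn0 (n2 - n1) (by omega) (n1 - 1) (by omega)
  rwa [show n1 - 1 + 1 = n1 by omega, show n1 + (n2 - n1) = n2 by omega] at h5

lemma triple_half (hf : f.Monic) (hfdeg : f.natDegree = 2) (hg : g.Monic)
    (hγ : γ = -(f.coeff 1 : ℚ) / 2)
    (hirr : ∀ n : ℕ, Irreducible ((g.comp (polyIter f n)).map (Int.castRingHom ℚ)))
    (hodd : Odd (f.coeff 1)) (K : ℕ) :
    ∃ n0, ∀ n1 n2 n3, n0 ≤ n1 → n1 < n2 → n2 < n3 → n3 ≤ n1 + K →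
      IsSquare (aeval (cs f γ n1) g * aeval (cs f γ n2) g) →
      IsSquare (aeval (cs f γ n1) g * aeval (cs f γ n3) g) →
      IsSquare (aeval (cs f γ n2) g * aeval (cs f γ n3) g) → False := by
  have hd := g_pos f g (hirr 0) hg
  have hgl : g.coeff g.natDegree = 1 := hg
  -- numerators
  have hu : ∀ n, ∃ u : ℤ, cs f γ n = (u : ℚ) / ((2 ^ (2 ^ n) : ℤ) : ℚ) ∧ Odd u ∧ (2 ≤ n → u % 4 = 1) := by
    intro n
    induction n with
    | zero => exact ⟨-f.coeff 1, by rw [cs_zero, hγ]; simp, hodd.neg, by omega⟩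
    | succ n ih =>
      obtain ⟨u, h1, h2, h3⟩ := ih
      set w : ℤ := 2 ^ (2 ^ n) with hw
      have hw0 : (w : ℚ) ≠ 0 := by positivity
      have hw2 : ∃ w', w = 2 * w' := by
        have h2n : 0 < 2 ^ n := by positivity
        refine ⟨2 ^ (2 ^ n - 1), ?_⟩
        rw [hw, ← pow_succ']; congr 1; omega
      have hww : (2:ℤ) ^ (2 ^ (n + 1)) = w ^ 2 := by rw [hw, ← pow_mul, pow_succ]
      refine ⟨u ^ 2 + w * (f.coeff 1 * u + f.coeff 0 * w), ?_, ?_, ?_⟩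
      · rw [cs_succ, aeval_f f hf hfdeg, h1, hww]
        push_cast
        field_simp
        ring
      · obtain ⟨w', hw'⟩ := hw2
        rw [hw', mul_assoc]
        exact h2.pow.add_even (even_two_mul _)
      · intro hn
        have hw4 : ∃ w', w = 4 * w' := ⟨2 ^ (2 ^ n - 2), by
          have h4 : 2 ^ 1 ≤ 2 ^ n := Nat.pow_le_pow_right (by norm_num) (by omega)
          rw [hw, show (4:ℤ) = 2 ^ 2 by norm_num, ← pow_add]; congr 1; omega⟩
        obtain ⟨w', hw'⟩ := hw4
        have h5 := Int.sq_mod_four_eq_one_of_odd h2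
        have h6 : w * (f.coeff 1 * u + f.coeff 0 * w) = 4 * (w' * (f.coeff 1 * u + f.coeff 0 * w)) := by
          rw [hw']; ring
        rw [h6]
        omega
  choose u hu1 hu2 hu3 using hu
  have hD : ∀ n, ∃ D : ℤ, ((2 ^ (2 ^ n) : ℤ) : ℚ) ^ g.natDegree * aeval (cs f γ n) g = D ∧ (2 ≤ n → D % 4 = 1) := by
    intro n
    obtain ⟨t, ht⟩ := Runge.homog g g.natDegree le_rfl (u n) (2 ^ (2 ^ n)) (by positivity)
    rw [← hu1, hgl, one_mul] at ht
    refine ⟨_, ht, fun hn => ?_⟩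
    have h4 : 2 ^ 1 ≤ 2 ^ n := Nat.pow_le_pow_right (by norm_num) (by omega)
    have h6 : (2:ℤ) ^ (2 ^ n) * t = 4 * (2 ^ (2 ^ n - 2) * t) := by
      rw [← mul_assoc, show (4:ℤ) = 2 ^ 2 by norm_num, ← pow_add]; congr 2; omega
    have h3 : u n ^ g.natDegree % 4 = 1 := by
      have : u n ^ g.natDegree ≡ 1 ^ g.natDegree [ZMOD 4] := Int.ModEq.pow _ (hu3 n hn)
      rw [one_pow] at this; exact this
    rw [h6]
    omega
  choose D hD1 hD2 using hD
  have hpair : ∀ k : ℕ, ∃ e0, 1 ≤ k → ∀ n, e0 ≤ 2 ^ n → 2 ≤ n →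
      IsSquare (aeval (cs f γ (n + 1)) g * aeval (cs f γ (n + 1 + k)) g) →
      ∃ V : ℤ, V % 4 = 1 ∧ V ^ 2 = D (n + 1) * D (n + 1 + k) ∧ V < 0 ∧ 0 < D (n + 1) := by
    intro k
    by_cases hk : 1 ≤ k
    swap
    · exact ⟨0, fun h => absurd h hk⟩
    obtain ⟨m1, l1⟩ := h_monic f g hf hfdeg hg 1
    obtain ⟨m2, l2⟩ := h_monic f g hf hfdeg hg (k + 1)
    obtain ⟨e0, he0⟩ := Runge.half_pair _ _ (g.natDegree * (1 + 2 ^ k)) (by positivity) m1 m2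
      (by rw [l1, l2]; ring) (by
        rw [l1, l2]
        apply Nat.mul_lt_mul_of_pos_left _ hd
        apply Nat.pow_lt_pow_right (by norm_num); omega) (hirr 1) (hirr (k + 1)) (-(cs f γ 1))
    refine ⟨e0, fun _ n hn hn2 hsq => ?_⟩
    obtain ⟨y, hy⟩ := hsq
    have hw0 : (0:ℚ) < ((2 ^ (2 ^ n) : ℤ) : ℚ) := by positivity
    have h1 : (((2 ^ (2 ^ n) : ℤ) : ℚ) ^ (g.natDegree * (1 + 2 ^ k)) * y) ^ 2 = ((D (n + 1) * D (n + 1 + k) : ℤ) : ℚ) := by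
      rw [Int.cast_mul, ← hD1, ← hD1, mul_pow, sq y, ← hy]
      push_cast
      ring
    have h2 : IsSquare (D (n + 1) * D (n + 1 + k)) := by
      rw [← Rat.isSquare_intCast_iff, ← h1]
      exact IsSquare.sq _
    obtain ⟨V0, hV0⟩ := h2
    have h3 : ∃ V : ℤ, V % 4 = 1 ∧ V ^ 2 = D (n + 1) * D (n + 1 + k) := by
      have a1 := hD2 (n + 1) (by omega)
      have a2 := hD2 (n + 1 + k) (by omega)
      have a3 : (V0 * V0) % 4 = 1 := by
        rw [← hV0, Int.mul_emod, a1, a2]; norm_num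
      have a4 : V0 % 4 = 0 ∨ V0 % 4 = 1 ∨ V0 % 4 = 2 ∨ V0 % 4 = 3 := by omega
      rcases a4 with h | h | h | h
      · rw [Int.mul_emod, h] at a3; norm_num at a3
      · exact ⟨V0, h, by rw [hV0, sq]⟩
      · rw [Int.mul_emod, h] at a3; norm_num at a3
      · exact ⟨-V0, by omega, by rw [hV0]; ring⟩
    obtain ⟨V, hV4, hV⟩ := h3
    have h4 := he0 (2 ^ n) hn (u n) V (hu3 n hn2) hV4 (by
      rw [← hu1, neg_neg]; exact cs_ge f γ hf hfdeg hγ n (by omega)) (by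
      rw [← hu1, aeval_h_cs, aeval_h_cs, show n + (k + 1) = n + 1 + k by ring, hy, ← sq y, ← mul_pow, h1, ← hV]
      push_cast; rfl)
    refine ⟨V, hV4, hV, h4.1, ?_⟩
    have h5 := h4.2
    rw [← hu1, aeval_h_cs] at h5
    have h6 : (0:ℚ) < D (n + 1) := by rw [← hD1]; positivity
    exact_mod_cast h6
  choose e0 he0 using hpair
  refine ⟨(Finset.range (K + 1)).sup e0 + 3, fun n1 n2 n3 h0 h12 h23 hK s12 s13 s23 => ?_⟩
  have hbig : ∀ n j, n1 ≤ n → n < j → j ≤ n1 + K →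
      IsSquare (aeval (cs f γ n) g * aeval (cs f γ j) g) →
      ∃ V : ℤ, V % 4 = 1 ∧ V ^ 2 = D n * D j ∧ V < 0 ∧ 0 < D n := by
    intro n j hn hj hjK hs
    have h4 := Finset.le_sup (f := e0) (Finset.mem_range.2 (show j - n < K + 1 by omega))
    have h6 : n - 1 < 2 ^ (n - 1) := Nat.lt_two_pow_self
    have h5 := he0 (j - n) (by omega) (n - 1) (by omega) (by omega)
    rw [show n - 1 + 1 = n by omega, show n + (j - n) = j by omega] at h5
    exact h5 hs
  obtain ⟨V1, a1, b1, c1, d1⟩ := hbig n1 n2 le_rfl h12 (by omega) s12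
  obtain ⟨V2, a2, b2, c2, -⟩ := hbig n1 n3 le_rfl (by omega) (by omega) s13
  obtain ⟨V3, a3, b3, c3, d2⟩ := hbig n2 n3 (by omega) (by omega) (by omega) s23
  have d3 : 0 < D n3 := by
    have : 0 < V3 ^ 2 := by nlinarith
    rw [b3] at this
    exact (mul_pos_iff_of_pos_left d2).1 this
  have e1 : (V1 * V2 * V3) ^ 2 = (D n1 * D n2 * D n3) ^ 2 := by
    rw [mul_pow, mul_pow, b1, b2, b3]; ring
  have e2 : V1 * V2 * V3 < 0 := mul_neg_of_pos_of_neg (mul_pos_of_neg_of_neg c1 c2) c3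
  have e3 : 0 < D n1 * D n2 * D n3 := by positivity
  have e4 : V1 * V2 * V3 % 4 = 1 := by rw [Int.mul_emod, Int.mul_emod V1, a1, a2, a3]; norm_num
  have e5 : D n1 * D n2 * D n3 % 4 = 1 := by
    rw [Int.mul_emod, Int.mul_emod (D n1), hD2 n1 (by omega), hD2 n2 (by omega), hD2 n3 (by omega)]; norm_num
  rcases sq_eq_sq_iff_eq_or_eq_neg.1 e1 with h | h
  · omega
  · omega

lemma triple (hf : f.Monic) (hfdeg : f.natDegree = 2) (hg : g.Monic)
    (hγ : γ = -(f.coeff 1 : ℚ) / 2)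
    (hirr : ∀ n : ℕ, Irreducible ((g.comp (polyIter f n)).map (Int.castRingHom ℚ)))
    (hinf : {q : ℚ | ∃ n : ℕ, 1 ≤ n ∧ aeval (cs f γ n) g = q}.Infinite) (K : ℕ) :
    ∃ n0, ∀ n1 n2 n3, n0 ≤ n1 → n1 < n2 → n2 < n3 → n3 ≤ n1 + K →
      IsSquare (aeval (cs f γ n1) g * aeval (cs f γ n2) g) →
      IsSquare (aeval (cs f γ n1) g * aeval (cs f γ n3) g) →
      IsSquare (aeval (cs f γ n2) g * aeval (cs f γ n3) g) → False := by
  rcases Int.even_or_odd (f.coeff 1) with h | h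
  · obtain ⟨r, hr⟩ := h
    obtain ⟨n0, hn0⟩ := triple_int f g γ hf hfdeg hg hγ hirr hinf (-r) (by rw [hγ, hr]; push_cast; ring) K
    exact ⟨n0, fun n1 n2 n3 h1 h2 h3 h4 h5 _ _ => hn0 n1 n2 h1 h2 (by omega) h5⟩
  · exact triple_half f g γ hf hfdeg hg hγ hirr h K

end

end CritOrbit


namespace CritOrbit

open Polynomial

lemma nat_isSquare (N : ℕ) (h0 : N ≠ 0) (h : ∀ p, p.Prime → Even (padicValNat p N)) : IsSquare N := by
  refine ⟨∏ p ∈ N.primeFactors, p ^ (N.factorization p / 2), ?_⟩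
  rw [← Finset.prod_mul_distrib]
  conv_lhs => rw [← Nat.prod_factorization_pow_eq_self h0]
  rw [Finsupp.prod, Nat.support_factorization]
  apply Finset.prod_congr rfl
  intro p hp
  have hpp := Nat.prime_of_mem_primeFactors hp
  have h1 := h p hpp
  rw [← Nat.factorization_def N hpp] at h1
  rw [← pow_add]
  congr 1
  obtain ⟨r, hr⟩ := h1
  omega

lemma rat_isSquare (q : ℚ) (h0 : 0 < q) (h : ∀ p : ℕ, p.Prime → Even (padicValRat p q)) : IsSquare q := by
  have hnum : 0 < q.num := Rat.num_pos.2 h0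
  have h1 : IsSquare (q.num.natAbs * q.den) := by
    apply nat_isSquare
    · exact mul_ne_zero (by omega) q.den_nz
    · intro p hp
      have := Fact.mk hp
      rw [padicValNat.mul (by omega) q.den_nz]
      have := h p hp
      rw [padicValRat_def, padicValInt, Int.even_sub] at this
      rw [Nat.even_add]
      exact_mod_cast this
  obtain ⟨r, hr⟩ := h1
  refine ⟨r / q.den, ?_⟩
  have hd : (q.den : ℚ) ≠ 0 := by exact_mod_cast q.den_nz
  have h2 : (q.num : ℚ) * q.den = r * r := by
    have : ((q.num.natAbs : ℤ)) = q.num := by omega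
    rw [← this]; exact_mod_cast hr
  have h3 : q = q.num / q.den := (Rat.num_div_den q).symm
  have h4 : q * q.den = q.num := by rw [eq_div_iff hd] at h3; exact h3
  field_simp
  linear_combination h2 + (q.den : ℚ) * h4

/-- the values have only powers of two in the denominator -/
lemma denom (f g : ℤ[X]) (hf : f.Monic) (hfdeg : f.natDegree = 2)
    (γ : ℚ) (hγ : γ = -(f.coeff 1 : ℚ) / 2) (n : ℕ) :
    (∃ (E : ℕ) (U : ℤ), 2 ^ E * cs f γ n = U) ∧ ∃ (E : ℕ) (D : ℤ), 2 ^ E * aeval (cs f γ n) g = D := by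
  have hu : ∃ (e : ℕ) (u : ℤ), cs f γ n = (u : ℚ) / ((2 ^ e : ℤ) : ℚ) := by
    induction n with
    | zero => exact ⟨1, -f.coeff 1, by rw [cs_zero, hγ]; simp⟩
    | succ n ih =>
      obtain ⟨e, u, h1⟩ := ih
      refine ⟨2 * e, u ^ 2 + 2 ^ e * (f.coeff 1 * u + f.coeff 0 * 2 ^ e), ?_⟩
      rw [cs_succ, aeval_f f hf hfdeg, h1]
      push_cast
      rw [mul_comm 2 e, pow_mul]
      field_simp
      ring
  obtain ⟨e, u, hu⟩ := hu
  refine ⟨⟨e, u, by rw [hu]; push_cast; field_simp⟩, ?_⟩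
  obtain ⟨t, ht⟩ := Runge.homog g g.natDegree le_rfl u (2 ^ e) (by positivity)
  rw [← hu] at ht
  exact ⟨e * g.natDegree, _, by rw [← ht, pow_mul]; push_cast; rfl⟩

lemma val_eq (p : ℕ) (hp : p.Prime) (hp2 : p ≠ 2) (E : ℕ) (D : ℤ) (q : ℚ) (hq : q ≠ 0) (h : 2 ^ E * q = D) :
    padicValRat p q = padicValInt p D := by
  have := Fact.mk hp
  rw [← padicValRat.of_int, ← h, padicValRat.mul (by positivity) hq]
  have : padicValRat p ((2:ℚ) ^ E) = 0 := by
    have h2 : padicValRat p ((2:ℕ) : ℚ) = 0 := by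
      rw [padicValRat.of_nat, padicValNat.eq_zero_of_not_dvd]
      · simp
      · intro h; exact hp2 ((Nat.prime_dvd_prime_iff_eq hp Nat.prime_two).1 h)
    push_cast at h2
    rw [padicValRat.pow, h2, mul_zero]
  rw [this, zero_add]

/-- arithmetic good levels -/
def Good (d : ℕ → ℚ) (Δ : ℤ) (n : ℕ) : Prop :=
  1 ≤ n ∧ ∃ p : ℕ, p.Prime ∧ p ≠ 2 ∧ ¬ (p : ℤ) ∣ Δ ∧ (∀ k, 1 ≤ k → k < n → padicValRat p (d k) = 0) ∧
    Odd (padicValRat p (d n))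

theorem good_infinite (f g : ℤ[X]) (hf : f.Monic) (hfdeg : f.natDegree = 2) (hg : g.Monic)
    (γ : ℚ) (hγ : γ = -(f.coeff 1 : ℚ) / 2)
    (hirr : ∀ n : ℕ, Irreducible ((g.comp (polyIter f n)).map (Int.castRingHom ℚ)))
    (hinf : {q : ℚ | ∃ n : ℕ, 1 ≤ n ∧ aeval (cs f γ n) g = q}.Infinite)
    (hne : ∀ n : ℕ, 1 ≤ n → aeval (cs f γ n) g ≠ 0)
    (hrigid : ∀ p : ℕ, p.Prime → p ≠ 2 → ∀ n : ℕ, 1 ≤ n → ∀ m : ℕ, 1 ≤ m →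
        0 < padicValRat p (aeval (cs f γ n) g) →
        padicValRat p (aeval (cs f γ (m * n)) g) = padicValRat p (aeval (cs f γ n) g))
    (Δ : ℤ) (hΔ : Δ ≠ 0) : {n | Good (fun n => aeval (cs f γ n) g) Δ n}.Infinite := by
  classical
  intro hfin
  set d : ℕ → ℚ := fun n => aeval (cs f γ n) g with hd
  obtain ⟨n0, hn0⟩ := hfin.bddAbove
  have hnonneg : ∀ p : ℕ, p.Prime → p ≠ 2 → ∀ n, 1 ≤ n → 0 ≤ padicValRat p (d n) := by
    intro p hp hp2 n hn
    obtain ⟨E, D, h⟩ := (denom f g hf hfdeg γ hγ n).2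
    rw [val_eq p hp hp2 E D _ (hne n hn) h]
    positivity
  let Q : Finset ℕ := {2} ∪ Δ.natAbs.primeFactors ∪
    (Finset.range (n0 + 1)).biUnion (fun k => (d k).num.natAbs.primeFactors ∪ (d k).den.primeFactors)
  have hQ : ∀ p : ℕ, p.Prime → p ∉ Q → ∀ n, 1 ≤ n → Even (padicValRat p (d n)) := by
    intro p hp hpQ n hn
    have := Fact.mk hp
    simp only [Q, Finset.mem_union, Finset.mem_singleton, Finset.mem_biUnion, Finset.mem_range, not_or, not_exists, not_and] at hpQ
    obtain ⟨⟨hp2, hpΔ⟩, hpk⟩ := hpQ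
    by_contra hcon
    rw [Int.not_even_iff_odd] at hcon
    have hpos : 0 < padicValRat p (d n) := by
      rcases (hnonneg p hp hp2 n hn).lt_or_eq with h | h
      · exact h
      · rw [← h] at hcon; simp at hcon
    have hex : ∃ k, 1 ≤ k ∧ 0 < padicValRat p (d k) := ⟨n, hn, hpos⟩
    obtain ⟨hk1, hk2⟩ := Nat.find_spec hex
    set k := Nat.find hex with hk
    have e1 := hrigid p hp hp2 k hk1 n hn hk2
    have e2 := hrigid p hp hp2 n hn k hk1 hpos
    rw [mul_comm] at e2
    have e3 : padicValRat p (d k) = padicValRat p (d n) := e1.symm.trans e2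
    have hgood : Good d Δ k := by
      refine ⟨hk1, p, hp, hp2, ?_, ?_, by rw [e3]; exact hcon⟩
      · intro h
        apply hpΔ
        rw [Nat.mem_primeFactors]
        exact ⟨hp, Int.natCast_dvd.1 h, by omega⟩
      · intro j hj1 hj2
        have := Nat.find_min hex hj2
        push Not at this
        exact le_antisymm (this hj1) (hnonneg p hp hp2 j hj1)
    have hkn0 : k ≤ n0 := hn0 hgood
    obtain ⟨f1, f2⟩ := hpk k (by omega)
    rw [Nat.mem_primeFactors] at f1 f2
    have hdk : d k ≠ 0 := hne k hk1
    have g1 : ¬ p ∣ (d k).num.natAbs := fun h => f1 ⟨hp, h, by simpa using hdk⟩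
    have g2 : ¬ p ∣ (d k).den := fun h => f2 ⟨hp, h, (d k).den_nz⟩
    have g3 : padicValRat p (d k) = 0 := by
      rw [padicValRat_def, padicValInt, padicValNat.eq_zero_of_not_dvd g1, padicValNat.eq_zero_of_not_dvd g2]; simp
    omega
  let cls : ℕ → SignType × (Q → ZMod 2) := fun n => (SignType.sign (d n), fun p => ((padicValRat p (d n) : ℤ) : ZMod 2))
  have hsq : ∀ n m, 1 ≤ n → 1 ≤ m → cls n = cls m → IsSquare (d n * d m) := by
    intro n m hn hm h
    simp only [cls, Prod.mk.injEq] at h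
    obtain ⟨h1, h2⟩ := h
    have hdn : d n ≠ 0 := hne n hn
    have hdm : d m ≠ 0 := hne m hm
    apply rat_isSquare
    · rw [← sign_eq_one_iff, sign_mul, h1]
      rcases lt_or_gt_of_ne hdm with h | h
      · rw [sign_neg h]; rfl
      · rw [sign_pos h]; rfl
    · intro p hp
      have := Fact.mk hp
      rw [padicValRat.mul hdn hdm]
      by_cases hpQ : p ∈ Q
      · have h3 := congrFun h2 ⟨p, hpQ⟩
        simp only at h3
        rw [ZMod.intCast_eq_intCast_iff] at h3
        have h4 : padicValRat p (d n) % 2 = padicValRat p (d m) % 2 := h3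
        rw [Int.even_iff]; omega
      · exact (hQ p hp hpQ n hn).add (hQ p hp hpQ m hm)
  set Cn := Fintype.card (SignType × (Q → ZMod 2)) with hCn
  obtain ⟨n1, hn1⟩ := triple f g γ hf hfdeg hg hγ hirr hinf (Cn * 2)
  obtain ⟨y, hy⟩ := Fintype.exists_lt_card_fiber_of_mul_lt_card (fun i : Fin (Cn * 2 + 1) => cls (n1 + 1 + i)) (n := 2)
    (by rw [Fintype.card_fin]; omega)
  obtain ⟨T, hT1, hT2⟩ := Finset.exists_subset_card_eq (show 3 ≤ _ from hy)
  let φ := T.orderEmbOfFin hT2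
  have hφ : ∀ i, cls (n1 + 1 + (φ i : ℕ)) = y := by
    intro i
    have h1 := Finset.orderEmbOfFin_mem T hT2 i
    exact (Finset.mem_filter.1 (hT1 h1)).2
  have l1 : φ 0 < φ 1 := φ.strictMono (by decide)
  have l2 : φ 1 < φ 2 := φ.strictMono (by decide)
  have l3 := (φ 2).2
  rw [Fin.lt_def] at l1 l2
  refine hn1 (n1 + 1 + φ 0) (n1 + 1 + φ 1) (n1 + 1 + φ 2) (by omega) (by omega) (by omega) (by omega) ?_ ?_ ?_
  · exact hsq _ _ (by omega) (by omega) ((hφ 0).trans (hφ 1).symm)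
  · exact hsq _ _ (by omega) (by omega) ((hφ 0).trans (hφ 2).symm)
  · exact hsq _ _ (by omega) (by omega) ((hφ 1).trans (hφ 2).symm)

end CritOrbit


namespace InertiaPart
open Polynomial NumberField

variable {K : Type*} [Field K] [NumberField K]

lemma perfect_res (p : Ideal ℤ) [p.IsPrime] (hp : p ≠ ⊥) : PerfectField p.ResidueField := by
  have : p.IsMaximal := Ideal.IsPrime.isMaximal inferInstance hp
  have : Finite (ℤ ⧸ p) := Ideal.finiteQuotientOfFreeOfNeBot p hp
  have : Finite p.ResidueField :=
    Finite.of_surjective _ (Ideal.bijective_algebraMap_quotient_residueField p).2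
  infer_instance

lemma unram [IsGalois ℚ K] (p : ℕ) (hp : p.Prime) (Q : Ideal (𝓞 K)) [Q.IsPrime]
    [Q.LiesOver (Ideal.span {(p:ℤ)})]
    (htriv : ∀ σ : K ≃ₐ[ℚ] K, σ ∈ Q.inertia (K ≃ₐ[ℚ] K) → σ = 1) (T : ℤ) (hT : T ≠ 0) :
    emultiplicity Q (Ideal.span {(T : 𝓞 K)}) = (padicValInt p T : ℕ) := by
  have hpp : Prime (p:ℤ) := Nat.prime_iff_prime_int.mp hp
  have hsp : (Ideal.span {(p:ℤ)}).IsPrime := (Ideal.span_singleton_prime hpp.ne_zero).2 hpp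
  have hbot : Ideal.span {(p:ℤ)} ≠ ⊥ := by simpa using hp.ne_zero
  have := perfect_res _ hbot
  have hQbot : Q ≠ ⊥ := Ideal.ne_bot_of_liesOver_of_ne_bot hbot Q
  have h1 := Ideal.card_inertia_eq_ramificationIdxIn (G := K ≃ₐ[ℚ] K) (Ideal.span {(p:ℤ)}) Q
  rw [Ideal.ramificationIdxIn_eq_ramificationIdx (Ideal.span {(p:ℤ)}) Q (K ≃ₐ[ℚ] K)] at h1
  have h2 : Nat.card (Q.inertia (K ≃ₐ[ℚ] K)) = 1 := by
    rw [Nat.card_eq_one_iff_exists]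
    exact ⟨1, fun σ => Subtype.ext (htriv σ.1 σ.2)⟩
  have h3 : (Ideal.span {(p:ℤ)}).ramificationIdx' Q = Q.ramificationIdx ℤ :=
    Ideal.ramificationIdx'_eq_ramificationIdx _ _ hbot
  have h4 := Ideal.IsDedekindDomain.emultiplicity_map_eq_ramificationIdx'_mul
    (R := ℤ) (S := 𝓞 K) (v := Ideal.span {(p:ℤ)}) (w := Q) (I := Ideal.span {T})
    (by simpa using hT) (Ideal.prime_of_isPrime hbot hsp).irreducible
    (Ideal.prime_of_isPrime hQbot inferInstance).irreducible hQbot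
  rw [h3, ← h1, h2, Ideal.map_span, Set.image_singleton] at h4
  simp only [algebraMap_int_eq, eq_intCast, Nat.cast_one, one_mul] at h4
  have : Fact p.Prime := ⟨hp⟩
  rw [h4, Ideal.emultiplicity_eq_emultiplicity_span, padicValInt,
    padicValNat_eq_emultiplicity (by simpa using hT), Int.emultiplicity_natAbs]

lemma smul_coe (σ : K ≃ₐ[ℚ] K) (x : 𝓞 K) : ((σ • x : 𝓞 K) : K) = σ (x : K) := rfl

lemma inj_of_bezout {R : Type*} [CommRing R] [IsDomain R] (Q : Ideal R) [Q.IsPrime]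
    (h u v : ℤ[X]) (Δ : ℤ) (hB : u * h + v * derivative h = C Δ) (hΔ : (Δ : R) ∉ Q)
    (x y : R) (hx : aeval x h = 0) (hy : aeval y h = 0) (hxy : x - y ∈ Q) : x = y := by
  by_contra hne
  set H := h.map (Int.castRingHom R) with hH
  have hx' : H.IsRoot x := by rwa [IsRoot, hH, eval_map, ← algebraMap_int_eq, ← aeval_def]
  have hy' : H.IsRoot y := by rwa [IsRoot, hH, eval_map, ← algebraMap_int_eq, ← aeval_def]
  obtain ⟨q, hq⟩ := dvd_iff_isRoot.2 hx'
  have hqy : q.eval y = 0 := by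
    rw [hq, IsRoot, eval_mul, mul_eq_zero] at hy'
    rcases hy' with h | h
    · simp only [eval_sub, eval_X, eval_C] at h
      exact absurd (sub_eq_zero.1 h).symm hne
    · exact h
  have hqx : q.eval x ∈ Q := by
    have := Q.mem_of_dvd (sub_dvd_eval_sub x y q) hxy
    rwa [hqy, sub_zero] at this
  have hd : aeval x (derivative h) = q.eval x := by
    have : aeval x (derivative h) = (derivative H).eval x := by
      rw [hH, derivative_map, eval_map, ← algebraMap_int_eq, ← aeval_def]
    rw [this, hq]
    simp
  have := congrArg (aeval x) hB
  rw [map_add, map_mul, map_mul, hx, mul_zero, zero_add, hd, aeval_C] at this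
  apply hΔ
  have h2 : (Δ : R) = aeval x v * q.eval x := by rw [this]; simp
  rw [h2]
  exact Q.mul_mem_left _ hqx

/-- The integer `4^deg * h(c - b²/4)`. -/
noncomputable def TT (f h : ℤ[X]) : ℤ :=
  (h.scaleRoots 4).eval (4 * f.coeff 0 - f.coeff 1 ^ 2)

lemma TT_mem {R : Type*} [CommRing R] (Q : Ideal R) (f h : ℤ[X]) (β : R) (hβ : aeval β h = 0)
    (hQ : 4 * (f.coeff 0 : R) - (f.coeff 1 : R) ^ 2 - 4 * β ∈ Q) : (TT f h : R) ∈ Q := by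
  have h1 : aeval (4 * β) (h.scaleRoots 4) = 0 := by
    have := scaleRoots_aeval_eq_zero (r := (4:ℤ)) hβ
    simpa using this
  set t : ℤ := 4 * f.coeff 0 - f.coeff 1 ^ 2 with ht
  have h2 : (TT f h : R) = aeval (t : R) (h.scaleRoots 4) := by
    rw [TT, ← ht, show ((t : ℤ) : R) = algebraMap ℤ R t by simp, aeval_algebraMap_apply]
    simp
  have h3 := sub_dvd_eval_sub (t : R) (4 * β) ((h.scaleRoots 4).map (Int.castRingHom R))
  rw [eval_map, eval_map, ← algebraMap_int_eq, ← aeval_def, ← aeval_def, h1, sub_zero, ← h2] at h3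
  refine Q.mem_of_dvd h3 ?_
  rw [ht]
  push_cast
  exact hQ

lemma TT_eq (f h : ℤ[X]) :
    (TT f h : ℚ) = 4 ^ h.natDegree * aeval ((f.coeff 0 : ℚ) - (f.coeff 1 : ℚ) ^ 2 / 4) h := by
  have := scaleRoots_eval₂_mul (p := h) (Int.castRingHom ℚ) ((f.coeff 0 : ℚ) - (f.coeff 1 : ℚ) ^ 2 / 4) 4
  rw [aeval_def, algebraMap_int_eq]
  simp only [eq_intCast, Int.cast_ofNat] at this
  rw [← this, TT]
  have h2 : (4:ℚ) * ((f.coeff 0 : ℚ) - (f.coeff 1 : ℚ) ^ 2 / 4) =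
    Int.castRingHom ℚ (4 * f.coeff 0 - f.coeff 1 ^ 2) := by
    simp; ring
  rw [h2, eval₂_at_apply]
  simp

lemma TT_prod (f h : ℤ[X]) (s : Multiset K) (hh : h.Monic)
    (hs : h.map (Int.castRingHom K) = (s.map (fun β => X - C β)).prod) :
    (TT f h : K) = (s.map (fun β => 4 * (f.coeff 0 : K) - (f.coeff 1 : K) ^ 2 - 4 * β)).prod := by
  have h1 := congrArg (algebraMap ℚ K) (TT_eq f h)
  rw [map_intCast, map_mul, ← aeval_algebraMap_apply, aeval_def, algebraMap_int_eq, ← eval_map, hs,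
    eval_multiset_prod, Multiset.map_map] at h1
  have hcard : h.natDegree = s.card := by
    rw [← hh.natDegree_map (Int.castRingHom K), hs, natDegree_multiset_prod_X_sub_C_eq_card]
  rw [h1, hcard]
  clear h1 hs hcard
  induction s using Multiset.induction_on with
  | empty => simp
  | cons a s ih =>
    simp only [Multiset.card_cons, Multiset.map_cons, Multiset.prod_cons, Function.comp_apply,
      eval_sub, eval_X, eval_C]
    rw [← ih, pow_succ]
    simp only [map_mul, map_sub, map_div₀, map_pow, map_ofNat, map_intCast, Function.comp_def, eval_sub, eval_X, eval_C]
    ring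

lemma lift_roots (h : ℤ[X]) (hh : h.Monic) (hs : (h.map (Int.castRingHom K)).Splits) :
    ∃ s : Multiset (𝓞 K), (∀ x, x ∈ s ↔ aeval x h = 0) ∧
      h.map (Int.castRingHom K) = ((s.map (fun x : 𝓞 K => (x : K))).map (fun β => X - C β)).prod ∧
      (h.map (Int.castRingHom K)).roots = s.map (fun x : 𝓞 K => (x : K)) := by
  have hm := hh.map (Int.castRingHom K)
  have key : ∀ x ∈ (h.map (Int.castRingHom K)).roots, ∃ y : 𝓞 K, (y : K) = x := by
    intro x hx
    have hx2 := isRoot_of_mem_roots hx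
    rw [IsRoot, eval_map] at hx2
    exact ⟨⟨x, ⟨h, hh, by rwa [algebraMap_int_eq]⟩⟩, rfl⟩
  have key2 : ∀ r : Multiset K, (∀ x ∈ r, ∃ y : 𝓞 K, (y : K) = x) →
      ∃ s : Multiset (𝓞 K), r = s.map (fun x : 𝓞 K => (x : K)) := by
    intro r
    induction r using Multiset.induction_on with
    | empty => intro _; exact ⟨0, by simp⟩
    | cons a r ih =>
      intro hr
      obtain ⟨s, hs⟩ := ih (fun x hx => hr x (Multiset.mem_cons_of_mem hx))
      obtain ⟨y, hy⟩ := hr a (Multiset.mem_cons_self a r)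
      exact ⟨y ::ₘ s, by rw [Multiset.map_cons, hs, hy]⟩
  obtain ⟨s, hs'⟩ := key2 _ key
  refine ⟨s, ?_, ?_, hs'⟩
  · intro x
    have e1 : x ∈ s ↔ (x : K) ∈ (h.map (Int.castRingHom K)).roots := by
      rw [hs', Multiset.mem_map]
      constructor
      · intro hx; exact ⟨x, hx, rfl⟩
      · rintro ⟨y, hy, hyx⟩
        rwa [← RingOfIntegers.ext hyx]
    rw [e1, mem_roots hm.ne_zero, IsRoot, eval_map, ← algebraMap_int_eq, ← aeval_def,
      show (x : K) = algebraMap (𝓞 K) K x from rfl, aeval_algebraMap_apply]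
    exact map_eq_zero_iff _ RingOfIntegers.coe_injective
  · rw [← hs']
    exact hs.eq_prod_roots_of_monic hm

end InertiaPart


namespace InertiaPart
open Polynomial NumberField CritOrbit

variable {K : Type*} [Field K] [NumberField K]

lemma TT_h (f g : ℤ[X]) (hf : f.Monic) (hfdeg : f.natDegree = 2)
    (γ : ℚ) (hγ : γ = -(f.coeff 1 : ℚ) / 2) (k : ℕ) :
    (2 : ℚ) ^ (2 * (g.comp (polyIter f k)).natDegree) * aeval (cs f γ (k + 1)) g =
      (TT f (g.comp (polyIter f k)) : ℤ) := by
  have e1 : (f.coeff 0 : ℚ) - (f.coeff 1 : ℚ) ^ 2 / 4 = aeval γ f := by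
    rw [aeval_f f hf hfdeg, hγ]; ring
  rw [TT_eq, e1, pow_mul, aeval_h]
  norm_num
  rfl

lemma polyIter_succ_comp (f : ℤ[X]) (k : ℕ) : polyIter f (k+1) = (polyIter f k).comp f := by
  induction k with
  | zero => simp [polyIter]
  | succ k ih =>
    have h1 : polyIter f (k+1+1) = f.comp (polyIter f (k+1)) := rfl
    have h2 : f.comp (polyIter f k) = polyIter f (k+1) := rfl
    rw [h1, ih, ← comp_assoc, h2, ih]

lemma mem_iff (p : ℕ) (Q : Ideal (𝓞 K)) [Q.LiesOver (Ideal.span {(p:ℤ)})] (D : ℤ) :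
    (D : 𝓞 K) ∈ Q ↔ (p : ℤ) ∣ D := by
  rw [← Ideal.mem_span_singleton, Ideal.mem_of_liesOver Q (Ideal.span {(p:ℤ)})]
  simp

/-- Roots at level `k` stay distinct modulo `Q`. -/
lemma roots_distinct (f g : ℤ[X]) (hf : f.Monic) (hfdeg : f.natDegree = 2)
    (u v : ℤ[X]) (Δ : ℤ) (hB : u * g + v * derivative g = C Δ)
    (p : ℕ) (Q : Ideal (𝓞 K)) [Q.IsPrime] [Q.LiesOver (Ideal.span {(p:ℤ)})]
    (hΔ : ¬ (p:ℤ) ∣ Δ) (k : ℕ) (hk : ∀ j < k, ¬ (p:ℤ) ∣ TT f (g.comp (polyIter f j)))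
    (x y : 𝓞 K) (hx : aeval x (g.comp (polyIter f k)) = 0)
    (hy : aeval y (g.comp (polyIter f k)) = 0) (hxy : x - y ∈ Q) : x = y := by
  induction k generalizing x y with
  | zero =>
    simp only [polyIter, comp_X] at hx hy
    exact inj_of_bezout Q g u v Δ hB (by rwa [mem_iff p]) x y hx hy hxy
  | succ k ih =>
    have hstep : ∀ z : 𝓞 K, aeval z (g.comp (polyIter f (k+1))) =
        aeval (aeval z f) (g.comp (polyIter f k)) := by
      intro z
      rw [aeval_h, aeval_h, Function.iterate_succ_apply]
    rw [hstep] at hx hy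
    have hfx := aeval_f f hf hfdeg x
    have hfy := aeval_f f hf hfdeg y
    have hmem : aeval x f - aeval y f ∈ Q := by
      rw [hfx, hfy]
      have : x ^ 2 + (f.coeff 1 : 𝓞 K) * x + (f.coeff 0 : 𝓞 K)
        - (y ^ 2 + (f.coeff 1 : 𝓞 K) * y + (f.coeff 0 : 𝓞 K)) = (x + y + f.coeff 1) * (x - y) := by ring
      rw [this]
      exact Q.mul_mem_left _ hxy
    have heq := ih (fun j hj => hk j (by omega)) _ _ hx hy hmem
    by_contra hne
    have h0 : (x + y + f.coeff 1) * (x - y) = 0 := by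
      have : (x + y + f.coeff 1) * (x - y) = aeval x f - aeval y f := by
        rw [hfx, hfy]; ring
      rw [this, heq, sub_self]
    have hsum : x + y + f.coeff 1 = 0 := by
      rcases mul_eq_zero.1 h0 with h | h
      · exact h
      · exact absurd (sub_eq_zero.1 h) hne
    apply hk k (by omega)
    rw [← mem_iff (K := K) p Q]
    refine TT_mem Q f _ _ hx ?_
    have : 4 * (f.coeff 0 : 𝓞 K) - (f.coeff 1 : 𝓞 K) ^ 2 - 4 * aeval x f
      = -((2 * x + f.coeff 1) * (x - y)) := by
      rw [hfx, show y = - x - f.coeff 1 by linear_combination hsum]; ring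
    rw [this]
    exact Q.neg_mem (Q.mul_mem_left _ hxy)

theorem exists_e [IsGalois ℚ K] (f g : ℤ[X]) (hf : f.Monic) (hfdeg : f.natDegree = 2) (hg : g.Monic)
    (γ : ℚ) (hγ : γ = -(f.coeff 1 : ℚ) / 2)
    (hirr : ∀ n : ℕ, Irreducible ((g.comp (polyIter f n)).map (Int.castRingHom ℚ)))
    (hne : ∀ n, 1 ≤ n → aeval (cs f γ n) g ≠ 0)
    (u v : ℤ[X]) (Δ : ℤ) (hB : u * g + v * derivative g = C Δ) (k : ℕ)
    (hgood : Good (fun n => aeval (cs f γ n) g) Δ (k + 1))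
    (hsplit : ∀ j ≤ k + 1, ((g.comp (polyIter f j)).map (Int.castRingHom K)).Splits)
    (hfaith : ∀ σ : K ≃ₐ[ℚ] K, (∀ j ≤ k + 1, ∀ x : K, aeval x (g.comp (polyIter f j)) = 0 → σ x = x) →
      σ = 1) :
    ∃ β : K, aeval β (g.comp (polyIter f k)) = 0 ∧ ∃ e : K ≃ₐ[ℚ] K,
      (∀ x : K, aeval x (g.comp (polyIter f k)) = 0 → e x = x) ∧
      ∀ x : K, aeval x (g.comp (polyIter f (k + 1))) = 0 → (e x = x ↔ aeval x f ≠ β) := by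
  obtain ⟨-, p, hp, hp2, hpΔ, hlow, hodd⟩ := hgood
  have hpp : Prime (p:ℤ) := Nat.prime_iff_prime_int.mp hp
  have := Fact.mk hp
  have hsp : (Ideal.span {(p:ℤ)}).IsPrime := (Ideal.span_singleton_prime hpp.ne_zero).2 hpp
  obtain ⟨Q, hQ1, hQ2⟩ : ∃ Q : Ideal (𝓞 K), Q.IsPrime ∧ Q.LiesOver (Ideal.span {(p:ℤ)}) := by
    obtain ⟨⟨Q, hQ⟩⟩ := (inferInstance : Nonempty ((Ideal.span {(p:ℤ)}).primesOver (𝓞 K)))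
    exact ⟨Q, hQ.1, hQ.2⟩
  have hval : ∀ j, padicValRat p (aeval (cs f γ (j+1)) g) =
      padicValInt p (TT f (g.comp (polyIter f j))) := fun j =>
    val_eq p hp hp2 _ _ _ (hne (j+1) (by omega)) (TT_h f g hf hfdeg γ hγ j)
  have hTne : ∀ j, TT f (g.comp (polyIter f j)) ≠ 0 := by
    intro j h0
    have h1 := TT_h f g hf hfdeg γ hγ j
    rw [h0, Int.cast_zero] at h1
    exact (mul_ne_zero (by positivity) (hne (j+1) (by omega))) h1
  have hTlow : ∀ j < k, ¬ (p:ℤ) ∣ TT f (g.comp (polyIter f j)) := by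
    intro j hj hd
    have h1 := hlow (j+1) (by omega) (by omega)
    simp only at h1
    rw [hval j] at h1
    have h2 := (padicValInt_dvd_iff 1 (TT f (g.comp (polyIter f j)))).1 (by simpa using hd)
    have h3 := hTne j
    simp only [h3, false_or] at h2
    omega
  have hTodd : Odd (padicValInt p (TT f (g.comp (polyIter f k)))) := by
    have h1 := hodd
    simp only at h1
    rw [hval k] at h1
    exact_mod_cast h1
  set T := TT f (g.comp (polyIter f k)) with hT
  have hpT : (p:ℤ) ∣ T := by
    have h2 := (padicValInt_dvd_iff (p := p) 1 T).2 (Or.inr hTodd.pos)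
    simpa using h2
  have hdist : ∀ j ≤ k, ∀ x y : 𝓞 K, aeval x (g.comp (polyIter f j)) = 0 →
      aeval y (g.comp (polyIter f j)) = 0 → x - y ∈ Q → x = y := fun j hj x y =>
    roots_distinct f g hf hfdeg u v Δ hB p Q hpΔ j (fun i hi => hTlow i (by omega)) x y
  -- lifting roots
  have hcoe : ∀ (h : ℤ[X]) (x : 𝓞 K), aeval (x : K) h = 0 ↔ aeval x h = 0 := by
    intro h x
    rw [show (x : K) = algebraMap (𝓞 K) K x from rfl, aeval_algebraMap_apply]
    exact map_eq_zero_iff _ RingOfIntegers.coe_injective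
  have hlift : ∀ j, ∀ x : K, aeval x (g.comp (polyIter f j)) = 0 → ∃ y : 𝓞 K, (y : K) = x := by
    intro j x hx
    exact ⟨⟨x, ⟨_, (h_monic f g hf hfdeg hg j).1, by rwa [aeval_def] at hx⟩⟩, rfl⟩
  obtain ⟨s, hs1, hs2, hs3⟩ := lift_roots (K := K) _ (h_monic f g hf hfdeg hg k).1 (hsplit k (by omega))
  have hsnd : s.Nodup := by
    have : (((g.comp (polyIter f k)).map (Int.castRingHom ℚ)).map (algebraMap ℚ K)).roots.Nodup :=
      nodup_roots ((hirr k).separable.map)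
    rw [Polynomial.map_map, show (algebraMap ℚ K).comp (Int.castRingHom ℚ) = Int.castRingHom K from
      RingHom.ext_int _ _, hs3] at this
    exact Multiset.Nodup.of_map _ this
  have hprod : (T : 𝓞 K) = (s.map (fun β => 4 * (f.coeff 0 : 𝓞 K) - (f.coeff 1 : 𝓞 K) ^ 2 - 4 * β)).prod := by
    have h1 := TT_prod (K := K) f _ _ (h_monic f g hf hfdeg hg k).1 hs2
    apply RingOfIntegers.coe_injective
    rw [map_multiset_prod, Multiset.map_map]
    rw [Multiset.map_map, ← hT] at h1
    have h4 : algebraMap (𝓞 K) K 4 = 4 := map_ofNat _ 4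
    simp only [Function.comp_def, map_sub, map_mul, map_pow, map_intCast, h4]
    exact h1
  have hTQ : (T : 𝓞 K) ∈ Q := (mem_iff p Q T).2 hpT
  obtain ⟨β0, hβ0s, hβ0⟩ : ∃ β0 ∈ s, 4 * (f.coeff 0 : 𝓞 K) - (f.coeff 1 : 𝓞 K) ^ 2 - 4 * β0 ∈ Q := by
    have h1 := hTQ
    rw [hprod] at h1
    obtain ⟨z, hz, hzQ⟩ := (Ideal.IsPrime.multiset_prod_mem_iff_exists_mem hQ1 _).1 h1
    obtain ⟨β, hβ, rfl⟩ := Multiset.mem_map.1 hz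
    exact ⟨β, hβ, hzQ⟩
  have h2Q : (2 : 𝓞 K) ∉ Q := by
    intro h
    have h1 : ((2:ℤ) : 𝓞 K) ∈ Q := by exact_mod_cast h
    rw [mem_iff p Q] at h1
    have h3 : p ∣ 2 := by exact_mod_cast h1
    exact hp2 ((Nat.prime_dvd_prime_iff_eq hp Nat.prime_two).1 h3)
  have huniq : ∀ β ∈ s, 4 * (f.coeff 0 : 𝓞 K) - (f.coeff 1 : 𝓞 K) ^ 2 - 4 * β ∈ Q → β = β0 := by
    intro β hβ hβQ
    refine hdist k le_rfl _ _ ((hs1 β).1 hβ) ((hs1 β0).1 hβ0s) ?_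
    have h1 := Q.sub_mem hβ0 hβQ
    have h3 : (4 * (f.coeff 0 : 𝓞 K) - (f.coeff 1 : 𝓞 K) ^ 2 - 4 * β0) -
      (4 * (f.coeff 0 : 𝓞 K) - (f.coeff 1 : 𝓞 K) ^ 2 - 4 * β) = 2 * (2 * (β - β0)) := by ring
    rw [h3] at h1
    exact (hQ1.mem_or_mem ((hQ1.mem_or_mem h1).resolve_left h2Q)).resolve_left h2Q
  have hstep : ∀ {R : Type _} [CommRing R] (z : R), aeval z (g.comp (polyIter f (k+1))) =
      aeval (aeval z f) (g.comp (polyIter f k)) := by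
    intro R _ z
    rw [aeval_h, aeval_h, Function.iterate_succ_apply]
  have hsq : ∀ x : 𝓞 K, 4 * (f.coeff 0 : 𝓞 K) - (f.coeff 1 : 𝓞 K) ^ 2 - 4 * aeval x f =
      - ((2 * x + f.coeff 1) * (2 * x + f.coeff 1)) := by
    intro x
    rw [aeval_f f hf hfdeg x]; ring
  have hact : ∀ (σ : K ≃ₐ[ℚ] K) (h : ℤ[X]) (x : 𝓞 K), aeval (σ • x) h = σ • aeval x h := by
    intro σ h x
    apply RingOfIntegers.coe_injective
    rw [← aeval_algebraMap_apply]
    change aeval (σ (x : K)) h = σ ((aeval x h : 𝓞 K) : K)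
    rw [show ((aeval x h : 𝓞 K) : K) = aeval (x : K) h from (aeval_algebraMap_apply K x h).symm]
    exact (aeval_algHom_apply ((σ : K →ₐ[ℚ] K).restrictScalars ℤ) (x : K) h)
  -- inertia acts
  have hin1 : ∀ σ ∈ Q.inertia (K ≃ₐ[ℚ] K), ∀ j ≤ k, ∀ x : 𝓞 K, aeval x (g.comp (polyIter f j)) = 0 →
      σ • x = x := by
    intro σ hσ j hj x hx
    refine hdist j hj _ _ ?_ hx (AddSubgroup.mem_inertia.1 hσ x)
    rw [hact, hx, smul_zero]
  have hin2 : ∀ σ ∈ Q.inertia (K ≃ₐ[ℚ] K), ∀ x : 𝓞 K, aeval x (g.comp (polyIter f (k+1))) = 0 →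
      aeval x f ≠ β0 → σ • x = x := by
    intro σ hσ x hx hxβ
    rw [hstep] at hx
    have h1 := hin1 σ hσ k le_rfl _ hx
    rw [← hact] at h1
    by_contra hne'
    apply hxβ
    refine huniq _ ((hs1 _).2 hx) ?_
    rw [hsq]
    have h3 : (σ • x + x + f.coeff 1) * (σ • x - x) = 0 := by
      have : (σ • x + x + f.coeff 1) * (σ • x - x) = aeval (σ • x) f - aeval x f := by
        rw [aeval_f f hf hfdeg, aeval_f f hf hfdeg]; ring
      rw [this, h1, sub_self]
    have h4 : σ • x + x + f.coeff 1 = 0 := by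
      rcases mul_eq_zero.1 h3 with h | h
      · exact h
      · exact absurd (sub_eq_zero.1 h) hne'
    refine Q.neg_mem (Q.mul_mem_left _ ?_)
    have h5 : 2 * x + (f.coeff 1 : 𝓞 K) = - (σ • x - x) := by linear_combination h4
    rw [h5]
    exact Q.neg_mem (AddSubgroup.mem_inertia.1 hσ x)
  -- inertia is nontrivial
  obtain ⟨σ, hσ, hσ1⟩ : ∃ σ ∈ Q.inertia (K ≃ₐ[ℚ] K), σ ≠ 1 := by
    by_contra hcon
    push Not at hcon
    have hem := unram p hp Q hcon T (hTne k)
    obtain ⟨α, hα⟩ : ∃ α : 𝓞 K, aeval α f = β0 := by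
      set F := f.map (Int.castRingHom K) - C (β0 : K) with hF
      have hFdeg : F.natDegree = 2 := by
        rw [hF, natDegree_sub_C, hf.natDegree_map, hfdeg]
      have hdvd : F ∣ (g.comp (polyIter f (k+1))).map (Int.castRingHom K) := by
        have h0 : ((g.comp (polyIter f k)).map (Int.castRingHom K)).IsRoot (β0 : K) := by
          rw [IsRoot, eval_map, ← algebraMap_int_eq, ← aeval_def]
          exact (hcoe _ _).2 ((hs1 _).1 hβ0s)
        obtain ⟨q, hq⟩ := dvd_iff_isRoot.2 h0
        refine ⟨q.comp (f.map (Int.castRingHom K)), ?_⟩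
        have hcomm : g.comp (polyIter f (k+1)) = (g.comp (polyIter f k)).comp f := by
          have : polyIter f (k+1) = (polyIter f k).comp f := by
            exact polyIter_succ_comp f k
          rw [this, comp_assoc]
        rw [hcomm, Polynomial.map_comp, hq, mul_comp]
        simp [hF]
      have hFs : F.Splits := (hsplit (k+1) le_rfl).of_dvd
        ((h_monic f g hf hfdeg hg (k+1)).1.map _).ne_zero hdvd
      obtain ⟨a, ha⟩ := hFs.exists_eval_eq_zero (by
        intro h
        have h0 : F.natDegree = 0 := natDegree_eq_of_degree_eq_some h
        omega)
      have ha2 : aeval a f = (β0 : K) := by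
        rw [hF, eval_sub, eval_C, eval_map, ← algebraMap_int_eq, ← aeval_def, sub_eq_zero] at ha
        exact ha
      obtain ⟨y, rfl⟩ := hlift (k+1) a (by
        rw [hstep, ha2]
        exact (hcoe _ _).2 ((hs1 _).1 hβ0s))
      refine ⟨y, RingOfIntegers.coe_injective ?_⟩
      exact (aeval_algebraMap_apply K y f).symm.trans ha2
    obtain ⟨s', hs'⟩ := Multiset.exists_cons_of_mem hβ0s
    set P := (s'.map (fun β => 4 * (f.coeff 0 : 𝓞 K) - (f.coeff 1 : 𝓞 K) ^ 2 - 4 * β)).prod with hP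
    have hPQ : P ∉ Q := by
      intro h
      obtain ⟨z, hz, hzQ⟩ := (Ideal.IsPrime.multiset_prod_mem_iff_exists_mem hQ1 _).1 h
      obtain ⟨β, hβ, rfl⟩ := Multiset.mem_map.1 hz
      have h1 := huniq β (by rw [hs']; exact Multiset.mem_cons_of_mem hβ) hzQ
      rw [hs', Multiset.nodup_cons] at hsnd
      exact hsnd.1 (h1 ▸ hβ)
    have hTP : (T : 𝓞 K) = (2 * α + f.coeff 1) * (2 * α + f.coeff 1) * (- P) := by
      rw [hprod, hs', Multiset.map_cons, Multiset.prod_cons, ← hP, ← hα, hsq]; ring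
    have hQpr : Prime Q := Ideal.prime_of_isPrime (Ideal.ne_bot_of_liesOver_of_ne_bot
      (p := Ideal.span {(p:ℤ)}) (by simpa using hp.ne_zero) Q) hQ1
    rw [hTP, ← Ideal.span_singleton_mul_span_singleton, ← Ideal.span_singleton_mul_span_singleton,
      emultiplicity_mul hQpr, emultiplicity_mul hQpr,
      emultiplicity_eq_zero.2 (show ¬ Q ∣ Ideal.span {-P} by
        rw [Ideal.dvd_span_singleton]; simpa using hPQ), add_zero] at hem
    obtain ⟨w, hw⟩ := hTodd
    rw [hw] at hem
    cases h : emultiplicity Q (Ideal.span {2 * α + (f.coeff 1 : 𝓞 K)}) with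
    | top =>
      rw [h, top_add] at hem
      exact ENat.natCast_ne_top _ hem.symm
    | coe a =>
      rw [h] at hem
      have : a + a = 2 * w + 1 := by exact_mod_cast hem
      omega
  refine ⟨β0, (hcoe _ _).2 ((hs1 _).1 hβ0s), σ, ?_, ?_⟩
  · intro x hx
    obtain ⟨y, rfl⟩ := hlift k x hx
    exact congrArg (fun z : 𝓞 K => (z : K)) (hin1 σ hσ k le_rfl y ((hcoe _ _).1 hx))
  · -- some root in the fibre of β0 is moved
    have hfc : ∀ y : 𝓞 K, aeval (y : K) f = ((aeval y f : 𝓞 K) : K) := fun y =>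
      (aeval_algebraMap_apply K y f)
    obtain ⟨y0, hy0, hy0m⟩ : ∃ y : 𝓞 K, aeval y (g.comp (polyIter f (k+1))) = 0 ∧ σ • y ≠ y := by
      by_contra hcon
      push Not at hcon
      apply hσ1
      apply hfaith
      intro j hj x hx
      obtain ⟨y, rfl⟩ := hlift j x hx
      rcases Nat.lt_or_ge k j with h | h
      · obtain rfl : j = k + 1 := by omega
        exact congrArg (fun z : 𝓞 K => (z : K)) (hcon y ((hcoe _ _).1 hx))
      · exact congrArg (fun z : 𝓞 K => (z : K)) (hin1 σ hσ j h y ((hcoe _ _).1 hx))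
    have hy0β : aeval y0 f = β0 := by
      by_contra h
      exact hy0m (hin2 σ hσ y0 hy0 h)
    intro x hx
    obtain ⟨y, rfl⟩ := hlift (k+1) x hx
    have hy := (hcoe _ _).1 hx
    constructor
    · intro hfix hβ
      have hfix' : σ • y = y := RingOfIntegers.coe_injective hfix
      have hβ' : aeval y f = β0 := by
        apply RingOfIntegers.coe_injective
        exact (hfc y).symm.trans hβ
      have h1 : (y - y0) * (y + y0 + f.coeff 1) = 0 := by
        have : (y - y0) * (y + y0 + f.coeff 1) = aeval y f - aeval y0 f := by
          rw [aeval_f f hf hfdeg, aeval_f f hf hfdeg]; ring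
        rw [this, hβ', hy0β, sub_self]
      rcases mul_eq_zero.1 h1 with h | h
      · rw [sub_eq_zero] at h
        exact hy0m (h ▸ hfix')
      · apply hy0m
        have h2 : y0 = - y - (f.coeff 1 : ℤ) := by linear_combination h
        have h3 : σ • ((f.coeff 1 : ℤ) : 𝓞 K) = (f.coeff 1 : ℤ) := by
          apply RingOfIntegers.coe_injective
          change σ (((f.coeff 1 : ℤ) : 𝓞 K) : K) = (((f.coeff 1 : ℤ) : 𝓞 K) : K)
          simp
        rw [h2, smul_sub, smul_neg, hfix', h3]
    · intro hβ
      refine congrArg (fun z : 𝓞 K => (z : K)) (hin2 σ hσ y hy ?_)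
      intro h
      exact hβ ((hfc y).trans (by rw [h]))

end InertiaPart


namespace InertiaPart
open Polynomial NumberField CritOrbit

/-- The product of `g ∘ f^j` for `j ≤ n`, over `ℚ`. -/
noncomputable def HH (f g : ℤ[X]) (n : ℕ) : ℚ[X] :=
  ∏ j ∈ Finset.range (n + 1), (g.comp (polyIter f j)).map (Int.castRingHom ℚ)

section
variable (f g : ℤ[X]) (hf : f.Monic) (hfdeg : f.natDegree = 2) (hg : g.Monic)

lemma HH_ne (hf : f.Monic) (hfdeg : f.natDegree = 2) (hg : g.Monic) (n : ℕ) : HH f g n ≠ 0 :=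
  Finset.prod_ne_zero_iff.2 fun j _ => ((h_monic f g hf hfdeg hg j).1.map _).ne_zero

lemma aeval_map_rat {E : Type*} [Field E] [CharZero E] (h : ℤ[X]) (x : E) :
    aeval x (h.map (Int.castRingHom ℚ)) = aeval x h := by
  rw [← algebraMap_int_eq, aeval_map_algebraMap]

lemma splits_of_HH {E : Type*} [Field E] [CharZero E] (hf : f.Monic) (hfdeg : f.natDegree = 2) (hg : g.Monic)
    (n : ℕ) (hs : ((HH f g n).map (algebraMap ℚ E)).Splits) (j : ℕ) (hj : j ≤ n) :
    ((g.comp (polyIter f j)).map (Int.castRingHom E)).Splits := by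
  have h1 : ((g.comp (polyIter f j)).map (Int.castRingHom E)) =
      ((g.comp (polyIter f j)).map (Int.castRingHom ℚ)).map (algebraMap ℚ E) := by
    rw [Polynomial.map_map]
    congr 1
    exact RingHom.ext_int _ _
  rw [h1]
  refine hs.of_dvd ?_ (Polynomial.map_dvd _ (Finset.dvd_prod_of_mem _ (Finset.mem_range.2 (by omega))))
  exact (Polynomial.map_ne_zero_iff (algebraMap ℚ E).injective).2 (HH_ne f g hf hfdeg hg n)

lemma mem_HH {E : Type*} [Field E] [CharZero E] (hf : f.Monic) (hfdeg : f.natDegree = 2) (hg : g.Monic)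
    (n : ℕ) (x : E) :
    x ∈ (HH f g n).rootSet E ↔ ∃ j ≤ n, aeval x (g.comp (polyIter f j)) = 0 := by
  rw [mem_rootSet_of_ne (HH_ne f g hf hfdeg hg n), HH, map_prod, Finset.prod_eq_zero_iff]
  constructor
  · rintro ⟨j, hj, h⟩
    exact ⟨j, by simpa [Nat.lt_succ_iff] using hj, by rwa [aeval_map_rat] at h⟩
  · rintro ⟨j, hj, h⟩
    exact ⟨j, by simpa [Nat.lt_succ_iff] using hj, by rwa [aeval_map_rat]⟩

lemma faith_of_HH {E : Type*} [Field E] [CharZero E] (hf : f.Monic) (hfdeg : f.natDegree = 2) (hg : g.Monic)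
    (n : ℕ) [IsSplittingField ℚ E (HH f g n)] (σ : E ≃ₐ[ℚ] E)
    (h : ∀ j ≤ n, ∀ x : E, aeval x (g.comp (polyIter f j)) = 0 → σ x = x) : σ = 1 := by
  have h1 := IsSplittingField.adjoin_rootSet E (HH f g n)
  have h2 : (σ : E →ₐ[ℚ] E) = AlgHom.id ℚ E := by
    refine AlgHom.ext_of_adjoin_eq_top h1 ?_
    intro x hx
    obtain ⟨j, hj, hx⟩ := (mem_HH f g hf hfdeg hg n x).1 hx
    exact h j hj x hx
  ext x
  exact DFunLike.congr_fun h2 x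

lemma trans_roots {E : Type*} [Field E] [CharZero E] [Normal ℚ E] (h : ℤ[X]) (hm : h.Monic)
    (hirr : Irreducible (h.map (Int.castRingHom ℚ))) (x y : E) (hx : aeval x h = 0)
    (hy : aeval y h = 0) : ∃ σ : E ≃ₐ[ℚ] E, σ x = y := by
  have hmin : ∀ z : E, aeval z h = 0 → minpoly ℚ z = h.map (Int.castRingHom ℚ) := by
    intro z hz
    exact (minpoly.eq_of_irreducible_of_monic hirr (by rwa [aeval_map_rat]) (hm.map _)).symm
  have hc : IsConjRoot ℚ x y := (hmin x hx).trans (hmin y hy).symm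
  obtain ⟨σ, hσ⟩ := isConjRoot_iff_exists_algEquiv.1 hc
  refine ⟨σ.symm, ?_⟩
  rw [← hσ]; simp

end

theorem exists_e_all {L : Type*} [Field L] [NumberField L] [IsGalois ℚ L] (f g : ℤ[X]) (hf : f.Monic)
    (hfdeg : f.natDegree = 2) (hg : g.Monic)
    (γ : ℚ) (hγ : γ = -(f.coeff 1 : ℚ) / 2)
    (hirr : ∀ n : ℕ, Irreducible ((g.comp (polyIter f n)).map (Int.castRingHom ℚ)))
    (hne : ∀ n, 1 ≤ n → aeval (cs f γ n) g ≠ 0)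
    (u v : ℤ[X]) (Δ : ℤ) (hB : u * g + v * derivative g = C Δ) (k : ℕ)
    (hgood : Good (fun n => aeval (cs f γ n) g) Δ (k + 1))
    (hsplit : ((HH f g (k+1)).map (algebraMap ℚ L)).Splits)
    (β : L) (hβ : aeval β (g.comp (polyIter f k)) = 0) :
    ∃ e : L ≃ₐ[ℚ] L,
      (∀ x : L, aeval x (g.comp (polyIter f k)) = 0 → e x = x) ∧
      ∀ x : L, aeval x (g.comp (polyIter f (k + 1))) = 0 → (e x = x ↔ aeval x f ≠ β) := by
  let K := IntermediateField.adjoin ℚ ((HH f g (k+1)).rootSet L)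
  have : IsSplittingField ℚ K (HH f g (k+1)) := IntermediateField.adjoin_rootSet_isSplittingField hsplit
  have : Normal ℚ K := Normal.of_isSplittingField (HH f g (k+1))
  have : IsGalois ℚ K := {}
  have : NumberField K := {}
  obtain ⟨β0, hβ0, e0, he1, he2⟩ := exists_e (K := K) f g hf hfdeg hg γ hγ hirr hne u v Δ hB k hgood
    (splits_of_HH f g hf hfdeg hg (k+1) (IsSplittingField.splits K (HH f g (k+1))))
    (faith_of_HH f g hf hfdeg hg (k+1))
  obtain ⟨e1, he1'⟩ := AlgEquiv.restrictNormalHom_surjective (F := ℚ) (K₁ := K) L e0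
  have hres : ∀ x : K, e1 (x : L) = (e0 x : L) := by
    intro x
    rw [← he1']
    exact (AlgEquiv.restrictNormal_commutes e1 K x).symm
  have hcoe : ∀ (h : ℤ[X]) (x : K), aeval (x : L) h = ((aeval x h : K) : L) := fun h x =>
    aeval_algebraMap_apply L x h
  have hin : ∀ j ≤ k + 1, ∀ x : L, aeval x (g.comp (polyIter f j)) = 0 → x ∈ K := by
    intro j hj x hx
    exact IntermediateField.subset_adjoin _ _ ((mem_HH f g hf hfdeg hg (k+1) x).2 ⟨j, hj, hx⟩)
  have hβ0L : aeval (β0 : L) (g.comp (polyIter f k)) = 0 := by rw [hcoe, hβ0]; rfl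
  obtain ⟨τ, hτ⟩ := trans_roots (E := L) _ (h_monic f g hf hfdeg hg k).1 (hirr k) (β0 : L) β hβ0L hβ
  have hae : ∀ (σ : L ≃ₐ[ℚ] L) (h : ℤ[X]) (x : L), aeval (σ x) h = σ (aeval x h) := fun σ h x =>
    (aeval_algHom_apply ((σ : L →ₐ[ℚ] L).restrictScalars ℤ) (x : L) h)
  have hroot : ∀ (σ : L ≃ₐ[ℚ] L) (h : ℤ[X]) (x : L), aeval x h = 0 → aeval (σ x) h = 0 := by
    intro σ h x hx
    rw [hae, hx, map_zero]
  refine ⟨τ * e1 * τ⁻¹, ?_, ?_⟩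
  · intro x hx
    have h1 : aeval (τ⁻¹ x) (g.comp (polyIter f k)) = 0 := hroot _ _ _ hx
    obtain ⟨y, hy⟩ : ∃ y : K, (y : L) = τ⁻¹ x := ⟨⟨_, hin k (by omega) _ h1⟩, rfl⟩
    have h2 : aeval y (g.comp (polyIter f k)) = 0 := by
      rw [← hy, hcoe] at h1
      exact_mod_cast h1
    change τ (e1 (τ⁻¹ x)) = x
    rw [← hy, hres, he1 y h2, hy]
    exact AlgEquiv.apply_symm_apply τ x
  · intro x hx
    have h1 : aeval (τ⁻¹ x) (g.comp (polyIter f (k+1))) = 0 := hroot _ _ _ hx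
    obtain ⟨y, hy⟩ : ∃ y : K, (y : L) = τ⁻¹ x := ⟨⟨_, hin (k+1) (by omega) _ h1⟩, rfl⟩
    have h2 : aeval y (g.comp (polyIter f (k+1))) = 0 := by
      rw [← hy, hcoe] at h1
      exact_mod_cast h1
    have hx' : x = τ (y : L) := by rw [hy]; exact (AlgEquiv.apply_symm_apply τ x).symm
    have h3 : (τ * e1 * τ⁻¹) x = τ ((e0 y : K) : L) := by
      change τ (e1 (τ⁻¹ x)) = _
      rw [← hy, hres]
    rw [h3, hx', τ.injective.eq_iff, hae, ← hτ, Ne, τ.injective.eq_iff, hcoe]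
    have h4 := he2 y h2
    rw [← Ne]
    constructor
    · intro h hc
      exact h4.1 (Subtype.ext h) (Subtype.ext hc)
    · intro h
      exact congrArg _ (h4.2 (fun hc => h (by rw [hc])))

end InertiaPart


namespace FrobPart
open Polynomial NumberField Pointwise InertiaPart

variable {L : Type*} [Field L] [NumberField L] [IsGalois ℚ L]

/-- The fixed field of `H`. -/
abbrev FF (H : Subgroup (L ≃ₐ[ℚ] L)) : IntermediateField ℚ L := FixedPoints.intermediateField H

lemma under_props (H : Subgroup (L ≃ₐ[ℚ] L)) (p : ℕ) (hp : p.Prime) (P : Ideal (𝓞 L)) [P.IsPrime]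
    [P.LiesOver (Ideal.span {(p:ℤ)})] (hH : MulAction.stabilizer (L ≃ₐ[ℚ] L) P = H) :
    Ideal.absNorm (P.under (𝓞 (FF H))) = p ∧
      (P.under (𝓞 (FF H))).primesOver (𝓞 L) = {P} := by
  subst hH
  have hbot : Ideal.span {(p:ℤ)} ≠ ⊥ := by simpa using hp.ne_zero
  have hPbot : P ≠ ⊥ := Ideal.ne_bot_of_liesOver_of_ne_bot hbot P
  have : P.IsMaximal := Ideal.IsPrime.isMaximal inferInstance hPbot
  set D := FF (MulAction.stabilizer (L ≃ₐ[ℚ] L) P) with hD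
  have : NumberField D := inferInstance
  have : IsDecompositionField ℚ L P D := inferInstance
  have : (P.under (𝓞 D)).IsMaximal := Ideal.IsMaximal.under _ P
  have : (P.under (𝓞 D)).LiesOver (Ideal.span {(p:ℤ)}) := Ideal.LiesOver.tower_bot P _ _
  constructor
  · have h1 := IsDecompositionField.inertiaDeg_eq (A := ℤ) (K := ℚ) (L := L) (P := P) (D := D)
      (𝓞D := 𝓞 D) (𝓟D := P.under (𝓞 D)) hbot
    rw [← Ideal.pow_inertiaDeg p, h1, pow_one]
  · exact IsDecompositionField.primesOver_eq_singleton (K := ℚ) (L := L) (P := P) (D := D)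
      (𝓞D := 𝓞 D) (𝓟D := P.under (𝓞 D))

lemma stab_cyclic (p : ℕ) (hp : p.Prime) (P : Ideal (𝓞 L)) [P.IsPrime]
    [P.LiesOver (Ideal.span {(p:ℤ)})]
    (htriv : ∀ σ : L ≃ₐ[ℚ] L, σ ∈ P.inertia (L ≃ₐ[ℚ] L) → σ = 1) :
    IsCyclic (MulAction.stabilizer (L ≃ₐ[ℚ] L) P) := by
  have hbot : Ideal.span {(p:ℤ)} ≠ ⊥ := by simpa using hp.ne_zero
  have hPbot : P ≠ ⊥ := Ideal.ne_bot_of_liesOver_of_ne_bot hbot P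
  have : P.IsMaximal := Ideal.IsPrime.isMaximal inferInstance hPbot
  have hpp : Prime (p:ℤ) := Nat.prime_iff_prime_int.mp hp
  have hsp : (Ideal.span {(p:ℤ)}).IsPrime := (Ideal.span_singleton_prime hpp.ne_zero).2 hpp
  have : (Ideal.span {(p:ℤ)}).IsMaximal := Ideal.IsPrime.isMaximal inferInstance hbot
  let := Ideal.Quotient.field P
  let := Ideal.Quotient.field (Ideal.span {(p:ℤ)})
  have : Finite (𝓞 L ⧸ P) := Ideal.finiteQuotientOfFreeOfNeBot P hPbot
  refine isCyclic_of_injective (Ideal.Quotient.stabilizerHom P (Ideal.span {(p:ℤ)}) (L ≃ₐ[ℚ] L)) ?_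
  rw [← MonoidHom.ker_eq_bot_iff, Ideal.Quotient.ker_stabilizerHom, eq_bot_iff]
  intro σ hσ
  exact Subgroup.mem_bot.2 (Subtype.ext (htriv σ.1 (AddSubgroup.mem_inertia.2 (AddSubgroup.mem_inertia.1 hσ))))

lemma card_orbit (p : ℕ) (P : Ideal (𝓞 L)) [P.IsPrime]
    [P.LiesOver (Ideal.span {(p:ℤ)})] :
    ((Ideal.span {(p:ℤ)}).primesOver (𝓞 L)).ncard * Nat.card (MulAction.stabilizer (L ≃ₐ[ℚ] L) P)
      = Nat.card (L ≃ₐ[ℚ] L) := by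
  rw [← Algebra.IsInvariant.orbit_eq_primesOver ℤ (𝓞 L) (L ≃ₐ[ℚ] L) (Ideal.span {(p:ℤ)}) P]
  simpa using Nat.card_congr (MulAction.orbitProdStabilizerEquivGroup (L ≃ₐ[ℚ] L) P)

lemma act_aeval (σ : L ≃ₐ[ℚ] L) (h : ℤ[X]) (x : 𝓞 L) : aeval (σ • x) h = σ • aeval x h := by
  apply RingOfIntegers.coe_injective
  rw [← aeval_algebraMap_apply]
  change aeval (σ (x : L)) h = σ ((aeval x h : 𝓞 L) : L)
  rw [show ((aeval x h : 𝓞 L) : L) = aeval (x : L) h from (aeval_algebraMap_apply L x h).symm]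
  exact (aeval_algHom_apply ((σ : L →ₐ[ℚ] L).restrictScalars ℤ) (x : L) h)

lemma stab_fix (p : ℕ) (P : Ideal (𝓞 L)) [P.IsPrime]
    [P.LiesOver (Ideal.span {(p:ℤ)})] (h : ℤ[X]) (hm : h.Monic)
    (hs : (h.map (Int.castRingHom L)).Splits)
    (hdist : ∀ x y : 𝓞 L, aeval x h = 0 → aeval y h = 0 → x - y ∈ P → x = y)
    (a : ℤ) (ha : (p:ℤ) ∣ h.eval a) :
    ∃ β : L, aeval β h = 0 ∧ ∀ σ ∈ MulAction.stabilizer (L ≃ₐ[ℚ] L) P, σ β = β := by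
  obtain ⟨s, hs1, hs2, -⟩ := lift_roots (K := L) h hm hs
  have hprod : ((h.eval a : ℤ) : 𝓞 L) = (s.map (fun β => (a : 𝓞 L) - β)).prod := by
    apply RingOfIntegers.coe_injective
    have h1 := congrArg (eval (a : L)) hs2
    rw [eval_multiset_prod, Multiset.map_map, Multiset.map_map, eval_intCast_map] at h1
    rw [map_multiset_prod, Multiset.map_map]
    simp only [Function.comp_def, map_sub, map_intCast]
    simpa [Function.comp_def] using h1
  have hmem : ((h.eval a : ℤ) : 𝓞 L) ∈ P := (mem_iff p P _).2 ha
  rw [hprod] at hmem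
  obtain ⟨z, hz, hzQ⟩ := (Ideal.IsPrime.multiset_prod_mem_iff_exists_mem inferInstance _).1 hmem
  obtain ⟨β, hβ, rfl⟩ := Multiset.mem_map.1 hz
  have hβ0 := (hs1 β).1 hβ
  refine ⟨β, ?_, ?_⟩
  · rw [show (β : L) = algebraMap (𝓞 L) L β from rfl, aeval_algebraMap_apply, hβ0, map_zero]
  · intro σ hσ
    have h1 : σ • ((a : 𝓞 L) - β) ∈ P := by
      rw [MulAction.mem_stabilizer_iff] at hσ
      have := Ideal.smul_mem_pointwise_smul σ _ _ hzQ
      rwa [hσ] at this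
    have h3 : σ • (a : 𝓞 L) = a := by
      apply RingOfIntegers.coe_injective
      change σ ((a : 𝓞 L) : L) = ((a : 𝓞 L) : L)
      simp
    rw [smul_sub, h3] at h1
    have h4 : σ • β = β := by
      refine hdist _ _ ?_ hβ0 ?_
      · rw [act_aeval, hβ0, smul_zero]
      · have := P.sub_mem hzQ h1
        have h5 : (a : 𝓞 L) - β - (a - σ • β) = σ • β - β := by ring
        rwa [h5] at this
    exact congrArg (fun z : 𝓞 L => (z : L)) h4

open Classical in
/-- Primes over `p` with stabilizer `H`. -/
lemma count_H (H : Subgroup (L ≃ₐ[ℚ] L)) (p : ℕ) (hp : p.Prime) (T : Finset (Ideal (𝓞 L)))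
    (hT : ∀ P ∈ T, P.IsPrime ∧ P.LiesOver (Ideal.span {(p:ℤ)}) ∧
      MulAction.stabilizer (L ≃ₐ[ℚ] L) P = H) :
    T.card ≤ (PrimeIdealBound.ID (FF H) p).card := by
  refine Finset.card_le_card_of_injOn (fun P => P.under (𝓞 (FF H))) ?_ ?_
  · intro P hP
    obtain ⟨h1, h2, h3⟩ := hT P hP
    exact PrimeIdealBound.mem_ID.2 ⟨hp.pos, (under_props H p hp P h3).1⟩
  · intro P hP P' hP' heq
    obtain ⟨h1, h2, h3⟩ := hT P hP
    obtain ⟨h1', h2', h3'⟩ := hT P' hP'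
    have e1 := (under_props H p hp P h3).2
    have e2 : P' ∈ (P.under (𝓞 (FF H))).primesOver (𝓞 L) := by
      simp only at heq
      rw [heq]
      exact ⟨h1', inferInstance⟩
    rw [e1] at e2
    exact e2.symm

end FrobPart


namespace FrobPart
open Polynomial NumberField Pointwise InertiaPart

/-- A cyclic subgroup has many generators. -/
lemma gens_card {G : Type*} [Group G] [Fintype G] [DecidableEq G] [DecidableEq (Subgroup G)]
    (H : Subgroup G) (hc : IsCyclic H) :
    Nat.totient (Nat.card H) ≤ (Finset.univ.filter (fun σ : G => Subgroup.zpowers σ = H)).card := by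
  classical
  have h1 := IsCyclic.card_orderOf_eq_totient (α := H) (d := Fintype.card H) dvd_rfl
  rw [Nat.card_eq_fintype_card, ← h1]
  refine Finset.card_le_card_of_injOn (fun σ : H => (σ : G)) ?_ (fun a _ b _ h => Subtype.ext h)
  intro σ hσ
  simp only [Finset.coe_filter, Finset.mem_univ, true_and, Set.mem_ofPred_eq] at hσ ⊢
  have h2 : Subgroup.zpowers (σ : G) ≤ H := by
    rw [Subgroup.zpowers_le]; exact σ.2
  refine Subgroup.eq_of_le_of_card_ge h2 ?_
  rw [Nat.card_zpowers, Subgroup.orderOf_coe, hσ, Nat.card_eq_fintype_card]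

lemma sum_card_le {G : Type*} [Group G] [Fintype G] (C : ℕ)
    (hC : ∀ σ : G, orderOf σ ≤ C * Nat.totient (orderOf σ)) (T : Finset (Subgroup G)) (F : Finset G)
    (hT : ∀ H ∈ T, IsCyclic H ∧ ∀ σ ∈ H, σ ∈ F) :
    ∑ H ∈ T, Nat.card H ≤ C * F.card := by
  classical
  calc ∑ H ∈ T, Nat.card H ≤ ∑ H ∈ T, C * (F.filter (fun σ : G => Subgroup.zpowers σ = H)).card := by
        refine Finset.sum_le_sum fun H hH => ?_
        obtain ⟨h1, h2⟩ := hT H hH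
        have h3 := gens_card H h1
        obtain ⟨τ, hτ⟩ := (Subgroup.isCyclic_iff_exists_zpowers_eq_top H).1 h1
        have h4 := hC τ
        rw [← Nat.card_zpowers, hτ] at h4
        refine h4.trans (Nat.mul_le_mul_left _ (h3.trans (Finset.card_le_card ?_)))
        intro σ hσ
        simp only [Finset.mem_filter, Finset.mem_univ, true_and] at hσ ⊢
        exact ⟨h2 σ (hσ ▸ Subgroup.mem_zpowers σ), hσ⟩
    _ = C * ∑ H ∈ T, (F.filter (fun σ : G => Subgroup.zpowers σ = H)).card := by rw [Finset.mul_sum]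
    _ ≤ C * F.card := by
        refine Nat.mul_le_mul_left _ ?_
        rw [← Finset.card_biUnion]
        · exact Finset.card_le_card (Finset.biUnion_subset.2 fun H _ => Finset.filter_subset _ _)
        · intro H _ H' _ hne
          rw [Function.onFun, Finset.disjoint_left]
          intro σ h1 h2
          exact hne ((Finset.mem_filter.1 h1).2.symm.trans (Finset.mem_filter.1 h2).2)

variable {L : Type*} [Field L] [NumberField L] [IsGalois ℚ L]

open Classical in
lemma frob_at_p (p : ℕ) (hp : p.Prime) (𝓗 : Finset (Subgroup (L ≃ₐ[ℚ] L)))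
    (hgood : ∀ P : Ideal (𝓞 L), P.IsPrime → P.LiesOver (Ideal.span {(p:ℤ)}) →
      MulAction.stabilizer (L ≃ₐ[ℚ] L) P ∈ 𝓗) :
    Nat.card (L ≃ₐ[ℚ] L) ≤ ∑ H ∈ 𝓗, Nat.card H * (PrimeIdealBound.ID (FF H) p).card := by
  have hbot : Ideal.span {(p:ℤ)} ≠ ⊥ := by simpa using hp.ne_zero
  have hpp : Prime (p:ℤ) := Nat.prime_iff_prime_int.mp hp
  have hsp : (Ideal.span {(p:ℤ)}).IsPrime := (Ideal.span_singleton_prime hpp.ne_zero).2 hpp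
  have : (Ideal.span {(p:ℤ)}).IsMaximal := Ideal.IsPrime.isMaximal inferInstance hbot
  have hfin : ((Ideal.span {(p:ℤ)}).primesOver (𝓞 L)).Finite := 
    IsDedekindDomain.primesOver_finite _ _
  set T := hfin.toFinset with hT
  have hTm : ∀ P ∈ T, P.IsPrime ∧ P.LiesOver (Ideal.span {(p:ℤ)}) := by
    intro P hP
    exact hfin.mem_toFinset.1 hP
  have hTc : ∀ P ∈ T, T.card * Nat.card (MulAction.stabilizer (L ≃ₐ[ℚ] L) P) = Nat.card (L ≃ₐ[ℚ] L) := by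
    intro P hP
    obtain ⟨h1, h2⟩ := hTm P hP
    rw [← card_orbit p P, Set.ncard_eq_toFinset_card _ hfin]
  have hTne : T.Nonempty := by
    obtain ⟨P, hP⟩ := (inferInstance : Nonempty ((Ideal.span {(p:ℤ)}).primesOver (𝓞 L)))
    exact ⟨P, hfin.mem_toFinset.2 hP⟩
  have hsum : ∑ P ∈ T, Nat.card (MulAction.stabilizer (L ≃ₐ[ℚ] L) P) = Nat.card (L ≃ₐ[ℚ] L) := by
    have h1 : T.card * ∑ P ∈ T, Nat.card (MulAction.stabilizer (L ≃ₐ[ℚ] L) P) =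
        T.card * Nat.card (L ≃ₐ[ℚ] L) := by
      rw [Finset.mul_sum, Finset.sum_congr rfl hTc, Finset.sum_const, smul_eq_mul]
    exact Nat.eq_of_mul_eq_mul_left (Finset.card_pos.2 hTne) h1
  rw [← hsum, ← Finset.sum_fiberwise_of_maps_to
    (g := fun P => MulAction.stabilizer (L ≃ₐ[ℚ] L) P) (t := 𝓗)
    (fun P hP => hgood P (hTm P hP).1 (hTm P hP).2)]
  refine Finset.sum_le_sum fun H _ => ?_
  rw [Finset.sum_congr rfl (g := fun _ => Nat.card H) (fun P hP => by rw [(Finset.mem_filter.1 hP).2]),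
    Finset.sum_const, smul_eq_mul, mul_comm]
  refine Nat.mul_le_mul_left _ (count_H H p hp _ ?_)
  intro P hP
  obtain ⟨h1, h2⟩ := Finset.mem_filter.1 hP
  exact ⟨(hTm P h1).1, (hTm P h1).2, h2⟩

open Classical in
/-- Chebotarev-type upper bound. -/
theorem frob_count (h : ℤ[X]) (hm : h.Monic) (hs : (h.map (Int.castRingHom L)).Splits)
    (B : Set ℕ)
    (hB : ∀ p : ℕ, p.Prime → p ∉ B → ∀ P : Ideal (𝓞 L), P.IsPrime →
      P.LiesOver (Ideal.span {(p:ℤ)}) →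
      (∀ σ : L ≃ₐ[ℚ] L, σ ∈ P.inertia (L ≃ₐ[ℚ] L) → σ = 1) ∧
      (∀ x y : 𝓞 L, aeval x h = 0 → aeval y h = 0 → x - y ∈ P → x = y))
    (C : ℕ) (hC : ∀ σ : L ≃ₐ[ℚ] L, orderOf σ ≤ C * Nat.totient (orderOf σ))
    (F : Finset (L ≃ₐ[ℚ] L)) (hF : ∀ σ : L ≃ₐ[ℚ] L, ∀ β : L, aeval β h = 0 → σ β = β → σ ∈ F) :
    ∀ᶠ N : ℕ in Filter.atTop,
      (Nat.card (L ≃ₐ[ℚ] L) : ℝ) *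
        (((Finset.range (N + 1)).filter Nat.Prime).filter
          (fun p => p ∉ B ∧ ∃ a : ℤ, (p:ℤ) ∣ h.eval a)).card ≤
      8 * (C * F.card) * ((Finset.range (N + 1)).filter Nat.Prime).card := by
  have : Fintype (L ≃ₐ[ℚ] L) := Fintype.ofFinite _
  have : Fintype (Subgroup (L ≃ₐ[ℚ] L)) := Fintype.ofFinite _
  set 𝓗 : Finset (Subgroup (L ≃ₐ[ℚ] L)) := Finset.univ.filter
    (fun H => IsCyclic H ∧ ∀ σ ∈ H, σ ∈ F) with h𝓗
  have hsum := sum_card_le C hC 𝓗 F (fun H hH => (Finset.mem_filter.1 hH).2)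
  have hev : ∀ᶠ N : ℕ in Filter.atTop, ∀ H ∈ 𝓗,
      ∑ p ∈ (Finset.range (N + 1)).filter Nat.Prime, ((PrimeIdealBound.ID (FF H) p).card : ℝ) ≤
        8 * ((Finset.range (N + 1)).filter Nat.Prime).card :=
    (Finset.eventually_all 𝓗).2 fun H _ => PrimeIdealBound.prime_sum_bound (FF H)
  filter_upwards [hev] with N hN
  set Q := (Finset.range (N + 1)).filter Nat.Prime with hQ
  set R := Q.filter (fun p => p ∉ B ∧ ∃ a : ℤ, (p:ℤ) ∣ h.eval a) with hR
  have h1 : ∀ p ∈ R, (Nat.card (L ≃ₐ[ℚ] L) : ℝ) ≤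
      ∑ H ∈ 𝓗, (Nat.card H : ℝ) * ((PrimeIdealBound.ID (FF H) p).card : ℝ) := by
    intro p hp
    obtain ⟨hpQ, hpB, a, ha⟩ := Finset.mem_filter.1 hp
    have hpp := (Finset.mem_filter.1 hpQ).2
    have := frob_at_p (L := L) p hpp 𝓗 (by
      intro P hP1 hP2
      obtain ⟨hi, hd⟩ := hB p hpp hpB P hP1 hP2
      refine Finset.mem_filter.2 ⟨Finset.mem_univ _, stab_cyclic p hpp P hi, ?_⟩
      obtain ⟨β, hβ, hfix⟩ := stab_fix p P h hm hs hd a ha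
      exact fun σ hσ => hF σ β hβ (hfix σ hσ))
    exact_mod_cast this
  calc (Nat.card (L ≃ₐ[ℚ] L) : ℝ) * R.card = ∑ p ∈ R, (Nat.card (L ≃ₐ[ℚ] L) : ℝ) := by
        rw [Finset.sum_const, nsmul_eq_mul, mul_comm]
    _ ≤ ∑ p ∈ R, ∑ H ∈ 𝓗, (Nat.card H : ℝ) * ((PrimeIdealBound.ID (FF H) p).card : ℝ) :=
        Finset.sum_le_sum h1
    _ ≤ ∑ p ∈ Q, ∑ H ∈ 𝓗, (Nat.card H : ℝ) * ((PrimeIdealBound.ID (FF H) p).card : ℝ) :=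
        Finset.sum_le_sum_of_subset_of_nonneg (Finset.filter_subset _ _)
          (fun _ _ _ => Finset.sum_nonneg fun _ _ => by positivity)
    _ = ∑ H ∈ 𝓗, (Nat.card H : ℝ) * ∑ p ∈ Q, ((PrimeIdealBound.ID (FF H) p).card : ℝ) := by
        rw [Finset.sum_comm]
        exact Finset.sum_congr rfl fun _ _ => (Finset.mul_sum _ _ _).symm
    _ ≤ ∑ H ∈ 𝓗, (Nat.card H : ℝ) * (8 * (Q.card : ℝ)) :=
        Finset.sum_le_sum fun H hH => mul_le_mul_of_nonneg_left (hN H hH) (by positivity)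
    _ = ((∑ H ∈ 𝓗, Nat.card H : ℕ) : ℝ) * (8 * (Q.card : ℝ)) := by
        rw [← Finset.sum_mul]; push_cast; rfl
    _ ≤ ((C * F.card : ℕ) : ℝ) * (8 * (Q.card : ℝ)) :=
        mul_le_mul_of_nonneg_right (by exact_mod_cast hsum) (by positivity)
    _ = _ := by push_cast; ring

end FrobPart


namespace FinalPart
open Polynomial NumberField InertiaPart CritOrbit

lemma totient_bound (D N n : ℕ) (hD : 0 < D) (hn : n ∣ D * 2 ^ N) : n ≤ (2 * D) * Nat.totient n := by
  have hn0 : 0 < n := Nat.pos_of_dvd_of_pos hn (by positivity)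
  have h1 := Nat.totient_mul_prod_primeFactors n
  have h2 : 0 < ∏ p ∈ n.primeFactors, (p - 1) :=
    Finset.prod_pos fun p hp => Nat.sub_pos_of_lt (Nat.prime_of_mem_primeFactors hp).one_lt
  have h3 : ∏ p ∈ n.primeFactors, p ≤ 2 * D := by
    refine Nat.le_of_dvd (by positivity) ?_
    have h4 : n.primeFactors ⊆ (2 * D).primeFactors := by
      intro p hp
      have hpp := Nat.prime_of_mem_primeFactors hp
      refine Nat.mem_primeFactors.2 ⟨hpp, ?_, by positivity⟩
      rcases (hpp.dvd_mul).1 ((Nat.dvd_of_mem_primeFactors hp).trans hn) with h | h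
      · exact h.mul_left 2
      · exact (hpp.dvd_of_dvd_pow h).mul_right D
    exact (Finset.prod_dvd_prod_of_subset _ _ _ h4).trans (Nat.prod_primeFactors_dvd _)
  calc n ≤ n * ∏ p ∈ n.primeFactors, (p - 1) := Nat.le_mul_of_pos_right _ h2
    _ = n.totient * ∏ p ∈ n.primeFactors, p := h1.symm
    _ ≤ n.totient * (2 * D) := Nat.mul_le_mul_left _ h3
    _ = _ := mul_comm _ _

lemma exists_bezout (h : ℤ[X]) (hirr : Irreducible (h.map (Int.castRingHom ℚ))) :
    ∃ (u v : ℤ[X]) (Δ : ℤ), Δ ≠ 0 ∧ u * h + v * derivative h = C Δ := by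
  obtain ⟨a, b, hab⟩ := hirr.separable
  obtain ⟨c, hc, hca⟩ := IsLocalization.integerNormalization_spec (nonZeroDivisors ℤ) a
  obtain ⟨d, hd, hdb⟩ := IsLocalization.integerNormalization_spec (nonZeroDivisors ℤ) b
  set a' := IsLocalization.integerNormalization (nonZeroDivisors ℤ) a
  set b' := IsLocalization.integerNormalization (nonZeroDivisors ℤ) b
  refine ⟨C d * a', C c * b', c * d, mul_ne_zero (nonZeroDivisors.ne_zero hc)
    (nonZeroDivisors.ne_zero hd), ?_⟩
  apply Polynomial.map_injective (Int.castRingHom ℚ) (RingHom.injective_int _)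
  rw [algebraMap_int_eq] at hca hdb
  rw [derivative_map] at hab
  simp only [Polynomial.map_add, Polynomial.map_mul, map_C, hca, hdb]
  have hc' : c • a = C ((Int.castRingHom ℚ) c) * a := by
    rw [← smul_eq_C_mul]; ext i; simp
  have hd' : d • b = C ((Int.castRingHom ℚ) d) * b := by
    rw [← smul_eq_C_mul]; ext i; simp
  rw [hc', hd', map_mul, C_mul]
  linear_combination (C ((Int.castRingHom ℚ) c) * C ((Int.castRingHom ℚ) d)) * hab

/-- A quadratic map is at most two-to-one. -/
lemma two_to_one {E : Type*} [Field E] (f : ℤ[X]) (hf : f.Monic) (hfdeg : f.natDegree = 2) (x y z : E)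
    (h1 : aeval x f = aeval y f) (h2 : aeval x f = aeval z f) (hxy : x ≠ y) (hxz : x ≠ z) : y = z := by
  rw [aeval_f f hf hfdeg, aeval_f f hf hfdeg] at h1 h2
  have e1 : (x - y) * (x + y + (f.coeff 1 : E)) = 0 := by linear_combination h1
  have e2 : (x - z) * (x + z + (f.coeff 1 : E)) = 0 := by linear_combination h2
  have e3 := (mul_eq_zero.1 e1).resolve_left (sub_ne_zero.2 hxy)
  have e4 := (mul_eq_zero.1 e2).resolve_left (sub_ne_zero.2 hxz)
  linear_combination e3 - e4

lemma step_h {R : Type*} [CommRing R] (f g : ℤ[X]) (k : ℕ) (x : R) :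
    aeval x (g.comp (polyIter f (k+1))) = aeval (aeval x f) (g.comp (polyIter f k)) := by
  rw [aeval_h, aeval_h, Function.iterate_succ_apply]

lemma act_L {E : Type*} [Field E] [CharZero E] (σ : E ≃ₐ[ℚ] E) (h : ℤ[X]) (x : E) :
    aeval (σ x) h = σ (aeval x h) :=
  aeval_algHom_apply ((σ : E →ₐ[ℚ] E).restrictScalars ℤ) x h

lemma pow_fix {E : Type*} [Field E] [CharZero E] (τ : E ≃ₐ[ℚ] E) (x : E) (h : τ x = x) (m : ℕ) :
    (τ ^ m) x = x := by
  induction m with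
  | zero => simp
  | succ m ih => rw [pow_succ, AlgEquiv.mul_apply, h, ih]

section
variable {L : Type*} [Field L] [NumberField L]

lemma fix_level (f g : ℤ[X]) (hf : f.Monic) (hfdeg : f.natDegree = 2) (hg : g.Monic)
    (σ : L ≃ₐ[ℚ] L) (k : ℕ) : ∀ x : L, aeval x (g.comp (polyIter f k)) = 0 →
      (σ ^ (g.natDegree.factorial * 2 ^ k)) x = x := by
  classical
  induction k with
  | zero =>
    intro x hx
    simp only [polyIter, comp_X] at hx
    set G := g.map (Int.castRingHom L) with hG
    have hG0 : G ≠ 0 := (hg.map _).ne_zero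
    have hmem : ∀ i : ℕ, (σ ^ i) x ∈ G.roots.toFinset := by
      intro i
      rw [Multiset.mem_toFinset, mem_roots hG0, IsRoot, hG, eval_map, ← algebraMap_int_eq,
        ← aeval_def, act_L, hx, map_zero]
    have hcard : G.roots.toFinset.card < (Finset.range (g.natDegree + 1)).card := by
      rw [Finset.card_range]
      have h1 := Multiset.toFinset_card_le G.roots
      have h2 := G.card_roots'
      have h3 : G.natDegree = g.natDegree := hg.natDegree_map _
      omega
    obtain ⟨i, hi, j, hj, hij, he⟩ := Finset.exists_ne_map_eq_of_card_lt_of_maps_to hcard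
      (f := fun i => (σ ^ i) x) (fun i _ => hmem i)
    have key : ∀ i j : ℕ, i < j → j ≤ g.natDegree → (σ ^ i) x = (σ ^ j) x →
        (σ ^ (g.natDegree.factorial * 2 ^ 0)) x = x := by
      intro i j hij hj he
      have h1 : (σ ^ (j - i)) x = x := by
        apply (σ ^ i).injective
        rw [he, ← AlgEquiv.mul_apply, ← pow_add]
        congr 2; omega
      obtain ⟨m, hm⟩ := Nat.dvd_factorial (m := j - i) (n := g.natDegree) (by omega) (by omega)
      rw [pow_zero, mul_one, hm, pow_mul]
      exact pow_fix _ x h1 m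
    rw [Finset.mem_range] at hi hj
    rcases lt_or_gt_of_ne hij with h | h
    · exact key i j h (by omega) he
    · exact key j i h (by omega) he.symm
  | succ k ih =>
    intro x hx
    rw [pow_succ, ← mul_assoc, pow_mul]
    set τ := σ ^ (g.natDegree.factorial * 2 ^ k) with hτ
    rw [step_h] at hx
    have h1 := ih _ hx
    rw [pow_two, AlgEquiv.mul_apply]
    by_cases h2 : τ x = x
    · rw [h2, h2]
    · refine (two_to_one f hf hfdeg (τ x) x (τ (τ x)) ?_ ?_ h2 ?_).symm
      · rw [act_L, h1]
      · rw [act_L, act_L, act_L, h1, h1]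
      · intro h3
        exact h2 (τ.injective h3).symm

lemma pow_one_of_split (f g : ℤ[X]) (hf : f.Monic) (hfdeg : f.natDegree = 2) (hg : g.Monic) (N : ℕ)
    [IsSplittingField ℚ L (HH f g N)] (σ : L ≃ₐ[ℚ] L) :
    σ ^ (g.natDegree.factorial * 2 ^ N) = 1 := by
  apply faith_of_HH f g hf hfdeg hg N
  intro j hj x hx
  have h1 := fix_level f g hf hfdeg hg σ j x hx
  obtain ⟨m, hm⟩ : g.natDegree.factorial * 2 ^ j ∣ g.natDegree.factorial * 2 ^ N :=
    mul_dvd_mul_left _ (pow_dvd_pow 2 hj)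
  rw [hm, pow_mul]
  exact pow_fix _ x h1 m

lemma order_bound (f g : ℤ[X]) (hf : f.Monic) (hfdeg : f.natDegree = 2) (hg : g.Monic) (N : ℕ)
    [IsSplittingField ℚ L (HH f g N)] (σ : L ≃ₐ[ℚ] L) :
    orderOf σ ≤ (2 * g.natDegree.factorial) * Nat.totient (orderOf σ) :=
  totient_bound _ N _ (Nat.factorial_pos _)
    (orderOf_dvd_of_pow_eq_one (pow_one_of_split f g hf hfdeg hg N σ))

lemma local_good [IsGalois ℚ L] (f g : ℤ[X]) (hf : f.Monic) (hfdeg : f.natDegree = 2) (hg : g.Monic) (N : ℕ)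
    [IsSplittingField ℚ L (HH f g N)] (u v : ℕ → ℤ[X]) (Δ : ℕ → ℤ)
    (hB : ∀ j, u j * (g.comp (polyIter f j)) + v j * derivative (g.comp (polyIter f j)) = C (Δ j))
    (p : ℕ) (hp : ∀ j ≤ N, ¬ (p:ℤ) ∣ Δ j) (P : Ideal (𝓞 L)) [P.IsPrime]
    [P.LiesOver (Ideal.span {(p:ℤ)})] :
    (∀ σ : L ≃ₐ[ℚ] L, σ ∈ P.inertia (L ≃ₐ[ℚ] L) → σ = 1) ∧
      (∀ x y : 𝓞 L, aeval x (g.comp (polyIter f N)) = 0 → aeval y (g.comp (polyIter f N)) = 0 →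
        x - y ∈ P → x = y) := by
  have hinj : ∀ j ≤ N, ∀ x y : 𝓞 L, aeval x (g.comp (polyIter f j)) = 0 →
      aeval y (g.comp (polyIter f j)) = 0 → x - y ∈ P → x = y := by
    intro j hj x y hx hy hxy
    exact inj_of_bezout P _ (u j) (v j) (Δ j) (hB j) (by rw [mem_iff p]; exact hp j hj) x y hx hy hxy
  refine ⟨?_, hinj N le_rfl⟩
  intro σ hσ
  apply faith_of_HH f g hf hfdeg hg N
  intro j hj x hx
  have hintg : IsIntegral ℤ x := ⟨_, (h_monic f g hf hfdeg hg j).1, by rwa [← aeval_def]⟩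
  let z : 𝓞 L := ⟨x, hintg⟩
  have hz : aeval z (g.comp (polyIter f j)) = 0 := by
    apply RingOfIntegers.coe_injective
    rw [map_zero, ← aeval_algebraMap_apply]
    exact hx
  have h1 := hinj j hj (σ • z) z (by rw [FrobPart.act_aeval, hz, smul_zero]) hz
    (AddSubgroup.mem_inertia.1 hσ z)
  exact congrArg (fun z : 𝓞 L => (z : L)) h1
end

end FinalPart


namespace FinalPart
open Polynomial NumberField InertiaPart CritOrbit

lemma HH_dvd (f g : ℤ[X]) {m n : ℕ} (h : m ≤ n) : HH f g m ∣ HH f g n :=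
  Finset.prod_dvd_prod_of_subset _ _ _ (Finset.range_mono (by omega))

lemma exists_split (q : ℚ[X]) : ∃ (L : Type) (_ : Field L) (_ : NumberField L),
    IsGalois ℚ L ∧ IsSplittingField ℚ L q := by
  have hsp : IsSplittingField ℚ (SplittingField q) q := by
    convert IsSplittingField.splittingField q
    exact Subsingleton.elim _ _
  have hfd : FiniteDimensional ℚ (SplittingField q) := IsSplittingField.finiteDimensional _ q
  have hn : Normal ℚ (SplittingField q) := Normal.of_isSplittingField q
  exact ⟨SplittingField q, inferInstance, ⟨⟩, ⟨⟩, hsp⟩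

lemma arith (d M R Q F : ℕ) (c : ℝ) (hpos : 0 < c) (hx : c * R ≤ 8 * (((2 * d : ℕ) : ℝ) * F) * Q)
    (hs : (M:ℝ) * F ≤ 2 * c) : (M:ℝ) * R ≤ (32 * d : ℕ) * Q := by
  push_cast at hx ⊢
  have hM' : (0:ℝ) ≤ M := by positivity
  have h1 := mul_le_mul_of_nonneg_left hx hM'
  have hd : (0:ℝ) ≤ 16 * d * Q := by positivity
  have h2 := mul_le_mul_of_nonneg_left hs hd
  refine le_of_mul_le_mul_left ?_ hpos
  calc c * ((M:ℝ) * R) = M * (c * R) := by ring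
    _ ≤ _ := h1
    _ = 16 * d * Q * (M * F) := by ring
    _ ≤ _ := h2
    _ = _ := by ring

open Classical in
theorem level_bound (f g : ℤ[X]) (hf : f.Monic) (hfdeg : f.natDegree = 2) (hg : g.Monic)
    (γ : ℚ) (hγ : γ = -(f.coeff 1 : ℚ) / 2)
    (hirr : ∀ n : ℕ, Irreducible ((g.comp (polyIter f n)).map (Int.castRingHom ℚ)))
    (hinf : {q : ℚ | ∃ n : ℕ, 1 ≤ n ∧ aeval (cs f γ n) g = q}.Infinite)
    (hne : ∀ n : ℕ, 1 ≤ n → aeval (cs f γ n) g ≠ 0)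
    (hrigid : ∀ p : ℕ, p.Prime → p ≠ 2 → ∀ n : ℕ, 1 ≤ n → ∀ m : ℕ, 1 ≤ m →
        0 < padicValRat p (aeval (cs f γ n) g) →
        padicValRat p (aeval (cs f γ (m * n)) g) = padicValRat p (aeval (cs f γ n) g))
    (M : ℕ) (hM : 0 < M) :
    ∃ N : ℕ, ∃ B : Set ℕ, B.Finite ∧ ∀ᶠ x : ℕ in Filter.atTop,
      (M : ℝ) * (((Finset.range (x + 1)).filter Nat.Prime).filter
          (fun p => p ∉ B ∧ ∃ a : ℤ, (p:ℤ) ∣ (g.comp (polyIter f N)).eval a)).card ≤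
      (32 * g.natDegree.factorial : ℕ) * ((Finset.range (x + 1)).filter Nat.Prime).card := by
  choose u v Δ hΔ hB using fun j => exists_bezout _ (hirr j)
  have hB0 : u 0 * g + v 0 * derivative g = C (Δ 0) := by
    have := hB 0
    simpa only [polyIter, comp_X] using this
  have hgi := good_infinite f g hf hfdeg hg γ hγ hirr hinf hne hrigid (Δ 0) (hΔ 0)
  obtain ⟨A', hA'sub, hA'card⟩ := hgi.exists_subset_card_eq (2 ^ M * M)
  have hA'1 : ∀ n ∈ A', 1 ≤ n := fun n hn => (hA'sub hn).1
  set A := A'.image (fun n => n - 1) with hA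
  have hAcard : 2 ^ M * M ≤ A.card := by
    rw [hA, Finset.card_image_of_injOn, hA'card]
    intro a ha b hb hab
    have h1 := hA'1 a ha
    have h2 := hA'1 b hb
    simp only at hab
    omega
  have hAgood : ∀ k ∈ A, Good (fun n => aeval (cs f γ n) g) (Δ 0) (k + 1) := by
    intro k hk
    obtain ⟨n, hn, rfl⟩ := Finset.mem_image.1 hk
    have h1 := hA'1 n hn
    rw [Nat.sub_add_cancel h1]
    exact hA'sub hn
  obtain ⟨N, hN⟩ : ∃ N : ℕ, ∀ k ∈ A, k < N :=
    ⟨A.sup id + 1, fun k hk => Nat.lt_succ_of_le (Finset.le_sup (f := id) hk)⟩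
  obtain ⟨L, _, _, _, _⟩ := exists_split (HH f g N)
  have hsplitN : ((HH f g N).map (algebraMap ℚ L)).Splits := IsSplittingField.splits L (HH f g N)
  have hsplit : ∀ m ≤ N, ((HH f g m).map (algebraMap ℚ L)).Splits := by
    intro m hm
    refine hsplitN.of_dvd ?_ (Polynomial.map_dvd _ (HH_dvd f g hm))
    exact (Polynomial.map_ne_zero_iff (algebraMap ℚ L).injective).2 (HH_ne f g hf hfdeg hg N)
  have : Fintype (L ≃ₐ[ℚ] L) := Fintype.ofFinite _
  let S : ℕ → Finset L := fun k => ((g.comp (polyIter f k)).map (Int.castRingHom L)).roots.toFinset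
  have hS : ∀ k x, x ∈ S k ↔ aeval x (g.comp (polyIter f k)) = 0 := by
    intro k x
    rw [Multiset.mem_toFinset, mem_roots ((h_monic f g hf hfdeg hg k).1.map _).ne_zero, IsRoot,
      eval_map, ← algebraMap_int_eq, ← aeval_def]
  have hsmall := TreeGroup.small_fix (G := L ≃ₐ[ℚ] L) S (fun x => aeval x f) N
    (by
      intro k _ σ x hx
      rw [hS] at hx ⊢
      rw [AlgEquiv.smul_def, act_L, hx, map_zero])
    (by
      intro k _ x hx y hy
      rw [hS] at hx hy
      exact trans_roots _ (h_monic f g hf hfdeg hg k).1 (hirr k) x y hx hy)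
    (fun x y z h1 h2 h3 h4 => two_to_one f hf hfdeg x y z h1 h2 h3 h4)
    (fun σ x => act_L σ f x)
    (by
      intro k _ x hx
      rw [hS] at hx ⊢
      rwa [step_h] at hx)
    A hN
    (by
      intro k hk β hβ
      rw [hS] at hβ
      obtain ⟨e, he1, he2⟩ := exists_e_all (L := L) f g hf hfdeg hg γ hγ hirr hne (u 0) (v 0) (Δ 0) hB0 k
        (hAgood k hk) (hsplit (k+1) (hN k hk)) β hβ
      exact ⟨e, fun x hx => he1 x ((hS k x).1 hx), fun x hx => he2 x ((hS (k+1) x).1 hx)⟩)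
    M hM hAcard
  refine ⟨N, {p | ∃ j ≤ N, (p:ℤ) ∣ Δ j}, ?_, ?_⟩
  · have : {p : ℕ | ∃ j ≤ N, (p:ℤ) ∣ Δ j} ⊆ ⋃ j ∈ Finset.range (N+1), {p : ℕ | p ∣ (Δ j).natAbs} := by
      rintro p ⟨j, hj, h⟩
      simp only [Set.mem_iUnion]
      exact ⟨j, Finset.mem_range.2 (by omega), Int.natCast_dvd.1 h⟩
    refine Set.Finite.subset (Set.Finite.biUnion (Finset.finite_toSet _) ?_) this
    intro j _
    refine (Set.finite_Iic (Δ j).natAbs).subset ?_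
    intro p hp
    exact Nat.le_of_dvd (Int.natAbs_pos.2 (hΔ j)) hp
  · have hfc := FrobPart.frob_count (L := L) (g.comp (polyIter f N)) (h_monic f g hf hfdeg hg N).1
      (splits_of_HH f g hf hfdeg hg N hsplitN N le_rfl) {p | ∃ j ≤ N, (p:ℤ) ∣ Δ j}
      (by
        intro p _ hpB P hP1 hP2
        exact local_good f g hf hfdeg hg N u v Δ hB p (fun j hj h => hpB ⟨j, hj, h⟩) P)
      (2 * g.natDegree.factorial) (order_bound f g hf hfdeg hg N)
      (TreeGroup.hasFix (L ≃ₐ[ℚ] L) (S N))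
      (by
        intro σ β hβ hfix
        exact Finset.mem_filter.2 ⟨Finset.mem_univ _, β, (hS N β).2 hβ, hfix⟩)
    filter_upwards [hfc] with x hx
    rw [← Nat.card_eq_fintype_card] at hsmall
    have hpos : (0:ℝ) < Nat.card (L ≃ₐ[ℚ] L) := by exact_mod_cast Nat.card_pos
    have hsmall' : (M:ℝ) * ((TreeGroup.hasFix (L ≃ₐ[ℚ] L) (S N)).card : ℝ) ≤
      2 * (Nat.card (L ≃ₐ[ℚ] L) : ℝ) := by exact_mod_cast hsmall
    exact arith _ M _ _ _ _ hpos hx hsmall'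

end FinalPart


namespace FinalPart
open CritOrbit Polynomial Filter

lemma pi_tendsto : Tendsto (fun x : ℕ => (((Finset.range (x + 1)).filter Nat.Prime).card : ℝ)) atTop atTop := by
  have h : ∀ x : ℕ, (((Finset.range (x + 1)).filter Nat.Prime).card : ℝ) = (Nat.primeCounting x : ℝ) := by
    intro N
    rw [Nat.primeCounting, Nat.primeCounting', Nat.count_eq_card_filter_range]
  simp only [h]
  exact tendsto_natCast_atTop_atTop.comp Nat.tendsto_primeCounting

lemma cover (f g : ℤ[X]) (a₀ : ℤ) (N : ℕ) : ∃ E : Set ℕ, E.Finite ∧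
    ∀ p ∈ transOrbitPrimes g f a₀, p ∈ E ∨ ∃ a : ℤ, (p:ℤ) ∣ (g.comp (polyIter f N)).eval a := by
  refine ⟨{p | ∃ n < N, Polynomial.eval ((fun x => Polynomial.eval x f)^[n] a₀) g ≠ 0 ∧
    (p : ℤ) ∣ Polynomial.eval ((fun x => Polynomial.eval x f)^[n] a₀) g}, ?_, ?_⟩
  · have h : {p : ℕ | ∃ n < N, Polynomial.eval ((fun x => Polynomial.eval x f)^[n] a₀) g ≠ 0 ∧
      (p : ℤ) ∣ Polynomial.eval ((fun x => Polynomial.eval x f)^[n] a₀) g} ⊆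
      ⋃ n ∈ Finset.range N,
        Set.Iic (Polynomial.eval ((fun x => Polynomial.eval x f)^[n] a₀) g).natAbs := by
      rintro p ⟨n, hn, h1, h2⟩
      simp only [Set.mem_iUnion]
      exact ⟨n, Finset.mem_range.2 hn, Nat.le_of_dvd (Int.natAbs_pos.2 h1) (Int.natCast_dvd.1 h2)⟩
    exact Set.Finite.subset (Set.Finite.biUnion (Finset.finite_toSet _)
      fun n _ => Set.finite_Iic _) h
  · rintro p ⟨_, n, h1, h2⟩
    by_cases hn : n < N
    · exact Or.inl ⟨n, hn, h1, h2⟩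
    · refine Or.inr ⟨(fun x => Polynomial.eval x f)^[n - N] a₀, ?_⟩
      have h3 := aeval_h f g N ((fun x => Polynomial.eval x f)^[n - N] a₀)
      simp only [Polynomial.coe_aeval_eq_eval] at h3
      rw [h3, ← Function.iterate_add_apply, show N + (n - N) = n by omega]
      exact h2

end FinalPart

theorem density_zero_of_rigid_divisibility_critical_orbit
    (f g : Polynomial ℤ) (hf : f.Monic) (hfdeg : f.natDegree = 2) (hg : g.Monic)
    (γ : ℚ) (hγ : γ = -(f.coeff 1 : ℚ) / 2)
    (hirr : ∀ n : ℕ, Irreducible ((g.comp (polyIter f n)).map (Int.castRingHom ℚ)))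
    (hinf : {q : ℚ | ∃ n : ℕ, 1 ≤ n ∧
        Polynomial.aeval ((fun x : ℚ => Polynomial.aeval x f)^[n] γ) g = q}.Infinite)
    (hne : ∀ n : ℕ, 1 ≤ n →
        Polynomial.aeval ((fun x : ℚ => Polynomial.aeval x f)^[n] γ) g ≠ 0)
    (hrigid : ∀ p : ℕ, p.Prime → p ≠ 2 → ∀ n : ℕ, 1 ≤ n → ∀ m : ℕ, 1 ≤ m →
        0 < padicValRat p (Polynomial.aeval ((fun x : ℚ => Polynomial.aeval x f)^[n] γ) g) →
        padicValRat p (Polynomial.aeval ((fun x : ℚ => Polynomial.aeval x f)^[m * n] γ) g) =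
          padicValRat p (Polynomial.aeval ((fun x : ℚ => Polynomial.aeval x f)^[n] γ) g))
    (a₀ : ℤ) :
    HasPrimeDensityZero (transOrbitPrimes g f a₀) := by
  classical
  unfold HasPrimeDensityZero
  rw [Metric.tendsto_atTop']
  intro ε hε
  set D : ℝ := ((32 * g.natDegree.factorial : ℕ) : ℝ) with hD
  have hD0 : 0 ≤ D := by positivity
  obtain ⟨M, hM⟩ := exists_nat_gt (2 * D / ε)
  have hMpos : (0:ℝ) < M := lt_of_le_of_lt (by positivity) hM
  have hDM : D / M < ε / 2 := by
    rw [div_lt_iff₀ hMpos]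
    rw [div_lt_iff₀ hε] at hM
    linarith
  obtain ⟨N, B, hBfin, hev⟩ := FinalPart.level_bound f g hf hfdeg hg γ hγ hirr hinf hne hrigid M
    (by exact_mod_cast hMpos)
  obtain ⟨E, hEfin, hcov⟩ := FinalPart.cover f g a₀ N
  set K : ℕ := (hBfin.toFinset ∪ hEfin.toFinset).card with hK
  have hpi := FinalPart.pi_tendsto.eventually_gt_atTop (2 * (K:ℝ) / ε)
  obtain ⟨x₀, hx₀⟩ := Filter.eventually_atTop.1 (hev.and hpi)
  refine ⟨x₀, fun x hx => ?_⟩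
  obtain ⟨h1, h2⟩ := hx₀ x hx.le
  have hpc : primeCount {p | p.Prime} x = ((Finset.range (x + 1)).filter Nat.Prime).card := by
    unfold primeCount
    congr 1
    ext p
    simp
  set Q := ((Finset.range (x + 1)).filter Nat.Prime).card with hQ
  have hQpos : (0:ℝ) < Q := lt_of_le_of_lt (by positivity) h2
  have hle : primeCount (transOrbitPrimes g f a₀) x ≤ K +
      (((Finset.range (x + 1)).filter Nat.Prime).filter
          (fun p => p ∉ B ∧ ∃ a : ℤ, (p:ℤ) ∣ (g.comp (polyIter f N)).eval a)).card := by
    refine le_trans (Finset.card_le_card ?_) (Finset.card_union_le _ _)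
    intro p hp
    obtain ⟨hp1, hp2⟩ := Finset.mem_filter.1 hp
    have hpp : p.Prime := hp2.1
    by_cases hpB : p ∈ B
    · simp [hpB]
    · rcases hcov p hp2 with h | h
      · simp [h]
      · refine Finset.mem_union_right _ (Finset.mem_filter.2 ⟨Finset.mem_filter.2 ⟨hp1, hpp⟩, hpB, h⟩)
  have hle' : (primeCount (transOrbitPrimes g f a₀) x : ℝ) ≤ K +
      ((((Finset.range (x + 1)).filter Nat.Prime).filter
          (fun p => p ∉ B ∧ ∃ a : ℤ, (p:ℤ) ∣ (g.comp (polyIter f N)).eval a)).card : ℝ) := by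
    exact_mod_cast hle
  have h3 : ((((Finset.range (x + 1)).filter Nat.Prime).filter
          (fun p => p ∉ B ∧ ∃ a : ℤ, (p:ℤ) ∣ (g.comp (polyIter f N)).eval a)).card : ℝ) ≤ D / M * Q := by
    rw [div_mul_eq_mul_div, le_div_iff₀ hMpos, mul_comm]
    exact h1
  have h4 : (K:ℝ) < ε / 2 * Q := by
    rw [div_lt_iff₀ hε] at h2
    linarith
  have h5 : D / M * Q ≤ ε / 2 * Q := mul_le_mul_of_nonneg_right hDM.le hQpos.le
  rw [Real.dist_eq, sub_zero, hpc, abs_of_nonneg (by positivity), div_lt_iff₀ hQpos]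
  linarith
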